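/- Let G be a connected affine algebraic group over an algebraically closed field k and F : G → G an isogeny. Consider the action of G on itself by F-conjugation, (g,x) ↦ g·x·F(g)⁻¹. If this action has only finitely many orbits, then it is transitive. -/

import Mathlib

open MvPolynomial Matrix

noncomputable section

/-- Coordinates for `GL n` viewed as a closed subvariety of affine `2n²`-space
via `g ↦ (g, g⁻¹)`. -/
abbrev Coord (n : ℕ) := (Fin n × Fin n) ⊕ (Fin n × Fin n)

def coords {k : Type} [Field k] {n : ℕ} (g : GL (Fin n) k) : Coord n → k :=
  Sum.elim (fun p => (g : Matrix (Fin n) (Fin n) k) p.1 p.2)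
    (fun p => ((g⁻¹ : GL (Fin n) k) : Matrix (Fin n) (Fin n) k) p.1 p.2)

/-- Zariski-closed subsets of `GL n`. -/
def IsZClosed {k : Type} [Field k] {n : ℕ} (S : Set (GL (Fin n) k)) : Prop :=
  ∃ I : Set (MvPolynomial (Coord n) k),
    S = {g | ∀ P ∈ I, MvPolynomial.eval (coords g) P = 0}

/-- Connectedness in the Zariski topology. -/
def IsZConnected {k : Type} [Field k] {n : ℕ} (G : Set (GL (Fin n) k)) : Prop :=
  ∀ S T : Set (GL (Fin n) k), IsZClosed S → IsZClosed T → G ⊆ S ∪ T →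
    G ∩ (S ∩ T) = ∅ → G ∩ S = ∅ ∨ G ∩ T = ∅

/-- A map `GL n → GL m` is regular on `G` if its coordinates are polynomial
functions of the coordinates of the source. -/
def IsRegularMapOn {k : Type} [Field k] {n m : ℕ} (G : Set (GL (Fin n) k))
    (F : GL (Fin n) k → GL (Fin m) k) : Prop :=
  ∃ P : Coord m → MvPolynomial (Coord n) k,
    ∀ g ∈ G, coords (F g) = fun i => MvPolynomial.eval (coords g) (P i)

/-- `F` is an isogeny from the algebraic group `G` onto the algebraic group `H`:
a regular surjective homomorphism of algebraic groups with finite kernel. -/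
structure IsIsogeny {k : Type} [Field k] {n m : ℕ} (G : Subgroup (GL (Fin n) k))
    (H : Subgroup (GL (Fin m) k)) (F : GL (Fin n) k → GL (Fin m) k) : Prop where
  maps : ∀ g ∈ G, F g ∈ H
  hom : ∀ g ∈ G, ∀ h ∈ G, F (g * h) = F g * F h
  regular : IsRegularMapOn (G : Set (GL (Fin n) k)) F
  surj : ∀ h ∈ H, ∃ g ∈ G, F g = h
  finKer : {g : GL (Fin n) k | g ∈ G ∧ F g = 1}.Finite

set_option linter.unusedSectionVars false

namespace FConjugation

section

/-- `A` is the coordinate ring of an irreducible affine algebraic group with group of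
points `Γ`. -/
structure IsCoordRing {k Γ : Type} [Field k] [Group Γ] (A : Subalgebra k (Γ → k)) : Prop where
  fg : A.FG
  mul_eq_zero : ∀ f ∈ A, ∀ g ∈ A, f * g = 0 → f = 0 ∨ g = 0
  comul : ∀ f ∈ A, ∃ (n : ℕ) (a b : Fin n → A),
    ∀ g h, f (g * h) = ∑ i, (a i : Γ → k) g * (b i : Γ → k) h
  inv : ∀ f ∈ A, (fun g => f g⁻¹) ∈ A
  exists_point : ∀ φ : A →ₐ[k] k, ∃ γ, ∀ f : A, φ f = (f : Γ → k) γ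
  separates : ∀ x y : Γ, (∀ f ∈ A, f x = f y) → x = y

variable {k Γ : Type} [Field k] [Group Γ] {A : Subalgebra k (Γ → k)}

/-- A self-map of `Γ` is regular if it pulls `A` back to itself. -/
def IsReg (A : Subalgebra k (Γ → k)) (u : Γ → Γ) : Prop :=
  ∀ f ∈ A, (fun x => f (u x)) ∈ A

/-- The Lang map of an endomorphism. -/
def lang (F : Γ →* Γ) (g : Γ) : Γ := g * (F g)⁻¹

/-- `F` is a regular surjective endomorphism whose Lang map is dominant. -/
structure IsDominant (A : Subalgebra k (Γ → k)) (F : Γ →* Γ) : Prop where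
  reg : IsReg A F
  surj : Function.Surjective F
  dom : ∀ f ∈ A, (∀ g, f (lang F g) = 0) → f = 0

theorem sum_apply_mem {ι : Type} (s : Finset ι) (f : ι → Γ → k) (h : ∀ i ∈ s, f i ∈ A) :
    (fun x => ∑ i ∈ s, f i x) ∈ A := by
  have := A.sum_mem h
  convert this using 1
  ext x; simp

theorem const_mem (c : k) : (fun _ : Γ => c) ∈ A := A.algebraMap_mem c

theorem mul_apply_mem {f g : Γ → k} (hf : f ∈ A) (hg : g ∈ A) : (fun x => f x * g x) ∈ A :=
  A.mul_mem hf hg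

theorem isReg_id : IsReg A (fun x => x) := fun _ hf => hf

theorem isReg_const (c : Γ) : IsReg A (fun _ => c) := fun f _ => const_mem (f c)

theorem IsReg.comp {u w : Γ → Γ} (hu : IsReg A u) (hw : IsReg A w) :
    IsReg A (fun x => u (w x)) := fun f hf => hw _ (hu f hf)

theorem IsReg.iterate {u : Γ → Γ} (hu : IsReg A u) (n : ℕ) : IsReg A (u^[n]) := by
  induction n with
  | zero => exact isReg_id
  | succ n ih => exact ih.comp hu

/-- Pull-back of functions along a regular map. -/
def pull (u : Γ → Γ) (hu : IsReg A u) : A →ₐ[k] A where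
  toFun f := ⟨fun x => (f : Γ → k) (u x), hu f f.2⟩
  map_one' := rfl
  map_mul' _ _ := rfl
  map_zero' := rfl
  map_add' _ _ := rfl
  commutes' _ := rfl

@[simp] theorem pull_apply (u : Γ → Γ) (hu : IsReg A u) (f : A) (x : Γ) :
    (pull u hu f : Γ → k) x = (f : Γ → k) (u x) := rfl

/-- Evaluation at a point. -/
def ev (A : Subalgebra k (Γ → k)) (x : Γ) : A →ₐ[k] k :=
  (Pi.evalAlgHom k (fun _ : Γ => k) x).comp A.val

@[simp] theorem ev_apply (x : Γ) (f : A) : ev A x f = (f : Γ → k) x := rfl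

namespace IsCoordRing

theorem isDomain (hA : IsCoordRing A) : IsDomain A := by
  have : Nontrivial A := ⟨⟨0, 1, fun h => by
    have := congrArg (fun f : A => (f : Γ → k) 1) h
    simp at this⟩⟩
  have : NoZeroDivisors A := ⟨fun {a b} h => by
    rcases hA.mul_eq_zero a a.2 b b.2 (congrArg Subtype.val h) with h | h
    · exact Or.inl (Subtype.ext h)
    · exact Or.inr (Subtype.ext h)⟩
  exact NoZeroDivisors.to_isDomain A

theorem isReg_mul (hA : IsCoordRing A) {u w : Γ → Γ} (hu : IsReg A u) (hw : IsReg A w) :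
    IsReg A (fun x => u x * w x) := by
  intro f hf
  obtain ⟨n, a, b, h⟩ := hA.comul f hf
  simp only [h]
  exact sum_apply_mem _ _ fun i _ => mul_apply_mem (hu _ (a i).2) (hw _ (b i).2)

theorem isReg_inv (hA : IsCoordRing A) {u : Γ → Γ} (hu : IsReg A u) : IsReg A (fun x => (u x)⁻¹) :=
  fun f hf => hu _ (hA.inv f hf)

theorem isReg_lang (hA : IsCoordRing A) {F : Γ →* Γ} (hF : IsReg A F) : IsReg A (lang F) :=
  hA.isReg_mul isReg_id (hA.isReg_inv hF)

/-- The functions `x ↦ f (u g * x * w g)` span a finite-dimensional space. -/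
theorem exists_two_sided (hA : IsCoordRing A) {u w : Γ → Γ} (hu : IsReg A u) (hw : IsReg A w)
    {f : Γ → k} (hf : f ∈ A) : ∃ (ι : Type) (_ : Fintype ι) (α β : ι → A),
      ∀ g x, f (u g * x * w g) = ∑ i, (α i : Γ → k) g * (β i : Γ → k) x := by
  obtain ⟨n, a, b, h⟩ := hA.comul f hf
  choose m c d h' using fun i => hA.comul (a i) (a i).2
  refine ⟨Σ i, Fin (m i), inferInstance,
    fun p => ⟨fun g => (c p.1 p.2 : Γ → k) (u g) * (b p.1 : Γ → k) (w g), ?_⟩,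
    fun p => d p.1 p.2, fun g x => ?_⟩
  · exact mul_apply_mem (hu _ (c p.1 p.2).2) (hw _ (b p.1).2)
  · rw [h, Fintype.sum_sigma]
    refine Finset.sum_congr rfl fun i _ => ?_
    rw [h', Finset.sum_mul]
    exact Finset.sum_congr rfl fun j _ => by ring

theorem exists_ne_zero (hA : IsCoordRing A) {ι : Type} (s : Finset ι) (f : ι → Γ → k)
    (hf : ∀ i ∈ s, f i ∈ A) (h0 : ∀ i ∈ s, f i ≠ 0) : ∃ g, ∀ i ∈ s, f i g ≠ 0 := by
  have := hA.isDomain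
  by_contra! hcon
  have hz : ∏ i ∈ s.attach, (⟨f i, hf i i.2⟩ : A) = 0 := by
    ext g
    obtain ⟨i, hi, h⟩ := hcon g
    have : (ev A g) (∏ i ∈ s.attach, (⟨f i, hf i i.2⟩ : A)) = 0 := by
      rw [map_prod]
      exact Finset.prod_eq_zero (Finset.mem_attach s ⟨i, hi⟩) h
    exact this
  obtain ⟨i, -, hi⟩ := Finset.prod_eq_zero_iff.mp hz
  exact h0 i i.2 (congrArg Subtype.val hi)

end IsCoordRing

/-- A matrix representation with regular coefficients. -/
def IsRegRep {d : ℕ} (A : Subalgebra k (Γ → k)) (ρ : Γ →* Matrix (Fin d) (Fin d) k) : Prop :=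
  ∀ i j, (fun g => ρ g i j) ∈ A

/-- The matrix representation `ρ` is irreducible. -/
structure IsIrred {d : ℕ} (ρ : Γ →* Matrix (Fin d) (Fin d) k) : Prop where
  pos : 0 < d
  eq_bot_or_eq_top : ∀ W : Submodule k (Fin d → k), (∀ g, ∀ v ∈ W, ρ g *ᵥ v ∈ W) →
    W = ⊥ ∨ W = ⊤

theorem rep_mul_inv {d : ℕ} (ρ : Γ →* Matrix (Fin d) (Fin d) k) (g : Γ) :
    ρ g * ρ g⁻¹ = 1 := by rw [← map_mul]; simp

theorem rep_inv_mul {d : ℕ} (ρ : Γ →* Matrix (Fin d) (Fin d) k) (g : Γ) :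
    ρ g⁻¹ * ρ g = 1 := by rw [← map_mul]; simp

theorem det_rep_ne_zero {d : ℕ} (ρ : Γ →* Matrix (Fin d) (Fin d) k) (g : Γ) :
    (ρ g).det ≠ 0 := fun h => by
  have := congrArg Matrix.det (rep_mul_inv ρ g)
  simp [h] at this

/-- The matrix of coefficient functions of a regular representation, composed with a
regular map. -/
def coeffMatrix {d : ℕ} {ρ : Γ →* Matrix (Fin d) (Fin d) k} (hρ : IsRegRep A ρ) {u : Γ → Γ}
    (hu : IsReg A u) : Matrix (Fin d) (Fin d) A :=
  Matrix.of fun i j => ⟨fun g => ρ (u g) i j, hu _ (hρ i j)⟩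

theorem coeffMatrix_map_ev {d : ℕ} {ρ : Γ →* Matrix (Fin d) (Fin d) k} (hρ : IsRegRep A ρ)
    {u : Γ → Γ} (hu : IsReg A u) (g : Γ) : (coeffMatrix hρ hu).map (ev A g) = ρ (u g) := rfl

/-- Matrices over `A` are determined by their values. -/
theorem matrix_ext {m n : Type} {M N : Matrix m n A}
    (h : ∀ g, M.map (ev A g) = N.map (ev A g)) : M = N := by
  ext i j g
  exact congrFun (congrFun (h g) i) j

end

section

/-- The product `M 0 * M 1 * ⋯ * M (n - 1)`. -/
def seqProd {R : Type*} [Monoid R] (M : ℕ → R) : ℕ → R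
  | 0 => 1
  | n + 1 => seqProd M n * M n

theorem seqProd_add {R : Type*} [Monoid R] (M : ℕ → R) (m n : ℕ) :
    seqProd M (m + n) = seqProd M m * seqProd (fun i => M (m + i)) n := by
  induction n with
  | zero => simp [seqProd]
  | succ n ih => rw [← add_assoc, seqProd, ih, mul_assoc]; rfl

theorem seqProd_succ' {R : Type*} [Monoid R] (M : ℕ → R) (n : ℕ) :
    seqProd M (n + 1) = M 0 * seqProd (fun i => M (i + 1)) n := by
  rw [add_comm, seqProd_add]
  simp [seqProd, add_comm]

theorem map_seqProd {R S G : Type*} [Monoid R] [Monoid S] [FunLike G R S]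
    [MonoidHomClass G R S] (f : G) (M : ℕ → R) (n : ℕ) :
    f (seqProd M n) = seqProd (fun i => f (M i)) n := by
  induction n with
  | zero => simp [seqProd]
  | succ n ih => simp [seqProd, ih]

theorem seqProd_smul {R : Type*} {d : ℕ} [CommRing R] (t : ℕ → R)
    (M : ℕ → Matrix (Fin d) (Fin d) R) (n : ℕ) :
    seqProd (fun i => t i • M i) n = seqProd t n • seqProd M n := by
  induction n with
  | zero => simp [seqProd]
  | succ n ih => simp [seqProd, ih, smul_smul, mul_comm]

theorem coeff_charpolyRev_smul {R : Type*} {d : ℕ} [CommRing R] (t : R)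
    (M : Matrix (Fin d) (Fin d) R) (j : ℕ) :
    (t • M).charpolyRev.coeff j = t ^ j * M.charpolyRev.coeff j := by
  have : (t • M).charpolyRev = M.charpolyRev.comp (Polynomial.C t * Polynomial.X) := by
    simp only [Matrix.charpolyRev]
    rw [← Polynomial.coe_compRingHom_apply, RingHom.map_det]
    congr 1
    ext1 i j
    by_cases h : i = j <;> simp [h, RingHom.mapMatrix_apply] <;> ring
  rw [this, Polynomial.comp_C_mul_X_coeff, mul_comm]

theorem isNilpotent_of_coeff_charpolyRev {d : ℕ} {K : Type*} [Field K]
    (M : Matrix (Fin d) (Fin d) K) (h : ∀ j, 1 ≤ j → M.charpolyRev.coeff j = 0) :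
    IsNilpotent M := by
  refine ⟨d, ?_⟩
  have hdeg : M.charpoly.natDegree = d := by simp [Matrix.charpoly_natDegree_eq_dim]
  have : M.charpoly = Polynomial.X ^ d := by
    ext i
    rw [Polynomial.coeff_X_pow]
    split_ifs with hi
    · subst hi
      have := M.charpoly_monic.coeff_natDegree
      rwa [hdeg] at this
    · rcases lt_or_gt_of_ne hi with hi | hi
      · have := h (d - i) (by omega)
        rwa [← Matrix.reverse_charpoly, Polynomial.coeff_reverse, hdeg,
          Polynomial.revAt_le (by omega), Nat.sub_sub_self hi.le] at this
      · exact Polynomial.coeff_eq_zero_of_natDegree_lt (by omega)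
  have h' := M.aeval_self_charpoly
  rwa [this, map_pow, Polynomial.aeval_X] at h'

theorem charpolyRev_conj {d : ℕ} {K : Type*} [Field K]
    (M N N' : Matrix (Fin d) (Fin d) K) (h : N * N' = 1) :
    (N * M * N').charpolyRev = M.charpolyRev := by
  rw [← Matrix.reverse_charpoly, ← Matrix.reverse_charpoly]
  congr 1
  have h' := mul_eq_one_comm.mp h
  rw [Matrix.charpoly_mul_comm, ← mul_assoc, h', one_mul]

section closure

variable {k : Type} [Field k] {d : ℕ}

/-- Variables for sequences of `d × d` matrices. -/
abbrev SeqVar (d : ℕ) := ℕ × Fin d × Fin d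

/-- The entries of a sequence of matrices. -/
def entries {R : Type} (M : ℕ → Matrix (Fin d) (Fin d) R) (v : SeqVar d) : R := M v.1 v.2.1 v.2.2

/-- The Zariski closure of a set of sequences of matrices. -/
def seqClosure (S : Set (ℕ → Matrix (Fin d) (Fin d) k)) :
    Set (ℕ → Matrix (Fin d) (Fin d) k) :=
  {M | ∀ f : MvPolynomial (SeqVar d) k, (∀ N ∈ S, eval (entries N) f = 0) →
    eval (entries M) f = 0}

theorem subset_seqClosure (S : Set (ℕ → Matrix (Fin d) (Fin d) k)) : S ⊆ seqClosure S :=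
  fun M hM _ hf => hf M hM

theorem eval_eq_of_mem_seqClosure {S : Set (ℕ → Matrix (Fin d) (Fin d) k)}
    {f f' : MvPolynomial (SeqVar d) k}
    (h : ∀ N ∈ S, eval (entries N) f = eval (entries N) f')
    {M : ℕ → Matrix (Fin d) (Fin d) k} (hM : M ∈ seqClosure S) :
    eval (entries M) f = eval (entries M) f' := by
  have := hM (f - f') fun N hN => by rw [map_sub, h N hN, sub_self]
  rwa [map_sub, sub_eq_zero] at this

/-- Polynomial maps which send `S` to its closure preserve the closure of `S`. -/
theorem map_mem_seqClosure {S : Set (ℕ → Matrix (Fin d) (Fin d) k)}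
    (u : (ℕ → Matrix (Fin d) (Fin d) k) → (ℕ → Matrix (Fin d) (Fin d) k))
    (U : SeqVar d → MvPolynomial (SeqVar d) k)
    (hU : ∀ M v, eval (entries M) (U v) = entries (u M) v)
    (h : ∀ N ∈ S, u N ∈ seqClosure S) {M : ℕ → Matrix (Fin d) (Fin d) k}
    (hM : M ∈ seqClosure S) : u M ∈ seqClosure S := by
  have key : ∀ f M, eval (entries M) (bind₁ U f) = eval (entries (u M)) f := by
    intro f M
    have h1 : eval (entries M) (bind₁ U f) = eval (fun v => eval (entries M) (U v)) f := by
      rw [eval, eval₂Hom_bind₁]; rfl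
    rw [h1, show (fun v => eval (entries M) (U v)) = entries (u M) from funext (hU M)]
  intro f hf
  rw [← key]
  exact hM _ fun N hN => by rw [key]; exact h N hN f hf

/-- The generic sequence of matrices. -/
def genericSeq (k : Type) [Field k] (d : ℕ) (i : ℕ) :
    Matrix (Fin d) (Fin d) (MvPolynomial (SeqVar d) k) :=
  Matrix.of fun a b => X (i, a, b)

theorem genericSeq_map (M : ℕ → Matrix (Fin d) (Fin d) k) (i : ℕ) :
    (eval (entries M)).mapMatrix (genericSeq k d i) = M i := by
  ext a b
  simp [genericSeq, entries]

/-- A constant matrix, with polynomial entries. -/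
def constMatrix (T : Matrix (Fin d) (Fin d) k) :
    Matrix (Fin d) (Fin d) (MvPolynomial (SeqVar d) k) := T.map C

theorem constMatrix_map (M : ℕ → Matrix (Fin d) (Fin d) k) (T : Matrix (Fin d) (Fin d) k) :
    (eval (entries M)).mapMatrix (constMatrix T) = T := by
  ext a b
  simp [constMatrix]

theorem eval_matrix_apply (M : ℕ → Matrix (Fin d) (Fin d) k)
    (Z : Matrix (Fin d) (Fin d) (MvPolynomial (SeqVar d) k)) (a b : Fin d) :
    eval (entries M) (Z a b) = (eval (entries M)).mapMatrix Z a b := rfl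

theorem mul_mem_seqClosure {S : Set (ℕ → Matrix (Fin d) (Fin d) k)}
    (hS : ∀ M ∈ S, ∀ N ∈ S, (fun i => M i * N i) ∈ S)
    {M N : ℕ → Matrix (Fin d) (Fin d) k} (hM : M ∈ seqClosure S) (hN : N ∈ seqClosure S) :
    (fun i => M i * N i) ∈ seqClosure S := by
  have h1 : ∀ M ∈ S, ∀ N ∈ seqClosure S, (fun i => M i * N i) ∈ seqClosure S := by
    intro M hM N hN
    refine map_mem_seqClosure (fun N i => M i * N i)
      (fun v => (constMatrix (M v.1) * genericSeq k d v.1) v.2.1 v.2.2) ?_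
      (fun N hN => subset_seqClosure _ (hS M hM N hN)) hN
    intro N v
    rw [eval_matrix_apply, map_mul, genericSeq_map, constMatrix_map]
    rfl
  refine map_mem_seqClosure (fun M i => M i * N i)
    (fun v => (genericSeq k d v.1 * constMatrix (N v.1)) v.2.1 v.2.2) ?_
    (fun M hM => h1 M hM N hN) hM
  intro M v
  rw [eval_matrix_apply, map_mul, genericSeq_map, constMatrix_map]
  rfl

theorem shift_mem_seqClosure {S : Set (ℕ → Matrix (Fin d) (Fin d) k)}
    (hS : ∀ M ∈ S, (fun i => M (i + 1)) ∈ S)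
    {M : ℕ → Matrix (Fin d) (Fin d) k} (hM : M ∈ seqClosure S) :
    (fun i => M (i + 1)) ∈ seqClosure S :=
  map_mem_seqClosure (fun M i => M (i + 1)) (fun v => X (v.1 + 1, v.2.1, v.2.2))
    (fun M v => by simp [entries]) (fun M hM => subset_seqClosure _ (hS M hM)) hM

end closure

end

section

theorem coeff_charpolyRev_map {R S : Type*} [CommRing R] [CommRing S] {d : ℕ} (f : R →+* S)
    (M : Matrix (Fin d) (Fin d) R) (j : ℕ) :
    (f.mapMatrix M).charpolyRev.coeff j = f (M.charpolyRev.coeff j) := by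
  have : (f.mapMatrix M).charpolyRev = M.charpolyRev.map f := by
    simp only [Matrix.charpolyRev]
    rw [← Polynomial.coe_mapRingHom, RingHom.map_det]
    congr 1
    ext1 i j
    by_cases h : i = j <;> simp [h, RingHom.mapMatrix_apply]
  rw [this, Polynomial.coeff_map]

theorem seqProd_conj {R : Type*} [Monoid R] {T T' : R} (h : T' * T = 1) (h' : T * T' = 1)
    (M : ℕ → R) (n : ℕ) : seqProd (fun i => T * M i * T') n = T * seqProd M n * T' := by
  induction n with
  | zero => simp [seqProd, h']
  | succ n ih =>
    simp only [seqProd, ih]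
    simp only [← mul_assoc]
    rw [mul_assoc (T * seqProd M n) T' T, h, mul_one]

theorem seqProd_mul_of_periodic {R : Type*} [Monoid R] {T T' : R} (h : T' * T = 1)
    (h' : T * T' = 1) (M : ℕ → R) (m : ℕ) (hM : ∀ i, M (m + i) = T * M i * T') (n : ℕ) :
    seqProd M (m * n) = (seqProd M m * T) ^ n * T' ^ n := by
  induction n with
  | zero => simp [seqProd]
  | succ n ih =>
    rw [mul_add_one, add_comm, seqProd_add]
    simp only [hM]
    rw [seqProd_conj h h', ih, pow_succ' (seqProd M m * T), pow_succ T']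
    simp only [mul_assoc]

variable {k Γ : Type} [Field k] [Group Γ] {A : Subalgebra k (Γ → k)} {F : Γ →* Γ} {d : ℕ}
  {ρ : Γ →* Matrix (Fin d) (Fin d) k}

theorem IsDominant.eq_of_lang (hF : IsDominant A F) {f : Γ → k} (hf : f ∈ A) {c : k}
    (h : ∀ g, f (lang F g) = c) (x : Γ) : f x = c := by
  have := hF.dom (f - fun _ => c) (A.sub_mem hf (const_mem c)) fun g => by simp [h g]
  have := congrFun this x
  simpa [sub_eq_zero] using this

/-- The twisted product `ρ x * ρ (F x) * ⋯ * ρ (F ^ (m - 1) x)`. -/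
def twistedProd (F : Γ →* Γ) (ρ : Γ →* Matrix (Fin d) (Fin d) k) (m : ℕ) (x : Γ) :
    Matrix (Fin d) (Fin d) k := seqProd (fun i => ρ (F^[i] x)) m

theorem iterate_lang (F : Γ →* Γ) (i : ℕ) (g : Γ) :
    F^[i] (lang F g) = F^[i] g * (F^[i + 1] g)⁻¹ := by
  rw [lang, iterate_map_mul, iterate_map_inv, ← Function.iterate_succ_apply]

theorem twistedProd_lang (F : Γ →* Γ) (ρ : Γ →* Matrix (Fin d) (Fin d) k) (m : ℕ) (g : Γ) :
    twistedProd F ρ m (lang F g) = ρ g * ρ (F^[m] g)⁻¹ := by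
  induction m with
  | zero => simp [twistedProd, seqProd, rep_mul_inv]
  | succ m ih =>
    rw [twistedProd] at ih ⊢
    rw [seqProd, ih, iterate_lang, map_mul, ← mul_assoc, mul_assoc (ρ g), rep_inv_mul, mul_one]

/-- The twisted product, with coefficients in `A`. -/
def twistedProdCoeff (hρ : IsRegRep A ρ) (hF : IsReg A F) (m : ℕ) : Matrix (Fin d) (Fin d) A :=
  seqProd (fun i => coeffMatrix hρ (hF.iterate i)) m

theorem twistedProdCoeff_map (hρ : IsRegRep A ρ) (hF : IsReg A F) (m : ℕ) (x : Γ) :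
    (ev A x : A →+* k).mapMatrix (twistedProdCoeff hρ hF m) = twistedProd F ρ m x := by
  have := map_seqProd ((ev A x : A →+* k).mapMatrix (m := Fin d))
    (fun i => coeffMatrix hρ (hF.iterate i)) m
  exact this

/-- Matrices intertwining `ρ` with a twist. -/
structure Intertwines (F : Γ →* Γ) (ρ : Γ →* Matrix (Fin d) (Fin d) k) (m : ℕ)
    (T T' : Matrix (Fin d) (Fin d) k) : Prop where
  pos : 0 < m
  mul_eq_one : T * T' = 1
  mul_eq_one' : T' * T = 1
  comm : ∀ g, T * ρ g = ρ (F^[m] g) * T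

namespace Intertwines

variable {m : ℕ} {T T' : Matrix (Fin d) (Fin d) k}

theorem conj_eq (h : Intertwines F ρ m T T') (g : Γ) : ρ (F^[m] g) = T * ρ g * T' := by
  rw [h.comm, mul_assoc, h.mul_eq_one, mul_one]

theorem twistedProd_lang_mul (h : Intertwines F ρ m T T') (g : Γ) :
    twistedProd F ρ m (lang F g) * T = ρ g * T * ρ g⁻¹ := by
  rw [twistedProd_lang, ← iterate_map_inv, h.conj_eq]
  simp only [mul_assoc, h.mul_eq_one', mul_one]

theorem coeff_charpolyRev (h : Intertwines F ρ m T T') (hρ : IsRegRep A ρ)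
    (hF : IsDominant A F) (x : Γ) (j : ℕ) :
    (twistedProd F ρ m x * T).charpolyRev.coeff j = T.charpolyRev.coeff j := by
  let f : A := (twistedProdCoeff hρ hF.reg m * (algebraMap k A).mapMatrix T).charpolyRev.coeff j
  have hf : ∀ x, (f : Γ → k) x = (twistedProd F ρ m x * T).charpolyRev.coeff j := by
    intro x
    have := coeff_charpolyRev_map (ev A x : A →+* k)
      (twistedProdCoeff hρ hF.reg m * (algebraMap k A).mapMatrix T) j
    rw [map_mul, twistedProdCoeff_map] at this
    rw [← ev_apply]
    refine this.symm.trans ?_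
    congr 3
  rw [← hf]
  refine hF.eq_of_lang f.2 (fun g => ?_) x
  rw [hf, h.twistedProd_lang_mul, charpolyRev_conj _ _ _ (rep_mul_inv ρ g)]

theorem det_twistedProd (h : Intertwines F ρ m T T') (hρ : IsRegRep A ρ)
    (hF : IsDominant A F) (x : Γ) : (twistedProd F ρ m x).det = 1 := by
  let f : A := (twistedProdCoeff hρ hF.reg m).det
  have hf : ∀ x, (f : Γ → k) x = (twistedProd F ρ m x).det := by
    intro x
    have := (ev A x : A →+* k).map_det (twistedProdCoeff hρ hF.reg m)
    rw [twistedProdCoeff_map] at this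
    exact this
  rw [← hf]
  refine hF.eq_of_lang f.2 (fun g => ?_) x
  rw [hf]
  have h1 := congrArg Matrix.det (h.twistedProd_lang_mul g)
  have h2 := congrArg Matrix.det (rep_mul_inv ρ g)
  have h3 := congrArg Matrix.det h.mul_eq_one
  rw [det_mul, det_mul, det_mul] at h1
  rw [det_mul, det_one] at h2 h3
  calc _ = (twistedProd F ρ m (lang F g)).det * T.det * T'.det := by rw [mul_assoc, h3, mul_one]
    _ = (ρ g).det * (ρ g⁻¹).det * (T.det * T'.det) := by rw [h1]; ring
    _ = 1 := by rw [h2, h3, one_mul]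

end Intertwines

/-- The rescalings of the sequences `i ↦ ρ (F ^ i x)`. -/
def orbitSeqs (F : Γ →* Γ) (ρ : Γ →* Matrix (Fin d) (Fin d) k) (m : ℕ) :
    Set (ℕ → Matrix (Fin d) (Fin d) k) :=
  {M | ∃ t : ℕ → k, (∀ i, t (m + i) = t i) ∧ ∃ x, ∀ i, M i = t i • ρ (F^[i] x)}

theorem mem_orbitSeqs (m : ℕ) (x : Γ) : (fun i => ρ (F^[i] x)) ∈ orbitSeqs F ρ m :=
  ⟨fun _ => 1, fun _ => rfl, x, fun i => by simp⟩

theorem mul_mem_orbitSeqs {m : ℕ} : ∀ M ∈ orbitSeqs F ρ m, ∀ N ∈ orbitSeqs F ρ m,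
    (fun i => M i * N i) ∈ orbitSeqs F ρ m := by
  rintro M ⟨t, ht, x, hx⟩ N ⟨s, hs, y, hy⟩
  refine ⟨fun i => t i * s i, fun i => by simp only [ht, hs], x * y, fun i => ?_⟩
  simp only
  rw [hx, hy, iterate_map_mul, map_mul, smul_mul_smul_comm]

theorem shift_mem_orbitSeqs {m : ℕ} : ∀ M ∈ orbitSeqs F ρ m,
    (fun i => M (i + 1)) ∈ orbitSeqs F ρ m := by
  rintro M ⟨t, ht, x, hx⟩
  refine ⟨fun i => t (i + 1), fun i => ht (i + 1), F x, fun i => ?_⟩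
  simp only
  rw [hx, ← Function.iterate_succ_apply]

namespace Intertwines

variable {m : ℕ} {T T' : Matrix (Fin d) (Fin d) k}

theorem periodic (h : Intertwines F ρ m T T') {M : ℕ → Matrix (Fin d) (Fin d) k}
    (hM : M ∈ seqClosure (orbitSeqs F ρ m)) (i : ℕ) : M (m + i) = T * M i * T' := by
  ext a b
  have := eval_eq_of_mem_seqClosure (S := orbitSeqs F ρ m) (f := X (m + i, a, b))
    (f' := (constMatrix T * genericSeq k d i * constMatrix T') a b) ?_ hM
  · rwa [eval_matrix_apply, map_mul, map_mul, constMatrix_map, constMatrix_map, genericSeq_map,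
      eval_X] at this
  · rintro N ⟨t, ht, x, hx⟩
    rw [eval_matrix_apply, map_mul, map_mul, constMatrix_map, constMatrix_map, genericSeq_map,
      eval_X, entries, hx, hx, ht, add_comm, Function.iterate_add_apply, add_comm,
      ← Function.iterate_add_apply, add_comm, Function.iterate_add_apply, h.conj_eq]
    simp

theorem isNilpotent (h : Intertwines F ρ m T T') (hρ : IsRegRep A ρ) (hF : IsDominant A F)
    (hd : 0 < d) {M : ℕ → Matrix (Fin d) (Fin d) k} (hM : M ∈ seqClosure (orbitSeqs F ρ m))
    (hdet : (M 0).det = 0) : IsNilpotent (seqProd M m * T) := by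
  have hprod : ∀ N : ℕ → Matrix (Fin d) (Fin d) k,
      (eval (entries N)).mapMatrix (seqProd (genericSeq k d) m) = seqProd N m := by
    intro N
    have := map_seqProd ((eval (entries N)).mapMatrix (m := Fin d)) (genericSeq k d) m
    refine this.trans ?_
    congr 1
    ext1 i
    exact genericSeq_map N i
  refine isNilpotent_of_coeff_charpolyRev _ fun j hj => ?_
  have key := eval_eq_of_mem_seqClosure (S := orbitSeqs F ρ m)
    (f := ((seqProd (genericSeq k d) m * constMatrix T).charpolyRev.coeff j) ^ d)
    (f' := C (T.charpolyRev.coeff j ^ d) * (seqProd (genericSeq k d) m).det ^ j) ?_ hM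
  · rw [map_pow, map_mul, map_pow _ _ j, ← coeff_charpolyRev_map, map_mul, hprod,
      constMatrix_map, RingHom.map_det, hprod] at key
    have h0 : (seqProd M m).det = 0 := by
      obtain ⟨n, rfl⟩ : ∃ n, m = n + 1 := ⟨m - 1, (Nat.sub_add_cancel h.pos).symm⟩
      rw [seqProd_succ', det_mul, hdet, zero_mul]
    rw [h0, zero_pow (by omega), mul_zero] at key
    exact pow_eq_zero_iff (by omega) |>.mp key
  · rintro N ⟨t, ht, x, hx⟩
    have hN : seqProd N m = seqProd t m • twistedProd F ρ m x := by
      rw [twistedProd, ← seqProd_smul]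
      congr 1
      ext1 i
      exact hx i
    rw [map_pow, map_mul, map_pow _ _ j, ← coeff_charpolyRev_map, map_mul, hprod,
      constMatrix_map, RingHom.map_det, hprod, hN, smul_mul_assoc, coeff_charpolyRev_smul,
      h.coeff_charpolyRev hρ hF, det_smul, h.det_twistedProd hρ hF, eval_C, Fintype.card_fin]
    ring

end Intertwines

end

section

theorem exists_valuationSubring_of_not_isIntegral {R K : Type*} [CommRing R] [Field K]
    [Algebra R K] {x : K} (hx : ¬ IsIntegral R x) :
    ∃ V : ValuationSubring K, (∀ r : R, algebraMap R K r ∈ V) ∧ x ∉ V := by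
  by_contra! hcon
  apply hx
  have h1 : x ∈ (⨅ V : {V : ValuationSubring K //
      ((algebraMap R K).range : Set K) ⊆ V.toSubring}, V.1.toSubring) := by
    rw [Subring.mem_iInf]
    rintro ⟨V, hV⟩
    exact hcon V fun r => hV ⟨r, rfl⟩
  rw [iInf_valuationSubring_superset] at h1
  have h2 : IsIntegral (Subring.closure ((algebraMap R K).range : Set K)) x := h1
  have h3 : ∀ y ∈ Subring.closure ((algebraMap R K).range : Set K), IsIntegral R y := by
    intro y hy
    rw [Subring.closure_eq] at hy
    obtain ⟨r, rfl⟩ := hy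
    exact isIntegral_algebraMap
  let f : R →+* Subring.closure ((algebraMap R K).range : Set K) :=
    (algebraMap R K).codRestrict _ fun r => Subring.subset_closure ⟨r, rfl⟩
  let := f.toAlgebra
  have : IsScalarTower R (Subring.closure ((algebraMap R K).range : Set K)) K :=
    IsScalarTower.of_algebraMap_eq fun r => rfl
  have : Algebra.IsIntegral R (Subring.closure ((algebraMap R K).range : Set K)) :=
    ⟨fun y => (isIntegral_algebraMap_iff (B := K) Subtype.val_injective).mp (h3 y y.2)⟩
  exact isIntegral_trans x h2

theorem exists_algHom_of_ne_top {k B : Type*} [Field k] [IsAlgClosed k] [CommRing B]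
    [Algebra k B] [Algebra.FiniteType k B] {J : Ideal B} (hJ : J ≠ ⊤) :
    ∃ φ : B →ₐ[k] k, ∀ x ∈ J, φ x = 0 := by
  obtain ⟨m, hm, hle⟩ := J.exists_le_maximal hJ
  let : Field (B ⧸ m) := Ideal.Quotient.field m
  have : Module.Finite k (B ⧸ m) := finite_of_finite_type_of_isJacobsonRing k (B ⧸ m)
  have hb := IsAlgClosed.algebraMap_bijective_of_isIntegral (k := k) (K := B ⧸ m)
  let e : k ≃ₐ[k] (B ⧸ m) := AlgEquiv.ofBijective (Algebra.ofId k (B ⧸ m)) hb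
  refine ⟨(e.symm : (B ⧸ m) →ₐ[k] k).comp (Ideal.Quotient.mkₐ k m), fun x hx => ?_⟩
  have : Ideal.Quotient.mkₐ k m x = 0 := Ideal.Quotient.eq_zero_iff_mem.mpr (hle hx)
  rw [AlgHom.comp_apply, this, map_zero]

theorem exists_eq_algebraMap_of_isIntegral {k B : Type*} [Field k] [IsAlgClosed k] [CommRing B]
    [IsDomain B] [Algebra k B] {x : B} (hx : IsIntegral k x) : ∃ c : k, algebraMap k B c = x := by
  have : Algebra.IsIntegral k (Algebra.adjoin k {x}) :=
    Algebra.IsIntegral.adjoin fun y hy => by rwa [Set.mem_singleton_iff.mp hy]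
  obtain ⟨c, hc⟩ := (IsAlgClosed.algebraMap_bijective_of_isIntegral (k := k)
    (K := Algebra.adjoin k {x})).2 ⟨x, Algebra.subset_adjoin rfl⟩
  exact ⟨c, congrArg Subtype.val hc⟩

end

section

variable {k Γ : Type} [Field k] [Group Γ] {A : Subalgebra k (Γ → k)} {F : Γ →* Γ} {d : ℕ}
  {ρ : Γ →* Matrix (Fin d) (Fin d) k}

/-- In an irreducible representation, nonzero matrices can be linked by a group element. -/
theorem IsIrred.exists_mul_mul_ne_zero (hirr : IsIrred ρ) {M N : Matrix (Fin d) (Fin d) k}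
    (hM : M ≠ 0) (hN : N ≠ 0) : ∃ y, M * ρ y * N ≠ 0 := by
  by_contra! hcon
  let W : Submodule k (Fin d → k) := Submodule.span k {w | ∃ y v, w = ρ y *ᵥ (N *ᵥ v)}
  have hW : ∀ g, ∀ v ∈ W, ρ g *ᵥ v ∈ W := by
    intro g v hv
    have : W ≤ W.comap (ρ g).mulVecLin := by
      refine Submodule.span_le.mpr ?_
      rintro _ ⟨y, v, rfl⟩
      refine Submodule.subset_span ⟨g * y, v, ?_⟩
      rw [map_mul]; simp [Matrix.mulVec_mulVec, mul_assoc]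
    exact this hv
  have hker : W ≤ LinearMap.ker M.mulVecLin := by
    refine Submodule.span_le.mpr ?_
    rintro _ ⟨y, v, rfl⟩
    have := congrArg (fun Z => Z *ᵥ v) (hcon y)
    simpa [Matrix.mulVec_mulVec, mul_assoc] using this
  rcases hirr.eq_bot_or_eq_top W hW with h | h
  · apply hN
    ext i j
    have h1 : ρ 1 *ᵥ (N *ᵥ Pi.single j 1) ∈ W := Submodule.subset_span ⟨1, _, rfl⟩
    rw [h, Submodule.mem_bot, map_one, one_mulVec] at h1
    have := congrFun h1 i
    simpa using this
  · apply hM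
    ext i j
    have h1 : (Pi.single j 1 : Fin d → k) ∈ LinearMap.ker M.mulVecLin := hker (h ▸ trivial)
    have := congrFun (LinearMap.mem_ker.mp h1) i
    simpa using this

theorem exists_mul_mul_ne_zero_forall (hA : IsCoordRing A) (hρ : IsRegRep A ρ)
    (hirr : IsIrred ρ) (hF : IsReg A F) (hsurj : Function.Surjective F) (m : ℕ)
    {M : ℕ → Matrix (Fin d) (Fin d) k} (hM : ∀ i, M i ≠ 0) :
    ∃ y, ∀ i < m, M i * ρ (F^[i] y) * M (i + 1) ≠ 0 := by
  have h1 : ∀ i, ∃ a b y, (M i * ρ (F^[i] y) * M (i + 1)) a b ≠ 0 := by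
    intro i
    obtain ⟨z, hz⟩ := hirr.exists_mul_mul_ne_zero (hM i) (hM (i + 1))
    obtain ⟨y, rfl⟩ := hsurj.iterate i z
    by_contra! h
    exact hz (Matrix.ext fun a b => h a b y)
  choose a b y hy using h1
  obtain ⟨g, hg⟩ := hA.exists_ne_zero (Finset.range m)
    (fun i g => (M i * ρ (F^[i] g) * M (i + 1)) (a i) (b i)) (fun i _ => by
      simp only [Matrix.mul_apply]
      exact sum_apply_mem _ _ fun j _ => mul_apply_mem
        (sum_apply_mem _ _ fun l _ => mul_apply_mem (const_mem _) (hF.iterate i _ (hρ l j)))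
        (const_mem _))
    (fun i _ h => hy i (congrFun h (y i)))
  exact ⟨g, fun i hi h => hg i (Finset.mem_range.mpr hi) (by rw [h]; rfl)⟩

theorem ker_le_of_rank_le {M N : Matrix (Fin d) (Fin d) k} (h : N.rank ≤ (M * N).rank)
    (v : Fin d → k) (hv : (M * N) *ᵥ v = 0) : N *ᵥ v = 0 := by
  have h1 : LinearMap.ker N.mulVecLin ≤ LinearMap.ker (M * N).mulVecLin := by
    intro v hv
    simp only [LinearMap.mem_ker, mulVecLin_apply] at hv ⊢
    rw [← mulVec_mulVec, hv, mulVec_zero]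
  have h2 := LinearMap.finrank_range_add_finrank_ker N.mulVecLin
  have h3 := LinearMap.finrank_range_add_finrank_ker (M * N).mulVecLin
  have h4 : LinearMap.ker N.mulVecLin = LinearMap.ker (M * N).mulVecLin := by
    refine Submodule.eq_of_le_of_finrank_le h1 ?_
    simp only [Matrix.rank] at h
    omega
  have : v ∈ LinearMap.ker N.mulVecLin := h4 ▸ (by simpa using hv)
  simpa using this

theorem Intertwines.false_of_degenerate {m : ℕ} {T T' : Matrix (Fin d) (Fin d) k}
    (h : Intertwines F ρ m T T') (hA : IsCoordRing A) (hρ : IsRegRep A ρ)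
    (hF : IsDominant A F) (hirr : IsIrred ρ)
    (hex : ∃ M ∈ seqClosure (orbitSeqs F ρ m), (∀ i, M i ≠ 0) ∧ (M 0).det = 0) : False := by
  let P : ℕ → Prop := fun r => ∃ M ∈ seqClosure (orbitSeqs F ρ m),
    (∀ i, M i ≠ 0) ∧ (M 0).det = 0 ∧ ∑ i ∈ Finset.range m, (M i).rank = r
  have hP : ∃ r, P r := by
    obtain ⟨M, hM, h1, h2⟩ := hex
    exact ⟨_, M, hM, h1, h2, rfl⟩
  classical
  obtain ⟨M, hM, hne, hdet, hsum⟩ := Nat.find_spec hP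
  have hmin : ∀ N ∈ seqClosure (orbitSeqs F ρ m), (∀ i, N i ≠ 0) → (N 0).det = 0 →
      ∑ i ∈ Finset.range m, (M i).rank ≤ ∑ i ∈ Finset.range m, (N i).rank := by
    intro N hN h1 h2
    rw [hsum]
    exact Nat.find_min' hP ⟨N, hN, h1, h2, rfl⟩
  obtain ⟨y, hy⟩ := exists_mul_mul_ne_zero_forall hA hρ hirr hF.reg hF.surj m hne
  have hyc : (fun i => ρ (F^[i] y)) ∈ seqClosure (orbitSeqs F ρ m) :=
    subset_seqClosure _ (mem_orbitSeqs m y)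
  have hQ : (fun i => M i * ρ (F^[i] y)) ∈ seqClosure (orbitSeqs F ρ m) :=
    mul_mem_seqClosure mul_mem_orbitSeqs hM hyc
  have hQM : (fun i => M i * ρ (F^[i] y) * M (i + 1)) ∈ seqClosure (orbitSeqs F ρ m) :=
    mul_mem_seqClosure mul_mem_orbitSeqs hQ (shift_mem_seqClosure shift_mem_orbitSeqs hM)
  have hTinj : ∀ X : Matrix (Fin d) (Fin d) k, T * X * T' = 0 → X = 0 := by
    intro X hX
    calc X = T' * T * X * (T' * T) := by rw [h.mul_eq_one']; simp
      _ = T' * (T * X * T') * T := by simp only [mul_assoc]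
      _ = 0 := by rw [hX]; simp
  have hne' : ∀ i, M i * ρ (F^[i] y) * M (i + 1) ≠ 0 := by
    intro i
    induction i using Nat.strong_induction_on with
    | _ i ih =>
      by_cases hi : i < m
      · exact hy i hi
      · obtain ⟨j, rfl⟩ := Nat.exists_eq_add_of_le (not_lt.mp hi)
        have hp := h.periodic hQM j
        rw [hp]
        exact fun h0 => ih j (by have := h.pos; omega) (hTinj _ h0)
  have hsum' := hmin _ hQM hne' (by simp [det_mul, hdet])
  have hrank : ∀ i, (M i * ρ (F^[i] y) * M (i + 1)).rank ≤ (M (i + 1)).rank := fun i =>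
    Matrix.rank_mul_le_right _ _
  have hUT : IsUnit T.det := IsUnit.of_mul_eq_one T'.det (by
    rw [← det_mul, h.mul_eq_one, det_one])
  have hUT' : IsUnit T'.det := IsUnit.of_mul_eq_one T.det (by
    rw [← det_mul, h.mul_eq_one', det_one])
  have hrankT : ∀ X : Matrix (Fin d) (Fin d) k, (T * X * T').rank = X.rank := fun X => by
    rw [Matrix.rank_mul_eq_left_of_isUnit_det _ _ hUT',
      Matrix.rank_mul_eq_right_of_isUnit_det _ _ hUT]
  have hshift : ∑ i ∈ Finset.range m, (M (i + 1)).rank = ∑ i ∈ Finset.range m, (M i).rank := by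
    have h1 := Finset.sum_range_succ (fun i => (M i).rank) m
    have h2 := Finset.sum_range_succ' (fun i => (M i).rank) m
    have h3 : (M m).rank = (M 0).rank := by
      have := h.periodic hM 0
      rw [add_zero] at this
      rw [this, hrankT]
    omega
  have heq : ∀ i, (M (i + 1)).rank ≤ (M i * ρ (F^[i] y) * M (i + 1)).rank := by
    have h1 : ∀ i ∈ Finset.range m, (M i * ρ (F^[i] y) * M (i + 1)).rank = (M (i + 1)).rank := by
      refine (Finset.sum_eq_sum_iff_of_le fun i _ => hrank i).mp (le_antisymm ?_ ?_)
      · exact Finset.sum_le_sum fun i _ => hrank i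
      · rw [hshift]; exact hsum'
    intro i
    induction i using Nat.strong_induction_on with
    | _ i ih =>
      by_cases hi : i < m
      · exact (h1 i (Finset.mem_range.mpr hi)).ge
      · obtain ⟨j, rfl⟩ := Nat.exists_eq_add_of_le (not_lt.mp hi)
        have hp := h.periodic hQM j
        rw [hp, hrankT, add_assoc, h.periodic hM, hrankT]
        exact ih j (by have := h.pos; omega)
  have hker : ∀ n i v, (seqProd (fun j => M (i + j) * ρ (F^[i + j] y)) n * M (i + n)) *ᵥ v = 0 →
      M (i + n) *ᵥ v = 0 := by
    intro n
    induction n with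
    | zero => intro i v hv; simpa [seqProd] using hv
    | succ n ih =>
      intro i v hv
      have e : i + (n + 1) = i + 1 + n := by ring
      rw [e]
      apply ih
      rw [seqProd_succ'] at hv
      simp only [e, add_zero] at hv
      have e2 : (fun j => M (i + (j + 1)) * ρ (F^[i + (j + 1)] y)) =
          fun j => M (i + 1 + j) * ρ (F^[i + 1 + j] y) := by
        ext1 j
        rw [show i + (j + 1) = i + 1 + j by ring]
      rw [e2] at hv
      cases n with
      | zero =>
        simp only [seqProd, mul_one, add_zero, one_mul] at hv ⊢
        exact ker_le_of_rank_le (heq i) v hv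
      | succ n =>
        rw [seqProd_succ'] at hv ⊢
        simp only [add_zero] at hv ⊢
        set Z := seqProd (fun j => M (i + 1 + (j + 1)) * ρ (F^[i + 1 + (j + 1)] y)) n
        have h2 := ker_le_of_rank_le (heq i)
          ((ρ (F^[i + 1] y) * Z * M (i + 1 + (n + 1))) *ᵥ v) (by
            rw [mulVec_mulVec]
            simpa only [mul_assoc] using hv)
        rw [mulVec_mulVec] at h2
        simpa only [mul_assoc] using h2
  have hnz : ∀ n, seqProd (fun i => M i * ρ (F^[i] y)) n ≠ 0 := by
    intro n h0
    apply hne n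
    ext a b
    have := hker n 0 (Pi.single b 1) (by
      have hz : seqProd (fun i => M (0 + i) * ρ (F^[0 + i] y)) n = 0 := by simpa using h0
      rw [hz, zero_mul, zero_mulVec])
    have := congrFun this a
    simpa using this
  obtain ⟨n, hn⟩ := h.isNilpotent hρ hF hirr.pos hQ (by simp [det_mul, hdet])
  apply hnz (m * n)
  rw [seqProd_mul_of_periodic h.mul_eq_one' h.mul_eq_one _ m (fun i => h.periodic hQ i), hn,
    zero_mul]

end

section

variable {k Γ : Type} [Field k] [Group Γ] {A : Subalgebra k (Γ → k)} {d : ℕ}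
  {ρ : Γ →* Matrix (Fin d) (Fin d) k}

theorem IsIrred.exists_offDiag_ne_zero (hirr : IsIrred ρ) (hd : 2 ≤ d) :
    ∃ a b g, a ≠ b ∧ ρ g a b ≠ 0 := by
  by_contra! hcon
  let i₀ : Fin d := ⟨0, by omega⟩
  let i₁ : Fin d := ⟨1, by omega⟩
  have h01 : i₀ ≠ i₁ := by simp [i₀, i₁]
  let W : Submodule k (Fin d → k) :=
    LinearMap.ker (LinearMap.proj (R := k) (φ := fun _ : Fin d => k) i₀)
  have hW : ∀ v, v ∈ W ↔ v i₀ = 0 := fun v => by simp [W]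
  have hinv : ∀ g, ∀ v ∈ W, ρ g *ᵥ v ∈ W := by
    intro g v hv
    rw [hW] at hv ⊢
    change ∑ j, ρ g i₀ j * v j = 0
    refine Finset.sum_eq_zero fun j _ => ?_
    by_cases hj : i₀ = j
    · rw [← hj, hv, mul_zero]
    · rw [hcon i₀ j g hj, zero_mul]
  rcases hirr.eq_bot_or_eq_top W hinv with h | h
  · have : (Pi.single i₁ 1 : Fin d → k) ∈ (⊥ : Submodule k (Fin d → k)) := by
      rw [← h, hW]
      simp [h01]
    have := congrFun ((Submodule.mem_bot k).mp this) i₁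
    simp at this
  · have : (Pi.single i₀ 1 : Fin d → k) ∈ (⊤ : Submodule k (Fin d → k)) := trivial
    rw [← h, hW] at this
    simp at this

/-- Elements of a valuation ring over an algebraically closed field can be specialised. -/
theorem exists_algHom_adjoin [IsAlgClosed k] {Q : Type} [Field Q] [Algebra k Q]
    (V : ValuationSubring Q) (hk : ∀ c, algebraMap k Q c ∈ V) {s : Set Q} (hs : s.Finite)
    (hsV : s ⊆ V) : ∃ B : Subalgebra k Q, s ⊆ B ∧ ∃ φ : B →ₐ[k] k,
      ∀ x : B, V.valuation (x : Q) < 1 → φ x = 0 := by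
  have hle : ∀ x ∈ Algebra.adjoin k s, V.valuation x ≤ 1 := by
    intro x hx
    rw [ValuationSubring.valuation_le_one_iff]
    induction hx using Algebra.adjoin_induction with
    | mem x hx => exact hsV hx
    | algebraMap c => exact hk c
    | add x y _ _ hx hy => exact V.add_mem _ _ hx hy
    | mul x y _ _ hx hy => exact V.mul_mem _ _ hx hy
  let J : Ideal (Algebra.adjoin k s) :=
    { carrier := {x | V.valuation (x : Q) < 1}
      add_mem' := fun {a b} ha hb =>
        (V.valuation.map_add (a : Q) b).trans_lt (max_lt ha hb)
      zero_mem' := by simp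
      smul_mem' := fun c x hx => by
        simp only [Set.mem_ofPred_eq, smul_eq_mul, MulMemClass.coe_mul, map_mul] at hx ⊢
        exact (mul_le_of_le_one_left' (hle c c.2)).trans_lt hx }
  have hJ : J ≠ ⊤ := by
    rw [Ideal.ne_top_iff_one]
    simp [J]
  have : Algebra.FiniteType k (Algebra.adjoin k s) :=
    (Subalgebra.fg_iff_finiteType (Algebra.adjoin k s)).mp ⟨hs.toFinset, by simp⟩
  obtain ⟨φ, hφ⟩ := exists_algHom_of_ne_top (k := k) hJ
  exact ⟨Algebra.adjoin k s, Algebra.subset_adjoin, φ, fun x hx => hφ x hx⟩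


namespace Intertwines

variable {m : ℕ} {T T' : Matrix (Fin d) (Fin d) k} {F : Γ →* Γ}

/-- The closure of `orbitSeqs` contains all specialisations of rescaled generic points. -/
theorem mem_seqClosure_of_algHom (hA : IsCoordRing A) [Infinite k] (hρ : IsRegRep A ρ)
    (hF : IsReg A F) (m : ℕ) {Q : Type} [Field Q] [Algebra k Q] (ψ : A →ₐ[k] Q)
    (t : ℕ → Q) {B : Subalgebra k Q} (N : ℕ → Matrix (Fin d) (Fin d) B)
    (hN : ∀ i, (N i).map B.val = t (i % m) • (coeffMatrix hρ (hF.iterate i)).map ψ)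
    (φ : B →ₐ[k] k) : (fun i => (N i).map φ) ∈ seqClosure (orbitSeqs F ρ m) := by
  have := hA.isDomain
  intro f hf
  let g : MvPolynomial ℕ A :=
    aeval (fun v : SeqVar d => X (v.1 % m) * C (coeffMatrix hρ (hF.iterate v.1) v.2.1 v.2.2)) f
  have hg : g = 0 := by
    have h1 : ∀ x, map (ev A x : A →+* k) g = 0 := by
      intro x
      apply MvPolynomial.funext
      intro τ
      have h2 : eval (entries fun i => τ (i % m) • ρ (F^[i] x)) f = 0 :=
        hf _ ⟨fun i => τ (i % m), fun i => by simp, x, fun i => rfl⟩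
      rw [map_zero, ← h2]
      let Θ : MvPolynomial ℕ A →ₐ[k] k :=
        { (eval τ).comp (map (ev A x : A →+* k)) with
          commutes' := fun c => by
            simp [IsScalarTower.algebraMap_apply k A (MvPolynomial ℕ A)] }
      have h3 : Θ g = aeval (fun v => Θ (X (v.1 % m) *
          C (coeffMatrix hρ (hF.iterate v.1) v.2.1 v.2.2))) f := by
        rw [← MvPolynomial.comp_aeval_apply]
      refine h3.trans ?_
      rw [MvPolynomial.aeval_eq_eval]
      congr 2
      ext v
      simp [Θ, entries, coeffMatrix]
    ext e x
    have := congrArg (coeff e) (h1 x)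
    simpa [coeff_map] using this
  have h4 : aeval (fun v : SeqVar d => N v.1 v.2.1 v.2.2) f = 0 := by
    apply Subtype.val_injective
    let Θ : MvPolynomial ℕ A →ₐ[k] Q :=
      { eval₂Hom (ψ : A →+* Q) t with
        commutes' := fun c => by
          simp [IsScalarTower.algebraMap_apply k A (MvPolynomial ℕ A)] }
    have h5 : Θ g = aeval (fun v => Θ (X (v.1 % m) *
        C (coeffMatrix hρ (hF.iterate v.1) v.2.1 v.2.2))) f := by
      rw [← MvPolynomial.comp_aeval_apply]
    have h6 : B.val (aeval (fun v : SeqVar d => N v.1 v.2.1 v.2.2) f) =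
        aeval (fun v : SeqVar d => B.val (N v.1 v.2.1 v.2.2)) f :=
      MvPolynomial.comp_aeval_apply _ _ _
    refine h6.trans (Eq.trans ?_ (h5.symm.trans (by rw [hg, map_zero]; rfl)))
    congr 2
    ext v
    have := congrFun (congrFun (hN v.1) v.2.1) v.2.2
    simpa [Θ] using this
  have h7 := MvPolynomial.comp_aeval_apply (fun v : SeqVar d => N v.1 v.2.1 v.2.2) φ f
  rw [h4, map_zero, MvPolynomial.aeval_eq_eval] at h7
  exact h7.symm

/-- If `d ≥ 2`, some coefficient of `ρ`, normalised by the determinant, is not a constant. -/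
theorem _root_.FConjugation.exists_not_isIntegral [IsAlgClosed k] (hA : IsCoordRing A)
    (hρ : IsRegRep A ρ) (hirr : IsIrred ρ) (hd : 2 ≤ d) {Q : Type} [Field Q] [Algebra k Q]
    (ψ : A →ₐ[k] Q) (hψ : Function.Injective ψ) :
    ∃ a b, ¬ IsIntegral k ((ψ (coeffMatrix hρ isReg_id a b)) ^ d *
      (((coeffMatrix hρ isReg_id).map ψ).det)⁻¹) := by
  have := hA.isDomain
  obtain ⟨a, b, g, hab, hg⟩ := hirr.exists_offDiag_ne_zero hd
  refine ⟨a, b, fun hintg => ?_⟩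
  have hreg := hA.isReg_inv (isReg_id (A := A))
  have hdet : (coeffMatrix hρ isReg_id).det * (coeffMatrix hρ hreg).det = 1 := by
    rw [← det_mul, ← det_one (n := Fin d)]
    congr 1
    refine matrix_ext fun g => ?_
    rw [Matrix.map_mul, coeffMatrix_map_ev, coeffMatrix_map_ev, rep_mul_inv,
      Matrix.map_one _ (map_zero _) (map_one _)]
  have hψdet : (((coeffMatrix hρ isReg_id).map ψ).det)⁻¹ = ψ (coeffMatrix hρ hreg).det := by
    apply inv_eq_of_mul_eq_one_right
    rw [← AlgHom.mapMatrix_apply, ← AlgHom.map_det, ← map_mul, hdet, map_one]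
  rw [hψdet, ← map_pow, ← map_mul, isIntegral_algHom_iff ψ hψ] at hintg
  obtain ⟨c, hc⟩ := exists_eq_algebraMap_of_isIntegral hintg
  have hval : ∀ x, c = (ρ x a b) ^ d * (ev A x) (coeffMatrix hρ hreg).det := by
    intro x
    have := congrArg (ev A x) hc
    rw [AlgHom.commutes, map_mul, map_pow] at this
    exact this
  have h1 := hval 1
  rw [map_one, Matrix.one_apply_ne hab, zero_pow (by omega), zero_mul] at h1
  have h2 := hval g
  rw [h1] at h2
  have h3 := congrArg (ev A g) hdet
  rw [map_mul, map_one] at h3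
  rcases mul_eq_zero.mp h2.symm with h | h
  · exact hg (pow_eq_zero_iff (by omega) |>.mp h)
  · rw [h, mul_zero] at h3
    exact zero_ne_one h3

theorem exists_degenerate [IsAlgClosed k] (h : Intertwines F ρ m T T') (hA : IsCoordRing A)
    (hρ : IsRegRep A ρ) (hF : IsReg A F) (hirr : IsIrred ρ) (hd : 2 ≤ d) :
    ∃ M ∈ seqClosure (orbitSeqs F ρ m), (∀ i, M i ≠ 0) ∧ (M 0).det = 0 := by
  have := hA.isDomain
  have hm := h.pos
  obtain ⟨Q, _, _, ψ, hψ⟩ : ∃ (Q : Type) (_ : Field Q) (_ : Algebra k Q) (ψ : A →ₐ[k] Q),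
      Function.Injective ψ :=
    ⟨FractionRing A, inferInstance, inferInstance, IsScalarTower.toAlgHom k A (FractionRing A),
      IsFractionRing.injective A (FractionRing A)⟩
  let C : ℕ → Matrix (Fin d) (Fin d) Q := fun i => (coeffMatrix hρ (hF.iterate i)).map ψ
  obtain ⟨a, b, hab⟩ := exists_not_isIntegral hA hρ hirr hd ψ hψ
  obtain ⟨V, hkV, hV⟩ := exists_valuationSubring_of_not_isIntegral hab
  have hC0 : ∀ i, C i ≠ 0 := by
    intro i h0
    have h1 : coeffMatrix hρ (hF.iterate i) = 0 := by
      ext1 a b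
      exact hψ ((congrFun (congrFun h0 a) b).trans (map_zero ψ).symm)
    have h2 := coeffMatrix_map_ev hρ (hF.iterate i) 1
    rw [h1, Matrix.map_zero _ (map_zero _)] at h2
    apply det_rep_ne_zero ρ (F^[i] 1)
    have : Nonempty (Fin d) := ⟨⟨0, hirr.pos⟩⟩
    rw [← h2, det_zero]
  have hmax : ∀ i, ∃ p : Fin d × Fin d, ∀ q : Fin d × Fin d,
      V.valuation (C i q.1 q.2) ≤ V.valuation (C i p.1 p.2) := by
    intro i
    have : Nonempty (Fin d × Fin d) := ⟨⟨⟨0, hirr.pos⟩, ⟨0, hirr.pos⟩⟩⟩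
    exact Finite.exists_max fun p : Fin d × Fin d => V.valuation (C i p.1 p.2)
  choose p hp using hmax
  let s : ℕ → Q := fun i => C i (p i).1 (p i).2
  have hs : ∀ i, s i ≠ 0 := by
    intro i h0
    apply hC0 i
    ext a b
    have := hp i (a, b)
    change V.valuation (C i a b) ≤ V.valuation (s i) at this
    rw [h0, map_zero, le_zero_iff, map_eq_zero] at this
    exact this
  let t : ℕ → Q := fun i => (s i)⁻¹
  let N : ℕ → Matrix (Fin d) (Fin d) Q := fun i => t (i % m) • C i
  have hNV : ∀ i < m, ∀ a b, V.valuation (N i a b) ≤ 1 := by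
    intro i hi a b
    change V.valuation (t (i % m) * C i a b) ≤ 1
    rw [Nat.mod_eq_of_lt hi, map_mul, map_inv₀]
    have h1 : V.valuation (s i) ≠ 0 := (map_ne_zero _).mpr (hs i)
    calc _ ≤ (V.valuation (s i))⁻¹ * V.valuation (s i) := mul_le_mul_right (hp i (a, b)) _
      _ = 1 := inv_mul_cancel₀ h1
  have hper : ∀ i, N (m + i) = T.map (algebraMap k Q) * N i * T'.map (algebraMap k Q) := by
    intro i
    have h1 : coeffMatrix hρ (hF.iterate (m + i)) =
        T.map (algebraMap k A) * coeffMatrix hρ (hF.iterate i) * T'.map (algebraMap k A) := by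
      refine matrix_ext fun g => ?_
      have e : ∀ X : Matrix (Fin d) (Fin d) k, (X.map (algebraMap k A)).map (ev A g) = X := by
        intro X
        ext
        simp
      rw [Matrix.map_mul, Matrix.map_mul, e, e, coeffMatrix_map_ev, coeffMatrix_map_ev,
        Function.iterate_add_apply, h.conj_eq]
    have e : ∀ X : Matrix (Fin d) (Fin d) k,
        (X.map (algebraMap k A)).map ψ = X.map (algebraMap k Q) := by
      intro X
      ext
      simp
    change t ((m + i) % m) • (coeffMatrix hρ (hF.iterate (m + i))).map ψ =
      _ * (t (i % m) • C i) * _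
    rw [h1, Matrix.map_mul, Matrix.map_mul, e, e, Nat.add_mod_left]
    simp [C]
  let S : Set Q := Set.range fun q : Fin m × Fin d × Fin d => N q.1 q.2.1 q.2.2
  obtain ⟨B, hSB, φ, hφ⟩ := exists_algHom_adjoin V hkV (Set.finite_range _ : S.Finite) (by
    rintro _ ⟨q, rfl⟩
    exact (V.valuation_le_one_iff _).mp (hNV q.1 q.1.2 _ _))
  have hNB : ∀ i a b, N i a b ∈ B := by
    intro i
    induction i using Nat.strong_induction_on with
    | _ i ih =>
      by_cases hi : i < m
      · exact fun a b => hSB ⟨(⟨i, hi⟩, a, b), rfl⟩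
      · obtain ⟨j, rfl⟩ := Nat.exists_eq_add_of_le (not_lt.mp hi)
        intro a b
        rw [hper, Matrix.mul_apply]
        refine B.sum_mem fun c _ => B.mul_mem ?_ (B.algebraMap_mem _)
        rw [Matrix.mul_apply]
        exact B.sum_mem fun c _ => B.mul_mem (B.algebraMap_mem _) (ih j (by omega) _ _)
  let N' : ℕ → Matrix (Fin d) (Fin d) B := fun i => Matrix.of fun a b => ⟨N i a b, hNB i a b⟩
  refine ⟨_, mem_seqClosure_of_algHom hA hρ hF m ψ t N' (fun i => rfl) φ, ?_, ?_⟩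
  · have hM := mem_seqClosure_of_algHom hA hρ hF m ψ t N' (fun i => rfl) φ
    intro i
    induction i using Nat.strong_induction_on with
    | _ i ih =>
      by_cases hi : i < m
      · intro h0
        have h1 := congrFun (congrFun h0 (p i).1) (p i).2
        have h2 : N' i (p i).1 (p i).2 = 1 := by
          apply Subtype.ext
          change t (i % m) * s i = 1
          rw [Nat.mod_eq_of_lt hi]
          exact inv_mul_cancel₀ (hs i)
        simp [h2] at h1
      · obtain ⟨j, rfl⟩ := Nat.exists_eq_add_of_le (not_lt.mp hi)
        rw [h.periodic hM j]
        intro h0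
        apply ih j (by omega)
        calc (N' j).map φ = T' * T * (N' j).map φ * (T' * T) := by rw [h.mul_eq_one']; simp
          _ = T' * (T * (N' j).map φ * T') * T := by simp only [mul_assoc]
          _ = 0 := by rw [h0]; simp
  · have h0 : φ (N' 0).det = ((N' 0).map φ).det := AlgHom.map_det φ (N' 0)
    refine h0.symm.trans (hφ (N' 0).det ?_)
    have h1 : ((N' 0).det : Q) = (N 0).det := by
      have := AlgHom.map_det B.val (N' 0)
      exact this
    rw [h1]
    have h2 : (N 0).det = (s 0)⁻¹ ^ d * (C 0).det := by
      change (t (0 % m) • C 0).det = _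
      rw [Nat.zero_mod, det_smul, Fintype.card_fin]
    have hC0det : (C 0).det ≠ 0 := by
      intro h0
      apply hV
      change _ * ((C 0).det)⁻¹ ∈ V
      rw [h0, _root_.inv_zero, mul_zero]
      exact V.zero_mem
    rw [← ValuationSubring.valuation_le_one_iff, not_le] at hV
    have h3 : V.valuation (C 0 a b ^ d * ((C 0).det)⁻¹) ≤
        V.valuation (s 0 ^ d * ((C 0).det)⁻¹) := by
      rw [map_mul, map_mul, map_pow, map_pow]
      exact mul_le_mul_left (pow_le_pow_left' (hp 0 (a, b)) d) _
    have h4 : 1 < V.valuation (s 0 ^ d * ((C 0).det)⁻¹) := hV.trans_le h3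
    have h5 : (N 0).det = (s 0 ^ d * ((C 0).det)⁻¹)⁻¹ := by
      rw [h2, mul_inv, inv_inv, inv_pow]
    rw [h5, map_inv₀]
    exact inv_lt_one_of_one_lt₀ h4

theorem dim_le_one [IsAlgClosed k] (h : Intertwines F ρ m T T') (hA : IsCoordRing A)
    (hρ : IsRegRep A ρ) (hF : IsDominant A F) (hirr : IsIrred ρ) : d ≤ 1 := by
  by_contra! hd
  exact h.false_of_degenerate hA hρ hF hirr (h.exists_degenerate hA hρ hF.reg hirr hd)

end Intertwines

end

section

variable {k Γ : Type} [Field k] [Group Γ] {A : Subalgebra k (Γ → k)} {d : ℕ}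
  {ρ : Γ →* Matrix (Fin d) (Fin d) k} {V : Type} [AddCommGroup V] [Module k V]

/-- Among infinitely many irreducible subrepresentations of a finite-dimensional representation,
two are isomorphic. -/
theorem exists_linearEquiv_of_embeddings [FiniteDimensional k V] (κ : Representation k Γ V)
    {W : Type} [AddCommGroup W] [Module k W] [Nontrivial W] (σ : ℕ → Representation k Γ W)
    (hirr : ∀ i, ∀ U : Submodule k W, (∀ g, ∀ u ∈ U, σ i g u ∈ U) → U = ⊥ ∨ U = ⊤)
    (ι : ℕ → W →ₗ[k] V) (hinj : ∀ i, Function.Injective (ι i))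
    (hι : ∀ i g w, ι i (σ i g w) = κ g (ι i w)) :
    ∃ i j, i < j ∧ ∃ e : W ≃ₗ[k] W, ∀ g w, e (σ i g w) = σ j g (e w) := by
  let f : ∀ i, (σ i).asModule →ₗ[MonoidAlgebra k Γ] κ.asModule := fun i =>
    MonoidAlgebra.equivariantOfLinearOfComm
      (κ.asModuleEquiv.symm.toLinearMap ∘ₗ ι i ∘ₗ (σ i).asModuleEquiv.toLinearMap) (by
        intro g v
        rw [Representation.single_smul, Representation.single_smul, one_smul, one_smul]
        exact hι i g _)
  have hf : ∀ i, Function.Injective (f i) := fun i => hinj i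
  have hsimple : ∀ i, IsSimpleModule (MonoidAlgebra k Γ) (σ i).asModule := by
    intro i
    have : Nontrivial (σ i).asModule := inferInstanceAs (Nontrivial W)
    rw [isSimpleModule_iff]
    refine { eq_bot_or_eq_top := fun U => ?_ }
    let U' : Submodule k W := (U.restrictScalars k).map (σ i).asModuleEquiv.toLinearMap
    have hU' : ∀ w, w ∈ U' ↔ (σ i).asModuleEquiv.symm w ∈ U := by
      intro w
      simp [U']
    have := hirr i U' (fun g u hu => by
      rw [hU'] at hu ⊢
      rw [Representation.asModuleEquiv_symm_map_rho]
      exact U.smul_mem _ hu)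
    refine this.imp (fun h => ?_) (fun h => ?_)
    · rw [Submodule.eq_bot_iff] at h ⊢
      exact fun x hx => h ((σ i).asModuleEquiv x) ((hU' _).mpr (by simpa using hx))
    · rw [Submodule.eq_top_iff'] at h ⊢
      exact fun x => by simpa using (hU' _).mp (h ((σ i).asModuleEquiv x))
  have : IsNoetherian k κ.asModule := inferInstanceAs (IsNoetherian k V)
  have : IsNoetherian (MonoidAlgebra k Γ) κ.asModule := isNoetherian_of_tower k inferInstance
  let e : ∀ i, (σ i).asModule ≃ₗ[MonoidAlgebra k Γ] LinearMap.range (f i) := fun i =>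
    LinearEquiv.ofInjective (f i) (hf i)
  have hs : ∀ i, IsSimpleModule (MonoidAlgebra k Γ) (LinearMap.range (f i)) := fun i =>
    IsSimpleModule.congr (e i).symm
  obtain ⟨i, j, hij, hc⟩ := Finite.exists_ne_map_eq_of_infinite fun i =>
    (⟨isotypicComponent _ _ (LinearMap.range (f i)), ⟨_, hs i, rfl⟩⟩ :
      isotypicComponents (MonoidAlgebra k Γ) κ.asModule)
  wlog hlt : i < j generalizing i j
  · exact this j i hij.symm hc.symm (lt_of_le_of_ne (not_lt.mp hlt) hij.symm)
  have hc' := congrArg Subtype.val hc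
  simp only at hc'
  have h1 : LinearMap.range (f i) ≤
      isotypicComponent (MonoidAlgebra k Γ) κ.asModule (LinearMap.range (f j)) :=
    hc' ▸ Submodule.le_isotypicComponent _
  have h2 := (isIsotypicOfType_submodule_iff.mp (IsIsotypicOfType.isotypicComponent
    (MonoidAlgebra k Γ) κ.asModule (LinearMap.range (f j)))) _ h1
  obtain ⟨E⟩ := h2
  let E' := (e i).trans (E.trans (e j).symm)
  refine ⟨i, j, hlt, (σ i).asModuleEquiv.symm.trans
    ((E'.restrictScalars k).trans (σ j).asModuleEquiv), fun g w => ?_⟩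
  change (σ j).asModuleEquiv (E' ((σ i).asModuleEquiv.symm (σ i g w))) =
    σ j g ((σ j).asModuleEquiv (E' ((σ i).asModuleEquiv.symm w)))
  rw [Representation.asModuleEquiv_symm_map_rho, map_smul, Representation.asModuleEquiv_map_smul,
    Representation.asAlgebraHom_of]

/-- A regular representation with a surjective endomorphism which twists the action by `F`. -/
structure IsTwistedRep (A : Subalgebra k (Γ → k)) (F : Γ →* Γ) (κ : Representation k Γ V)
    (Φ : V →ₗ[k] V) : Prop where
  reg : ∀ (φ : V →ₗ[k] k) (v : V), (fun g => φ (κ g v)) ∈ A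
  surj : Function.Surjective Φ
  comm : ∀ g v, Φ (κ (F g) v) = κ g (Φ v)

/-- The endomorphism `F ^ i`. -/
def iterHom (F : Γ →* Γ) (i : ℕ) : Γ →* Γ where
  toFun := F^[i]
  map_one' := iterate_map_one F i
  map_mul' := iterate_map_mul F i

namespace IsTwistedRep

variable {F : Γ →* Γ} {κ : Representation k Γ V} {Φ : V →ₗ[k] V}

theorem iterate_comm (h : IsTwistedRep A F κ Φ) (i : ℕ) (g : Γ) (v : V) :
    (Φ ^ i) (κ (F^[i] g) v) = κ g ((Φ ^ i) v) := by
  induction i generalizing g v with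
  | zero => rfl
  | succ i ih =>
    rw [pow_succ, Module.End.mul_apply, Function.iterate_succ_apply', h.comm, ih,
      Module.End.mul_apply]

theorem injective [FiniteDimensional k V] (h : IsTwistedRep A F κ Φ) : Function.Injective Φ :=
  LinearMap.injective_iff_surjective.mpr h.surj

/-- Simple subrepresentations of a twisted representation are one-dimensional. -/
theorem finrank_eq_one [IsAlgClosed k] [FiniteDimensional k V] (h : IsTwistedRep A F κ Φ)
    (hA : IsCoordRing A) (hF : IsDominant A F) {W : Submodule k V} (hne : W ≠ ⊥)
    (hW : ∀ g, ∀ w ∈ W, κ g w ∈ W)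
    (hsimple : ∀ U ≤ W, (∀ g, ∀ u ∈ U, κ g u ∈ U) → U = ⊥ ∨ U = W) :
    Module.finrank k W = 1 := by
  have hnt : Nontrivial W := (Submodule.nontrivial_iff_ne_bot).mpr hne
  have hpos : 0 < Module.finrank k W := Module.finrank_pos
  let b := Module.finBasis k W
  let κW : Γ →* Module.End k W :=
    { toFun := fun g => (κ g).restrict (hW g)
      map_one' := by ext; simp
      map_mul' := fun g g' => by ext; simp }
  have hκW : ∀ g (w : W), (κW g w : V) = κ g w := fun g w => rfl
  let ρ : Γ →* Matrix (Fin (Module.finrank k W)) (Fin (Module.finrank k W)) k :=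
    (LinearMap.toMatrixAlgEquiv b : Module.End k W →* _).comp κW
  let ι : (Fin (Module.finrank k W) → k) →ₗ[k] V :=
    W.subtype ∘ₗ b.equivFun.symm.toLinearMap
  have hι : ∀ g v, ι (ρ g *ᵥ v) = κ g (ι v) := by
    intro g v
    have h1 : b.equivFun.symm (ρ g *ᵥ v) = κW g (b.equivFun.symm v) := by
      rw [LinearEquiv.symm_apply_eq]
      have := LinearMap.toMatrix_mulVec_repr b b (κW g) (b.equivFun.symm v)
      rw [← Module.Basis.equivFun_apply, ← Module.Basis.equivFun_apply,
        LinearEquiv.apply_symm_apply] at this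
      exact this
    change ((b.equivFun.symm (ρ g *ᵥ v) : W) : V) = _
    rw [h1, hκW]
    rfl
  have hιinj : Function.Injective ι := W.injective_subtype.comp b.equivFun.symm.injective
  have hιW : ∀ v, ι v ∈ W := fun v => (b.equivFun.symm v).2
  have hιsurj : ∀ w ∈ W, ∃ v, ι v = w := fun w hw => ⟨b.equivFun ⟨w, hw⟩, by simp [ι]⟩
  have hirr : IsIrred ρ := by
    refine ⟨hpos, fun U hU => ?_⟩
    have := hsimple (U.map ι) (by rintro _ ⟨v, -, rfl⟩; exact hιW v) (by
      rintro g _ ⟨v, hv, rfl⟩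
      exact ⟨_, hU g v hv, hι g v⟩)
    refine this.imp (fun h0 => ?_) (fun h0 => ?_)
    · rw [Submodule.eq_bot_iff] at h0 ⊢
      exact fun v hv => hιinj ((h0 _ ⟨v, hv, rfl⟩).trans (map_zero ι).symm)
    · rw [Submodule.eq_top_iff']
      intro v
      obtain ⟨u, hu, huv⟩ : ι v ∈ U.map ι := by rw [h0]; exact hιW v
      rwa [← hιinj huv]
  have hreg : IsRegRep A ρ := by
    intro i j
    obtain ⟨φ, hφ⟩ := LinearMap.exists_extend (b.coord i)
    have := h.reg φ (b j)
    convert this using 1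
    ext g
    have h1 : φ (κ g (b j)) = b.coord i (κW g (b j)) := by
      rw [← hφ]; rfl
    rw [h1]
    exact LinearMap.toMatrix_apply b b (κW g) i j
  let σ : ℕ → Representation k Γ (Fin (Module.finrank k W) → k) := fun i =>
    (Matrix.toLinAlgEquiv' (R := k) (n := Fin (Module.finrank k W))).toRingEquiv.toMonoidHom.comp
      (ρ.comp (iterHom F i))
  have hσ : ∀ i g v, σ i g v = ρ (F^[i] g) *ᵥ v := fun i g v => rfl
  have hne' : Nonempty (Fin (Module.finrank k W)) := ⟨⟨0, hpos⟩⟩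
  obtain ⟨i, j, hij, e, he⟩ := exists_linearEquiv_of_embeddings κ σ (fun i U hU => by
      refine hirr.eq_bot_or_eq_top U fun g v hv => ?_
      obtain ⟨g', rfl⟩ := hF.surj.iterate i g
      exact hU g' v hv)
    (fun i => (Φ ^ i) ∘ₗ ι) (fun i => by
      rw [LinearMap.coe_comp, Module.End.coe_pow]
      exact (h.injective.iterate i).comp hιinj)
    (fun i g v => by
      change (Φ ^ i) (ι (ρ (F^[i] g) *ᵥ v)) = κ g ((Φ ^ i) (ι v))
      rw [hι, h.iterate_comm])
  have hcomm : ∀ g v, e (ρ g *ᵥ v) = ρ (F^[j - i] g) *ᵥ e v := by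
    intro g v
    obtain ⟨g', rfl⟩ := hF.surj.iterate i g
    have := he g' v
    rwa [hσ, hσ, ← Nat.sub_add_cancel hij.le, Function.iterate_add_apply] at this
  have hintg : Intertwines F ρ (j - i) (LinearMap.toMatrix' e.toLinearMap)
      (LinearMap.toMatrix' e.symm.toLinearMap) := by
    refine ⟨by omega, ?_, ?_, fun g => ?_⟩
    · rw [← LinearMap.toMatrix'_mul]; simp [Module.End.mul_eq_comp]
    · rw [← LinearMap.toMatrix'_mul]; simp [Module.End.mul_eq_comp]
    · apply Matrix.mulVec_injective
      ext1 v
      rw [← mulVec_mulVec, ← mulVec_mulVec, LinearMap.toMatrix'_mulVec, LinearMap.toMatrix'_mulVec]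
      exact hcomm g v
  have := hintg.dim_le_one hA hreg hF hirr
  omega

/-- A nonzero twisted representation has a common eigenvector. -/
theorem exists_eigenvector [IsAlgClosed k] [FiniteDimensional k V] [Nontrivial V]
    (h : IsTwistedRep A F κ Φ) (hA : IsCoordRing A) (hF : IsDominant A F) :
    ∃ v ≠ 0, ∃ χ : Γ → k, ∀ g, κ g v = χ g • v := by
  let 𝒰 : Set (Submodule k V) := {U | U ≠ ⊥ ∧ ∀ g, ∀ u ∈ U, κ g u ∈ U}
  have hne : 𝒰.Nonempty := ⟨⊤, top_ne_bot, fun _ _ _ => trivial⟩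
  obtain ⟨W, ⟨hW0, hW⟩, hmin⟩ := wellFounded_lt.has_min 𝒰 hne
  have h1 : Module.finrank k W = 1 := h.finrank_eq_one hA hF hW0 hW fun U hUW hU => by
    by_contra! hcon
    exact hmin U ⟨hcon.1, hU⟩ (lt_of_le_of_ne hUW hcon.2)
  obtain ⟨⟨w, hw⟩, hw0, hspan⟩ := finrank_eq_one_iff'.mp h1
  refine ⟨w, fun h0 => hw0 (Subtype.ext h0), ?_⟩
  choose χ hχ using fun g => hspan ⟨κ g w, hW g w hw⟩
  exact ⟨χ, fun g => (congrArg Subtype.val (hχ g)).symm⟩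

/-- A nonzero equivariant map to a twisted representation yields an eigenfunctional on the
source. -/
theorem exists_eigenfunctional [IsAlgClosed k] (hA : IsCoordRing A) (hF : IsDominant A F)
    {C : Type} [AddCommGroup C] [Module k C] (σ : Γ → C → C) (n : ℕ) :
    ∀ (V : Type) [AddCommGroup V] [Module k V] [FiniteDimensional k V]
      (κ : Representation k Γ V) (Φ : V →ₗ[k] V) (_ : IsTwistedRep A F κ Φ) (f : C →ₗ[k] V)
      (_ : f ≠ 0) (_ : ∀ g c, f (σ g c) = κ g (f c)) (_ : Module.finrank k V ≤ n),
      ∃ (ℓ : C →ₗ[k] k) (χ : Γ → k), ℓ ≠ 0 ∧ χ ∈ A ∧ ∀ g c, ℓ (σ g c) = χ g * ℓ c := by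
  induction n with
  | zero =>
    intro V _ _ _ κ Φ h f hf _ hV
    have := Module.finrank_zero_iff.mp (Nat.le_zero.mp hV)
    exact absurd (LinearMap.ext fun c => Subsingleton.elim _ _) hf
  | succ n ih =>
    intro V _ _ _ κ Φ h f hf hσ hV
    obtain ⟨c₀, hc₀⟩ : ∃ c, f c ≠ 0 := by
      by_contra! hcon
      exact hf (LinearMap.ext hcon)
    have hnt : Nontrivial V := ⟨⟨f c₀, 0, hc₀⟩⟩
    let E : Set V := {v | ∃ χ : Γ → k, ∀ g, κ g v = χ g • v}
    let S : Submodule k V := Submodule.span k E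
    have hSκ : ∀ g, ∀ v ∈ S, κ g v ∈ S := by
      intro g v hv
      induction hv using Submodule.span_induction with
      | mem v hv =>
        obtain ⟨χ, hχ⟩ := hv
        rw [hχ]
        exact S.smul_mem _ (Submodule.subset_span ⟨χ, hχ⟩)
      | zero => rw [map_zero]; exact S.zero_mem
      | add v w _ _ hv hw => rw [map_add]; exact S.add_mem hv hw
      | smul a v _ hv => rw [map_smul]; exact S.smul_mem _ hv
    have hSΦ : ∀ v ∈ S, Φ v ∈ S := by
      intro v hv
      induction hv using Submodule.span_induction with
      | mem v hv =>
        obtain ⟨χ, hχ⟩ := hv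
        refine Submodule.subset_span ⟨fun g => χ (F g), fun g => ?_⟩
        rw [← h.comm, hχ, map_smul]
      | zero => rw [map_zero]; exact S.zero_mem
      | add v w _ _ hv hw => rw [map_add]; exact S.add_mem hv hw
      | smul a v _ hv => rw [map_smul]; exact S.smul_mem _ hv
    by_cases hfS : ∀ c, f c ∈ S
    · let E' : Set S := {v | ∃ χ : Γ → k, ∀ g, κ g v = χ g • (v : V)}
      have hE' : ⊤ ≤ Submodule.span k E' := by
        have h1 : (Submodule.span k E').map S.subtype = S := by
          rw [Submodule.map_span]
          congr 1
          ext v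
          constructor
          · rintro ⟨w, hw, rfl⟩; exact hw
          · intro hv; exact ⟨⟨v, Submodule.subset_span hv⟩, hv, rfl⟩
        rintro ⟨v, hv⟩ -
        obtain ⟨w, hw, hwv⟩ : v ∈ (Submodule.span k E').map S.subtype := by rw [h1]; exact hv
        have e : w = ⟨v, hv⟩ := Subtype.ext hwv
        rwa [← e]
      let b := Module.Basis.ofSpan hE'
      have hb : ∀ i, ∃ χ : Γ → k, ∀ g, κ g (b i) = χ g • (b i : V) := fun i =>
        Module.Basis.ofSpan_subset hE' ⟨i, rfl⟩
      choose χ hχ using hb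
      let f' : C →ₗ[k] S := f.codRestrict S hfS
      obtain ⟨i, hi⟩ : ∃ i, b.coord i (f' c₀) ≠ 0 := by
        by_contra! hcon
        apply hc₀
        have : f' c₀ = 0 := b.ext_elem fun i => by
          rw [map_zero]; exact hcon i
        exact congrArg Subtype.val this
      have hcoord : ∀ g, ∀ s : S, b.coord i ⟨κ g s, hSκ g s s.2⟩ = χ i g * b.coord i s := by
        intro g s
        let κS : S →ₗ[k] S := (κ g).restrict (hSκ g)
        have h1 : b.coord i ∘ₗ κS = χ i g • b.coord i := by
          refine b.ext fun j => ?_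
          have h2 : κS (b j) = χ j g • b j := Subtype.ext (hχ j g)
          rw [LinearMap.comp_apply, h2, map_smul, LinearMap.smul_apply]
          by_cases hij : i = j
          · rw [hij]
          · simp [Ne.symm hij]
        exact LinearMap.congr_fun h1 s
      have hℓ : ∀ g c, b.coord i (f' (σ g c)) = χ i g * b.coord i (f' c) := by
        intro g c
        rw [← hcoord]
        congr 1
        exact Subtype.ext (hσ g c)
      refine ⟨b.coord i ∘ₗ f', χ i, fun h0 => hi (LinearMap.congr_fun h0 c₀), ?_, hℓ⟩
      obtain ⟨φ, hφ⟩ := LinearMap.exists_extend (b.coord i)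
      have h1 := A.smul_mem (h.reg φ (f c₀)) (b.coord i (f' c₀))⁻¹
      convert h1 using 1
      ext g
      have h2 : φ (κ g (f c₀)) = b.coord i ⟨κ g (f' c₀), hSκ g _ (f' c₀).2⟩ := by
        rw [← hφ]; rfl
      rw [Pi.smul_apply, h2, hcoord, smul_eq_mul, mul_comm (χ i g), inv_mul_cancel_left₀ hi]
    · push Not at hfS
      obtain ⟨c, hc⟩ := hfS
      let κ' : Representation k Γ (V ⧸ S) :=
        { toFun := fun g => S.mapQ S (κ g) (hSκ g)
          map_one' := by ext; simp
          map_mul' := fun g g' => by ext; simp }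
      have hκ' : ∀ g v, κ' g (S.mkQ v) = S.mkQ (κ g v) := fun g v => rfl
      have h' : IsTwistedRep A F κ' (S.mapQ S Φ hSΦ) := by
        refine ⟨fun φ v => ?_, fun v => ?_, fun g v => ?_⟩
        · obtain ⟨v, rfl⟩ := S.mkQ_surjective v
          exact h.reg (φ ∘ₗ S.mkQ) v
        · obtain ⟨v, rfl⟩ := S.mkQ_surjective v
          obtain ⟨w, rfl⟩ := h.surj v
          exact ⟨S.mkQ w, rfl⟩
        · obtain ⟨v, rfl⟩ := S.mkQ_surjective v
          change S.mkQ (Φ (κ (F g) v)) = S.mkQ (κ g (Φ v))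
          rw [h.comm]
      refine ih (V ⧸ S) κ' _ h' (S.mkQ ∘ₗ f) (fun h0 => hc ?_) (fun g c => ?_) ?_
      · have := LinearMap.congr_fun h0 c
        exact (Submodule.Quotient.mk_eq_zero S).mp this
      · change S.mkQ (f (σ g c)) = S.mkQ (κ g (f c))
        rw [hσ]
      · obtain ⟨v, hv0, χ, hχ⟩ := h.exists_eigenvector hA hF
        have hS : 0 < Module.finrank k S := by
          have : Nontrivial S := ⟨⟨⟨v, Submodule.subset_span ⟨χ, hχ⟩⟩, 0, fun h0 =>
            hv0 (congrArg Subtype.val h0)⟩⟩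
          exact Module.finrank_pos
        have := S.finrank_quotient_add_finrank
        omega

end IsTwistedRep

end

section

variable {k Γ : Type} [Field k] [Group Γ] {A : Subalgebra k (Γ → k)} {d : ℕ}
  {ρ : Γ →* Matrix (Fin d) (Fin d) k} {F : Γ →* Γ}

/-- A matrix whose span modulo scalars is stable under conjugation by an irreducible
representation is scalar. -/
theorem IsIrred.eq_scalar [IsAlgClosed k] (hA : IsCoordRing A) (hρ : IsRegRep A ρ)
    (hirr : IsIrred ρ) {X : Matrix (Fin d) (Fin d) k} {χ : Γ → k} (hχ : χ ∈ A) (c : Γ → k)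
    (h : ∀ g, ρ g⁻¹ * X * ρ g = χ g • X + c g • 1) : ∃ l : k, X = l • 1 := by
  by_contra! hX
  have := hA.isDomain
  let i₀ : Fin d := ⟨0, hirr.pos⟩
  have hne : Nonempty (Fin d) := ⟨i₀⟩
  have hcA : c ∈ A := by
    have h1 : c = fun g => (ρ g⁻¹ * X * ρ g) i₀ i₀ - χ g * X i₀ i₀ := by
      ext g
      rw [h]
      simp
    rw [h1]
    refine A.sub_mem ?_ (mul_apply_mem hχ (const_mem _))
    simp only [Matrix.mul_apply]
    exact sum_apply_mem _ _ fun i _ => mul_apply_mem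
      (sum_apply_mem _ _ fun j _ => mul_apply_mem (hA.inv _ (hρ _ _)) (const_mem _)) (hρ _ _)
  have h1 : χ 1 = 1 ∧ c 1 = 0 := by
    have h2 := h 1
    rw [inv_one, map_one, one_mul, mul_one] at h2
    have h3 : χ 1 = 1 := by
      by_contra hne
      apply hX ((1 - χ 1)⁻¹ * c 1)
      have h4 : (1 - χ 1) • X = c 1 • (1 : Matrix (Fin d) (Fin d) k) := by
        rw [sub_smul, one_smul, sub_eq_iff_eq_add']
        exact h2
      rw [mul_smul, ← h4, smul_smul, inv_mul_cancel₀ (sub_ne_zero.mpr (Ne.symm hne)), one_smul]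
    refine ⟨h3, ?_⟩
    rw [h3, one_smul, left_eq_add] at h2
    have := congrFun (congrFun h2 i₀) i₀
    simpa using this
  obtain ⟨l, hl⟩ := Module.End.exists_eigenvalue (toLin' X)
  have hstab : ∀ g, ∀ v, X *ᵥ v = l • v → X *ᵥ (ρ g *ᵥ v) = (χ g * l + c g) • (ρ g *ᵥ v) := by
    intro g v hv
    have h2 : X * ρ g = ρ g * (χ g • X + c g • 1) := by
      rw [← h g, ← mul_assoc, ← mul_assoc, rep_mul_inv, one_mul]
    rw [mulVec_mulVec, h2, ← mulVec_mulVec, add_mulVec, smul_mulVec, smul_mulVec, one_mulVec, hv,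
      smul_smul, ← add_smul, mulVec_smul]
  obtain ⟨v₀, hv₀⟩ := hl.exists_hasEigenvector
  have hv₀' : X *ᵥ v₀ = l • v₀ := by simpa using hv₀.apply_eq_smul
  have hfin := Module.End.finite_hasEigenvalue (toLin' X)
  have hmem : ∀ g, χ g * l + c g ∈ hfin.toFinset := by
    intro g
    rw [Set.Finite.mem_toFinset]
    refine Module.End.hasEigenvalue_of_hasEigenvector (x := ρ g *ᵥ v₀) ⟨?_, fun h0 => hv₀.2 ?_⟩
    · rw [Module.End.mem_eigenspace_iff, toLin'_apply]
      exact hstab g v₀ hv₀'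
    · rw [← one_mulVec v₀, ← rep_inv_mul ρ g, ← mulVec_mulVec, h0, mulVec_zero]
  have hconst : ∀ g, χ g * l + c g = l := by
    by_contra! hcon
    obtain ⟨g, hg⟩ := hA.exists_ne_zero hfin.toFinset (fun μ g => χ g * l + c g - μ)
      (fun μ _ => A.sub_mem (A.add_mem (mul_apply_mem hχ (const_mem _)) hcA) (const_mem _))
      (fun μ _ h0 => by
        have h2 := congrFun h0 1
        simp only [h1.1, h1.2, one_mul, add_zero, Pi.zero_apply, sub_eq_zero] at h2
        obtain ⟨g, hg⟩ := hcon
        apply hg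
        have h3 := congrFun h0 g
        rw [h2]
        exact sub_eq_zero.mp (by simpa [h2] using h3))
    exact hg _ (hmem g) (sub_self _)
  rcases hirr.eq_bot_or_eq_top (Module.End.eigenspace (toLin' X) l) (fun g v hv => by
    rw [Module.End.mem_eigenspace_iff, toLin'_apply] at hv ⊢
    rw [hstab g v hv, hconst]) with h2 | h2
  · exact hl h2
  · refine hX l (Matrix.mulVec_injective ?_)
    ext1 v
    have : v ∈ Module.End.eigenspace (toLin' X) l := by rw [h2]; trivial
    rw [Module.End.mem_eigenspace_iff, toLin'_apply] at this
    rw [this, smul_mulVec, one_mulVec]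

end

section

variable {k Γ : Type} [Field k] [Group Γ] {A : Subalgebra k (Γ → k)} {d : ℕ}
  {ρ : Γ →* Matrix (Fin d) (Fin d) k} {F : Γ →* Γ}

/-- A matrix orthogonal to all traceless matrices is scalar. -/
theorem eq_smul_one_of_trace_mul_eq_zero {M : Matrix (Fin d) (Fin d) k} (i₀ : Fin d)
    (h : ∀ Y : Matrix (Fin d) (Fin d) k, Y.trace = 0 → (M * Y).trace = 0) :
    M = M i₀ i₀ • 1 := by
  ext i j
  by_cases hij : i = j
  · subst hij
    have := h (single i i 1 - single i₀ i₀ 1) (by simp)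
    rw [mul_sub, trace_sub, trace_mul_single, trace_mul_single] at this
    simpa [sub_eq_zero] using this
  · have := h (single j i 1) (trace_single_eq_of_ne _ _ _ (Ne.symm hij))
    rw [trace_mul_single] at this
    simpa [hij] using this

theorem exists_trace_mul_eq (ℓ : Matrix (Fin d) (Fin d) k →ₗ[k] k) :
    ∃ X : Matrix (Fin d) (Fin d) k, ∀ Y, ℓ Y = (X * Y).trace := by
  refine ⟨of fun j i => ℓ (single i j 1), fun Y => ?_⟩
  conv_lhs => rw [matrix_eq_sum_single Y]
  rw [trace_mul_comm]
  simp only [map_sum, trace, diag_apply, mul_apply, of_apply]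
  refine Finset.sum_congr rfl fun i _ => Finset.sum_congr rfl fun j _ => ?_
  rw [← mul_one (Y i j), ← smul_eq_mul, ← smul_single, map_smul]
  simp

theorem IsCoordRing.isReg_conj (hA : IsCoordRing A) (g : Γ) :
    IsReg A (fun x => g⁻¹ * x * g) :=
  hA.isReg_mul (hA.isReg_mul (isReg_const g⁻¹) isReg_id) (isReg_const g)

/-- Modulo a subspace of finite codimension which is stable under `F` and under conjugation,
some iterated twist of an irreducible representation is scalar. -/
theorem IsIrred.exists_iterate_scalar_mod [IsAlgClosed k] (hA : IsCoordRing A)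
    (hF : IsDominant A F) (hρ : IsRegRep A ρ) (hirr : IsIrred ρ) (𝔞 : Submodule k A)
    [FiniteDimensional k (A ⧸ 𝔞)] (h𝔞F : ∀ f ∈ 𝔞, pull F hF.reg f ∈ 𝔞)
    (h𝔞c : ∀ g, ∀ f ∈ 𝔞, pull _ (hA.isReg_conj g) f ∈ 𝔞) :
    ∃ (n : ℕ) (w : A), ∀ i j,
      coeffMatrix hρ (hF.reg.iterate n) i j - (if i = j then w else 0) ∈ 𝔞 := by
  let i₀ : Fin d := ⟨0, hirr.pos⟩
  let P : ℕ → A →ₗ[k] A := fun n => (pull _ (hF.reg.iterate n)).toLinearMap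
  have hP : ∀ n (f : A) x, (P n f : Γ → k) x = (f : Γ → k) (F^[n] x) := fun _ _ _ => rfl
  have hP1 : ∀ n f, P (n + 1) f = pull F hF.reg (P n f) := fun n f => by
    ext x; simp only [hP, pull_apply, Function.iterate_succ_apply]
  have hP2 : ∀ n f, P (n + 1) f = P n (pull F hF.reg f) := fun n f => by
    ext x; simp only [hP, pull_apply, Function.iterate_succ_apply']
  have hmono : ∀ f n m, n ≤ m → P n f ∈ 𝔞 → P m f ∈ 𝔞 := by
    intro f n m hnm h
    induction m, hnm using Nat.le_induction with
    | base => exact h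
    | succ m _ ih => rw [hP1]; exact h𝔞F _ ih
  let 𝔟 : Submodule k A :=
    { carrier := {f | ∃ n, P n f ∈ 𝔞}
      zero_mem' := ⟨0, by rw [map_zero]; exact 𝔞.zero_mem⟩
      add_mem' := by
        rintro f g ⟨n, hn⟩ ⟨m, hm⟩
        exact ⟨max n m, by
          rw [map_add]
          exact 𝔞.add_mem (hmono _ _ _ (le_max_left _ _) hn) (hmono _ _ _ (le_max_right _ _) hm)⟩
      smul_mem' := by
        rintro c f ⟨n, hn⟩
        exact ⟨n, by rw [map_smul]; exact 𝔞.smul_mem _ hn⟩ }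
  have hmem : ∀ f, f ∈ 𝔟 ↔ ∃ n, P n f ∈ 𝔞 := fun f => Iff.rfl
  have h𝔞𝔟 : 𝔞 ≤ 𝔟 := fun f hf => ⟨0, hf⟩
  have hfd : FiniteDimensional k (A ⧸ 𝔟) :=
    Module.Finite.of_surjective (𝔞.mapQ 𝔟 LinearMap.id h𝔞𝔟) (by
      intro v
      obtain ⟨v, rfl⟩ := 𝔟.mkQ_surjective v
      exact ⟨𝔞.mkQ v, rfl⟩)
  let Ψ : A →ₗ[k] A := (pull F hF.reg).toLinearMap
  have hΨ : ∀ f, Ψ f ∈ 𝔟 ↔ f ∈ 𝔟 := by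
    intro f
    constructor
    · rintro ⟨n, hn⟩
      exact ⟨n + 1, by rw [hP2]; exact hn⟩
    · rintro ⟨n, hn⟩
      refine ⟨n, ?_⟩
      change P n (pull F hF.reg f) ∈ 𝔞
      rw [← hP2]
      exact hmono f n (n + 1) n.le_succ hn
  let Φ : (A ⧸ 𝔟) →ₗ[k] (A ⧸ 𝔟) := 𝔟.mapQ 𝔟 Ψ fun f hf => (hΨ f).mpr hf
  let c : Γ → A →ₗ[k] A := fun g => (pull _ (hA.isReg_conj g)).toLinearMap
  have hc : ∀ g (f : A) x, (c g f : Γ → k) x = (f : Γ → k) (g⁻¹ * x * g) := fun _ _ _ => rfl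
  have hc𝔟 : ∀ g, ∀ f ∈ 𝔟, c g f ∈ 𝔟 := by
    rintro g f ⟨n, hn⟩
    obtain ⟨g', rfl⟩ := hF.surj.iterate n g
    refine ⟨n, ?_⟩
    have : P n (c (F^[n] g') f) = pull _ (hA.isReg_conj g') (P n f) := by
      ext x
      simp only [hP, hc, pull_apply, iterate_map_mul, iterate_map_inv]
    rw [this]
    exact h𝔞c _ _ hn
  let κ : Representation k Γ (A ⧸ 𝔟) :=
    { toFun := fun g => 𝔟.mapQ 𝔟 (c g) (hc𝔟 g)
      map_one' := by
        refine LinearMap.ext fun v => ?_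
        obtain ⟨f, rfl⟩ := 𝔟.mkQ_surjective v
        change 𝔟.mkQ (c 1 f) = 𝔟.mkQ f
        congr 1
        ext x
        simp [hc]
      map_mul' := fun g g' => by
        refine LinearMap.ext fun v => ?_
        obtain ⟨f, rfl⟩ := 𝔟.mkQ_surjective v
        change 𝔟.mkQ (c (g * g') f) = 𝔟.mkQ (c g (c g' f))
        congr 1
        ext x
        simp [hc, mul_assoc] }
  have hκ : ∀ g f, κ g (𝔟.mkQ f) = 𝔟.mkQ (c g f) := fun _ _ => rfl
  have htw : IsTwistedRep A F κ Φ := by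
    refine ⟨fun φ v => ?_, ?_, fun g v => ?_⟩
    · obtain ⟨f, rfl⟩ := 𝔟.mkQ_surjective v
      obtain ⟨ι, _, α, β, h⟩ := hA.exists_two_sided (hA.isReg_inv isReg_id) isReg_id f.2
      have h1 : ∀ g, c g f = ∑ i, (α i : Γ → k) g • β i := by
        intro g
        ext x
        rw [hc, h]
        simp
      simp only [hκ, h1, map_sum, map_smul, smul_eq_mul]
      exact sum_apply_mem _ _ fun i _ => mul_apply_mem (α i).2 (const_mem _)
    · rw [← LinearMap.injective_iff_surjective, ← LinearMap.ker_eq_bot, LinearMap.ker_eq_bot']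
      intro v hv
      obtain ⟨f, rfl⟩ := 𝔟.mkQ_surjective v
      exact (Submodule.Quotient.mk_eq_zero 𝔟).mpr
        ((hΨ f).mp ((Submodule.Quotient.mk_eq_zero 𝔟).mp hv))
    · obtain ⟨f, rfl⟩ := 𝔟.mkQ_surjective v
      change 𝔟.mkQ (Ψ (c (F g) f)) = 𝔟.mkQ (c g (Ψ f))
      congr 1
      ext x
      change (f : Γ → k) ((F g)⁻¹ * F x * F g) = (f : Γ → k) (F (g⁻¹ * x * g))
      rw [map_mul, map_mul, map_inv]
  let C : Submodule k (Matrix (Fin d) (Fin d) k) := LinearMap.ker (traceLinearMap (Fin d) k k)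
  have hC : ∀ Y, Y ∈ C ↔ Y.trace = 0 := fun Y => Iff.rfl
  have hregtr : ∀ Y : Matrix (Fin d) (Fin d) k, (fun x => (Y * ρ x).trace) ∈ A := by
    intro Y
    simp only [trace, diag_apply, mul_apply]
    exact sum_apply_mem _ _ fun i _ => sum_apply_mem _ _ fun j _ =>
      mul_apply_mem (const_mem _) (hρ _ _)
  let t : Matrix (Fin d) (Fin d) k →ₗ[k] A :=
    { toFun := fun Y => ⟨fun x => (Y * ρ x).trace, hregtr Y⟩
      map_add' := fun Y Z => by ext x; simp [add_mul]
      map_smul' := fun a Y => by ext x; simp }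
  have ht : ∀ Y x, (t Y : Γ → k) x = (Y * ρ x).trace := fun _ _ => rfl
  let f : C →ₗ[k] (A ⧸ 𝔟) := 𝔟.mkQ ∘ₗ t ∘ₗ C.subtype
  by_cases hf : f = 0
  · have h1 : ∀ Y, Y.trace = 0 → t Y ∈ 𝔟 := fun Y hY =>
      (Submodule.Quotient.mk_eq_zero 𝔟).mp (LinearMap.congr_fun hf ⟨Y, hY⟩)
    have h2 : ∀ i j, ∃ n, P n (coeffMatrix hρ isReg_id i j -
        (if i = j then coeffMatrix hρ isReg_id i₀ i₀ else 0)) ∈ 𝔞 := by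
      intro i j
      by_cases hij : i = j
      · subst hij
        obtain ⟨n, hn⟩ := h1 (single i i 1 - single i₀ i₀ 1) (by simp)
        refine ⟨n, ?_⟩
        convert hn using 2
        ext x
        simp [ht, trace_single_mul, coeffMatrix]
      · obtain ⟨n, hn⟩ := h1 (single j i 1) (trace_single_eq_of_ne _ _ _ (Ne.symm hij))
        refine ⟨n, ?_⟩
        convert hn using 2
        ext x
        simp [ht, trace_single_mul, coeffMatrix, hij]
    choose n hn using h2
    let N := Finset.univ.sup fun p : Fin d × Fin d => n p.1 p.2
    refine ⟨N, coeffMatrix hρ (hF.reg.iterate N) i₀ i₀, fun i j => ?_⟩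
    have h3 := hmono _ _ N (Finset.le_sup (f := fun p : Fin d × Fin d => n p.1 p.2)
      (Finset.mem_univ (i, j))) (hn i j)
    convert h3 using 1
    by_cases hij : i = j
    · simp only [hij, if_true]; rfl
    · simp only [hij, if_false]; rfl
  · let σ : Γ → C → C := fun g Y => ⟨ρ g * Y * ρ g⁻¹, by
      rw [hC, trace_mul_comm, ← mul_assoc, rep_inv_mul, one_mul]
      exact Y.2⟩
    obtain ⟨ℓ, χ, hℓ0, hχ, hℓ⟩ := IsTwistedRep.exists_eigenfunctional hA hF σ _ (A ⧸ 𝔟) κ Φ htw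
      f hf (fun g Y => by
        change 𝔟.mkQ (t (ρ g * Y * ρ g⁻¹)) = 𝔟.mkQ (c g (t Y))
        congr 1
        ext x
        rw [hc, ht, ht, map_mul, map_mul, mul_assoc, mul_assoc, trace_mul_comm]
        simp only [mul_assoc]) le_rfl
    obtain ⟨ℓ', hℓ'⟩ := LinearMap.exists_extend ℓ
    obtain ⟨X, hX⟩ := exists_trace_mul_eq ℓ'
    have hℓX : ∀ Y : C, ℓ Y = (X * Y).trace := fun Y => by
      rw [← hX, ← hℓ']; rfl
    have h1 : ∀ g, ∃ c : k, ρ g⁻¹ * X * ρ g = χ g • X + c • 1 := by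
      intro g
      refine ⟨_, eq_add_of_sub_eq' (eq_smul_one_of_trace_mul_eq_zero i₀ fun Y hY => ?_)⟩
      have h2 := hℓ g ⟨Y, hY⟩
      rw [hℓX, hℓX] at h2
      rw [sub_mul, trace_sub, smul_mul, trace_smul, smul_eq_mul, ← h2, sub_eq_zero,
        mul_assoc, mul_assoc, trace_mul_comm]
      simp only [mul_assoc, σ]
    choose b hb using h1
    obtain ⟨l, hl⟩ := hirr.eq_scalar hA hρ hχ b hb
    refine absurd (LinearMap.ext fun Y => ?_) hℓ0
    rw [hℓX, hl, smul_mul, one_mul, trace_smul, (hC _).mp Y.2]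
    simp

end

section

/-- In characteristic zero, a derivation detects every transcendental element of a finitely
generated field extension. -/
theorem exists_derivation_ne_zero {k Q : Type} [Field k] [Field Q] [Algebra k Q] [CharZero k]
    [Algebra.EssFiniteType k Q] {x : Q} (hx : Transcendental k x) :
    ∃ δ : Derivation k Q Q, δ x ≠ 0 := by
  let := (Polynomial.aeval x : Polynomial k →ₐ[k] Q).toRingHom.toAlgebra
  have hX : algebraMap (Polynomial k) Q Polynomial.X = x := Polynomial.aeval_X x
  have ht : IsScalarTower k (Polynomial k) Q := .of_algebraMap_eq fun c =>
    (Polynomial.aeval_C x c).symm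
  have hfs : FaithfulSMul (Polynomial k) Q :=
    (faithfulSMul_iff_algebraMap_injective _ _).mpr (transcendental_iff_injective.mp hx)
  let K := FractionRing (Polynomial k)
  let : Algebra K Q := FractionRing.liftAlgebra (Polynomial k) Q
  have ht2 : IsScalarTower (Polynomial k) K Q := FractionRing.isScalarTower_liftAlgebra _ _
  have ht3 : IsScalarTower k K Q := .of_algebraMap_eq fun c => by
    rw [IsScalarTower.algebraMap_apply k (Polynomial k) Q,
      IsScalarTower.algebraMap_apply k (Polynomial k) K,
      ← IsScalarTower.algebraMap_apply (Polynomial k) K Q]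
  have : Algebra.EssFiniteType K Q := Algebra.EssFiniteType.of_comp k K Q
  have : CharZero K := charZero_of_injective_algebraMap (algebraMap k K).injective
  have : Algebra.FormallySmooth K Q := inferInstance
  have : Algebra.FormallySmooth (Polynomial k) K :=
    .of_isLocalization (nonZeroDivisors (Polynomial k))
  have : Algebra.FormallySmooth (Polynomial k) Q := .comp (Polynomial k) K Q
  have hinj : Function.Injective (KaehlerDifferential.mapBaseChange k (Polynomial k) Q) := by
    rw [injective_iff_map_eq_zero]
    intro y hy
    obtain ⟨z, rfl⟩ := (Algebra.H1Cotangent.exact_δ_mapBaseChange k (Polynomial k) Q y).mp hy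
    rw [Subsingleton.elim z 0, map_zero]
  have hD : KaehlerDifferential.D k Q x ≠ 0 := by
    intro h0
    have h1 : KaehlerDifferential.mapBaseChange k (Polynomial k) Q
        (1 ⊗ₜ KaehlerDifferential.D k (Polynomial k) Polynomial.X) = 0 := by
      rw [KaehlerDifferential.mapBaseChange_tmul, one_smul, KaehlerDifferential.map_D, hX, h0]
    have h2 := hinj (h1.trans (map_zero _).symm)
    have h3 := congrArg ((TensorProduct.rid (Polynomial k) Q) ∘
      (LinearMap.lTensor Q (KaehlerDifferential.polynomialEquiv k).toLinearMap)) h2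
    simp at h3
  obtain ⟨f, hf⟩ := Module.Projective.exists_dual_ne_zero Q hD
  exact ⟨f.compDer (KaehlerDifferential.D k Q), hf⟩

theorem exists_generators_of_finite {R S : Type} [CommRing R] [CommRing S] {f : R →+* S}
    (hf : f.Finite) : ∃ (m : ℕ) (b : Fin m → S), ∀ y, ∃ x : Fin m → R, y = ∑ i, f (x i) * b i := by
  let := f.toAlgebra
  have hf' : Module.Finite R S := hf
  obtain ⟨m, b, hb⟩ := hf'.exists_fin
  refine ⟨m, b, fun y => ?_⟩
  obtain ⟨x, hx⟩ := (Submodule.mem_span_range_iff_exists_fun _).mp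
    (hb.ge (Submodule.mem_top (x := y)))
  exact ⟨x, hx.symm⟩

variable {k B : Type} [Field k] [IsAlgClosed k] [CommRing B] [IsDomain B] [Algebra k B]
  [Algebra.FiniteType k B]

/-- In characteristic zero, two linearly independent elements have a nonzero Wronskian for some
derivation. -/
theorem exists_derivation_wronskian_ne_zero [CharZero k] {c w : B} (hw : w ≠ 0)
    (hc : ∀ l : k, c ≠ l • w) : ∃ δ : Derivation k B B, w * δ c - c * δ w ≠ 0 := by
  obtain ⟨Q, _, _, _, _, _⟩ : ∃ (Q : Type) (_ : Field Q) (_ : Algebra k Q) (_ : Algebra B Q)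
      (_ : IsScalarTower k B Q), IsFractionRing B Q :=
    ⟨FractionRing B, inferInstance, inferInstance, inferInstance, inferInstance, inferInstance⟩
  have hinj : Function.Injective (algebraMap B Q) := IsFractionRing.injective B Q
  have : Algebra.EssFiniteType B Q := .of_isLocalization _ (nonZeroDivisors B)
  have : Algebra.EssFiniteType k Q := .comp k B Q
  have hwQ : algebraMap B Q w ≠ 0 := by simpa using hw
  have hx : Transcendental k (algebraMap B Q c / algebraMap B Q w) := by
    intro halg
    obtain ⟨l, hl⟩ := exists_eq_algebraMap_of_isIntegral halg.isIntegral
    refine hc l (hinj ?_)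
    rw [eq_comm, div_eq_iff hwQ] at hl
    rw [Algebra.smul_def, map_mul, hl, IsScalarTower.algebraMap_apply k B Q]
  obtain ⟨D, hD⟩ := exists_derivation_ne_zero hx
  obtain ⟨s, hs⟩ := ‹Algebra.FiniteType k B›.out
  classical
  obtain ⟨e, he⟩ := IsLocalization.exist_integer_multiples_of_finset (nonZeroDivisors B)
    (s.image fun b => D (algebraMap B Q b))
  have hex : ∀ b : B, ∃ a : B, algebraMap B Q a = algebraMap B Q e * D (algebraMap B Q b) := by
    intro b
    have hb : b ∈ Algebra.adjoin k (s : Set B) := by rw [hs]; trivial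
    induction hb using Algebra.adjoin_induction with
    | mem b hb =>
      obtain ⟨a, ha⟩ := he _ (Finset.mem_image_of_mem _ hb)
      exact ⟨a, ha.trans (Algebra.smul_def _ _)⟩
    | algebraMap r =>
      refine ⟨0, ?_⟩
      rw [← IsScalarTower.algebraMap_apply, D.map_algebraMap, mul_zero, map_zero]
    | add x y _ _ hx hy =>
      obtain ⟨a, ha⟩ := hx
      obtain ⟨b, hb⟩ := hy
      exact ⟨a + b, by rw [map_add, map_add, map_add, ha, hb, mul_add]⟩
    | mul x y _ _ hx hy =>
      obtain ⟨a, ha⟩ := hx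
      obtain ⟨b, hb⟩ := hy
      refine ⟨x * b + y * a, ?_⟩
      rw [map_add, map_mul, map_mul, map_mul, D.leibniz, ha, hb, smul_eq_mul, smul_eq_mul]
      ring
  choose δ hδ using hex
  let δ' : Derivation k B B := Derivation.mk'
    { toFun := δ
      map_add' := fun x y => hinj (by rw [map_add, hδ, hδ, hδ, map_add, map_add, mul_add])
      map_smul' := fun r x => hinj (by
        rw [RingHom.id_apply, Algebra.smul_def, Algebra.smul_def, map_mul, hδ, hδ, map_mul,
          ← IsScalarTower.algebraMap_apply, D.leibniz, D.map_algebraMap, smul_zero, add_zero,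
          smul_eq_mul]
        ring) }
    (fun x y => hinj (by
      change algebraMap B Q (δ (x * y)) = algebraMap B Q (x * δ y + y * δ x)
      rw [map_add, map_mul, map_mul, hδ, hδ, hδ, map_mul, D.leibniz, smul_eq_mul, smul_eq_mul]
      ring))
  refine ⟨δ', fun h0 => hD ?_⟩
  have h1 := congrArg (algebraMap B Q) h0
  change algebraMap B Q (w * δ c - c * δ w) = _ at h1
  rw [map_sub, map_mul, map_mul, hδ, hδ, map_zero] at h1
  have he0 : algebraMap B Q e ≠ 0 := by simp
  have h2 : algebraMap B Q w * D (algebraMap B Q c) =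
      algebraMap B Q c * D (algebraMap B Q w) :=
    mul_left_cancel₀ he0 (by linear_combination h1)
  have h3 := D.leibniz (algebraMap B Q c / algebraMap B Q w) (algebraMap B Q w)
  rw [div_mul_cancel₀ _ hwQ, smul_eq_mul, smul_eq_mul] at h3
  have h4 :
      algebraMap B Q w * (algebraMap B Q w * D (algebraMap B Q c / algebraMap B Q w)) = 0 := by
    have h5 : algebraMap B Q w * (algebraMap B Q c / algebraMap B Q w) = algebraMap B Q c :=
      mul_div_cancel₀ _ hwQ
    linear_combination h2 - algebraMap B Q w * h3 - D (algebraMap B Q w) * h5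
  simpa only [mul_eq_zero, hwQ, false_or] using h4

/-- In characteristic `p`, if `c / w` is not a `p ^ r`-th power in the fraction field, then some
`p ^ (-r)`-linear operator kills `w` but not `c`. -/
theorem exists_cartier_operator {Q : Type} [Field Q] [Algebra B Q] [IsFractionRing B Q] (p : ℕ)
    [Fact p.Prime] [CharP k p] [CharP B p] [CharP Q p] (r : ℕ) {c w : B}
    (hc : ∀ z : Q, algebraMap B Q c ≠ algebraMap B Q w * z ^ p ^ r) :
    ∃ δ : B →+ B, (∀ x y, δ (x ^ p ^ r * y) = x * δ y) ∧ δ w = 0 ∧ δ c ≠ 0 := by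
  have hinj : Function.Injective (algebraMap B Q) := IsFractionRing.injective B Q
  have hfin : (iterateFrobenius B p r).Finite := by
    refine RingHom.IsIntegral.to_finite (fun x => ?_) ?_
    · refine ⟨Polynomial.X ^ p ^ r - Polynomial.C x, Polynomial.monic_X_pow_sub_C _
        (pow_ne_zero _ (Fact.out : p.Prime).ne_zero), ?_⟩
      rw [Polynomial.eval₂_sub, Polynomial.eval₂_X_pow, Polynomial.eval₂_C, iterateFrobenius_def,
        sub_self]
    · refine RingHom.FiniteType.of_comp_finiteType (f := algebraMap k B) ?_
      have h1 : (iterateFrobenius B p r).comp (algebraMap k B) =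
          (algebraMap k B).comp (iterateFrobenius k p r) := by
        ext x
        simp [iterateFrobenius_def]
      rw [h1]
      refine RingHom.FiniteType.comp (RingHom.finiteType_algebraMap.mpr ‹_›)
        (RingHom.FiniteType.of_surjective _ fun x => ?_)
      obtain ⟨y, hy⟩ := IsAlgClosed.exists_pow_nat_eq x
        (pow_pos (Fact.out : p.Prime).pos r)
      exact ⟨y, hy⟩
  obtain ⟨m, b, hb⟩ := exists_generators_of_finite hfin
  let K : Subfield Q := (iterateFrobenius Q p r).fieldRange
  have hpow : ∀ z : Q, z ^ p ^ r ∈ K := fun z => ⟨z, rfl⟩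
  obtain ⟨α, hαc, hαw⟩ : ∃ α : Q →ₗ[K] K, α (algebraMap B Q c) ≠ 0 ∧
      α (algebraMap B Q w) = 0 := by
    have h1 : algebraMap B Q c ∉ Submodule.span K {algebraMap B Q w} := by
      rw [Submodule.mem_span_singleton]
      rintro ⟨⟨_, z, rfl⟩, hz⟩
      apply hc z
      rw [← hz, Subfield.smul_def, smul_eq_mul, mul_comm]
      rfl
    obtain ⟨α, hα, hα'⟩ := Submodule.exists_le_ker_of_notMem h1
    exact ⟨α, hα, hα' (Submodule.mem_span_singleton_self _)⟩
  have hα : ∀ (x y : Q), (α (x ^ p ^ r * y) : Q) = x ^ p ^ r * α y := by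
    intro x y
    have := α.map_smul ⟨x ^ p ^ r, hpow x⟩ y
    exact congrArg Subtype.val this
  choose z hz using fun i => (α (algebraMap B Q (b i))).2
  obtain ⟨e, he⟩ := IsLocalization.exist_integer_multiples_of_finite (nonZeroDivisors B) z
  choose a ha using he
  have hex : ∀ y : B, ∃ x : B,
      algebraMap B Q x ^ p ^ r = algebraMap B Q e ^ p ^ r * α (algebraMap B Q y) := by
    intro y
    obtain ⟨x, rfl⟩ := hb y
    refine ⟨∑ i, x i * a i, ?_⟩
    rw [map_sum, sum_pow_char_pow, map_sum, map_sum, AddSubmonoidClass.coe_finsetSum,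
      Finset.mul_sum]
    refine Finset.sum_congr rfl fun i _ => ?_
    have h1 : (z i) ^ p ^ r = α (algebraMap B Q (b i)) := hz i
    rw [iterateFrobenius_def, map_mul, map_mul, map_pow, hα, ha, ← h1, Algebra.smul_def]
    ring
  have hinj' : ∀ x y : B, algebraMap B Q x ^ p ^ r = algebraMap B Q y ^ p ^ r → x = y :=
    fun x y h => hinj (iterateFrobenius_inj Q p r h)
  choose δ hδ using hex
  refine ⟨AddMonoidHom.mk' δ fun x y => hinj' _ _ ?_, fun x y => hinj' _ _ ?_, hinj' _ _ ?_,
    fun h0 => ?_⟩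
  · rw [map_add, add_pow_char_pow, hδ, hδ, hδ, map_add, map_add, Subfield.coe_add, mul_add]
  · change algebraMap B Q (δ _) ^ p ^ r = algebraMap B Q (x * δ y) ^ p ^ r
    rw [hδ, map_mul (algebraMap B Q), map_mul (algebraMap B Q), mul_pow, hδ, map_pow, hα]
    ring
  · change algebraMap B Q (δ _) ^ p ^ r = _
    rw [hδ, hαw, map_zero, zero_pow (pow_ne_zero _ (Fact.out : p.Prime).ne_zero)]
    simp
  · have h1 := hδ c
    change δ c = 0 at h0
    rw [h0, map_zero, zero_pow (pow_ne_zero _ (Fact.out : p.Prime).ne_zero), eq_comm,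
      mul_eq_zero] at h1
    rcases h1 with h1 | h1
    · have := pow_eq_zero_iff (pow_ne_zero _ (Fact.out : p.Prime).ne_zero) |>.mp h1
      exact nonZeroDivisors.ne_zero e.2 (hinj (this.trans (map_zero _).symm))
    · exact hαc (Subtype.ext h1)

/-- An ideal containing a power of each function vanishing at a point has finite codimension. -/
theorem finiteDimensional_quotient_of_pow_mem (φ : B →ₐ[k] k) (I : Ideal B)
    (hI : ∀ x, φ x = 0 → ∃ n, x ^ n ∈ I) :
    FiniteDimensional k (B ⧸ I) := by
  have : Algebra.IsIntegral k (B ⧸ I) := by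
    refine ⟨fun y => ?_⟩
    obtain ⟨y, rfl⟩ := Ideal.Quotient.mk_surjective y
    obtain ⟨n, hn⟩ := hI (y - algebraMap k B (φ y)) (by simp)
    have h1 : IsIntegral k (Ideal.Quotient.mk I (y - algebraMap k B (φ y))) := by
      have h2 : (Ideal.Quotient.mk I (y - algebraMap k B (φ y))) ^ (n + 1) = 0 := by
        rw [← map_pow, pow_succ]
        exact Ideal.Quotient.eq_zero_iff_mem.mpr (I.mul_mem_right _ hn)
      exact ⟨Polynomial.X ^ (n + 1), Polynomial.monic_X_pow _, by simpa using h2⟩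
    have h3 : IsIntegral k (Ideal.Quotient.mk I (algebraMap k B (φ y))) :=
      isIntegral_algebraMap (R := k) (A := B ⧸ I) (x := φ y)
    have := h1.add h3
    rwa [← map_add, sub_add_cancel] at this
  have : Algebra.FiniteType k (B ⧸ I) :=
    .of_surjective (Ideal.Quotient.mkₐ k I) (Ideal.Quotient.mkₐ_surjective k I)
  exact Algebra.IsIntegral.finite

end

section

variable {k Γ : Type} [Field k] [Group Γ] {A : Subalgebra k (Γ → k)} {d : ℕ}
  {ρ : Γ →* Matrix (Fin d) (Fin d) k} {F : Γ →* Γ}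

theorem IsCoordRing.isReg_mul_left (hA : IsCoordRing A) (g : Γ) : IsReg A (fun x => g * x) :=
  hA.isReg_mul (isReg_const g) isReg_id

/-- Some iterated twist of an irreducible representation is scalar to the order prescribed by `𝔞`
at every point. -/
theorem IsIrred.exists_iterate_proportional_mod [IsAlgClosed k] (hA : IsCoordRing A)
    (hF : IsDominant A F) (hρ : IsRegRep A ρ) (hirr : IsIrred ρ) (𝔞 : Ideal A)
    (hpow : ∀ x, ev A 1 x = 0 → ∃ n, x ^ n ∈ 𝔞)
    (hst : ∀ u (hu : IsReg A u), u 1 = 1 → ∀ f ∈ 𝔞, pull u hu f ∈ 𝔞) :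
    ∃ n, ∀ g i j l m, pull _ (hA.isReg_mul_left g)
      (ρ (F^[n] g) l m • coeffMatrix hρ (hF.reg.iterate n) i j -
        ρ (F^[n] g) i j • coeffMatrix hρ (hF.reg.iterate n) l m) ∈ 𝔞 := by
  have := hA.isDomain
  have : Algebra.FiniteType k A := A.fg_iff_finiteType.mp hA.fg
  have hfd : FiniteDimensional k (A ⧸ 𝔞.restrictScalars k) :=
    finiteDimensional_quotient_of_pow_mem (ev A 1) 𝔞 hpow
  obtain ⟨n, w, h⟩ := hirr.exists_iterate_scalar_mod hA hF hρ (𝔞.restrictScalars k)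
    (fun f hf => hst F hF.reg (map_one F) f hf)
    (fun g f hf => hst _ (hA.isReg_conj g) (by simp) f hf)
  have hn : ∀ i j, coeffMatrix hρ (hF.reg.iterate n) i j - (if i = j then w else 0) ∈ 𝔞 := h
  refine ⟨n, fun g i j l m => ?_⟩
  have key : ∀ i j, pull _ (hA.isReg_mul_left g) (coeffMatrix hρ (hF.reg.iterate n) i j) -
      ρ (F^[n] g) i j • w ∈ 𝔞 := by
    intro i j
    have h1 : pull _ (hA.isReg_mul_left g) (coeffMatrix hρ (hF.reg.iterate n) i j) -
        ρ (F^[n] g) i j • w = ∑ s, ρ (F^[n] g) i s •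
          (coeffMatrix hρ (hF.reg.iterate n) s j - (if s = j then w else 0)) := by
      simp only [smul_sub, Finset.sum_sub_distrib, smul_ite, smul_zero, Finset.sum_ite_eq',
        Finset.mem_univ, if_true]
      congr 1
      ext x
      simp [coeffMatrix, iterate_map_mul, Matrix.mul_apply]
    rw [h1]
    refine 𝔞.sum_mem fun s _ => ?_
    rw [Algebra.smul_def]
    exact 𝔞.mul_mem_left _ (hn s j)
  rw [map_sub, map_smul, map_smul]
  have h2 := 𝔞.sub_mem (𝔞.mul_mem_left (algebraMap k A (ρ (F^[n] g) l m)) (key i j))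
    (𝔞.mul_mem_left (algebraMap k A (ρ (F^[n] g) i j)) (key l m))
  rw [← Algebra.smul_def, ← Algebra.smul_def, smul_sub, smul_sub, smul_comm _ _ w,
    sub_sub_sub_cancel_right] at h2
  exact h2

/-- In characteristic `p`, ratios of matrix coefficients of iterated twists of an irreducible
representation are `p ^ r`-th powers. -/
theorem IsIrred.exists_iterate_eq_mul_pow [IsAlgClosed k] (hA : IsCoordRing A)
    (hF : IsDominant A F) (hρ : IsRegRep A ρ) (hirr : IsIrred ρ) (p : ℕ) [Fact p.Prime] [CharP k p]
    {Q : Type} [Field Q] [Algebra A Q] [IsFractionRing A Q] (r : ℕ) :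
    ∃ n, ∀ i j l m, coeffMatrix hρ (hF.reg.iterate n) l m ≠ 0 → ∃ z : Q,
      algebraMap A Q (coeffMatrix hρ (hF.reg.iterate n) i j) =
        algebraMap A Q (coeffMatrix hρ (hF.reg.iterate n) l m) * z ^ p ^ r := by
  have := hA.isDomain
  have : Algebra.FiniteType k A := A.fg_iff_finiteType.mp hA.fg
  have : CharP A p := charP_of_injective_algebraMap (algebraMap k A).injective p
  have : CharP Q p := charP_of_injective_algebraMap (IsFractionRing.injective A Q) p
  have hp0 : p ^ r ≠ 0 := pow_ne_zero _ (Fact.out : p.Prime).ne_zero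
  let S : Set A := {y | ∃ x : A, ev A 1 x = 0 ∧ y = x ^ p ^ r}
  obtain ⟨n, hn⟩ := hirr.exists_iterate_proportional_mod hA hF hρ (Ideal.span S)
    (fun x hx => ⟨p ^ r, Ideal.subset_span ⟨x, hx, rfl⟩⟩) (fun u hu hu1 f hf => by
      induction hf using Submodule.span_induction with
      | mem y hy =>
        obtain ⟨x, hx, rfl⟩ := hy
        rw [map_pow]
        refine Ideal.subset_span ⟨_, ?_, rfl⟩
        rw [ev_apply, pull_apply, hu1]
        exact hx
      | zero => rw [map_zero]; exact Ideal.zero_mem _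
      | add x y _ _ hx hy => rw [map_add]; exact Ideal.add_mem _ hx hy
      | smul a x _ hx => rw [smul_eq_mul, map_mul]; exact Ideal.mul_mem_left _ _ hx)
  refine ⟨n, fun i j l m hlm => ?_⟩
  by_contra! hcon
  obtain ⟨δ, hδ, hδw, hδc⟩ := exists_cartier_operator (k := k) p r hcon
  have key : ∀ g, ∀ f ∈ Ideal.span S, ∀ b : A,
      (δ (b * pull _ (hA.isReg_mul_left g⁻¹) f) : Γ → k) g = 0 := by
    intro g f hf
    induction hf using Submodule.span_induction with
    | mem y hy =>
      obtain ⟨x, hx, rfl⟩ := hy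
      intro b
      rw [map_pow, mul_comm, hδ]
      have h1 : (pull _ (hA.isReg_mul_left g⁻¹) x : Γ → k) g = 0 := by
        rw [pull_apply, inv_mul_cancel]
        exact hx
      change (pull _ (hA.isReg_mul_left g⁻¹) x : Γ → k) g * _ = 0
      rw [h1, zero_mul]
    | zero => intro b; simp
    | add x y _ _ hx hy =>
      intro b
      rw [map_add, mul_add, map_add]
      change _ + _ = (0 : k)
      rw [hx, hy, add_zero]
    | smul a x _ hx =>
      intro b
      rw [smul_eq_mul, map_mul (pull _ _), ← mul_assoc]
      exact hx _
  have hmul : ∀ (a : k) (x : A), ∃ s : k, s ^ p ^ r = a ∧ δ (a • x) = s • δ x := by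
    intro a x
    obtain ⟨s, rfl⟩ := IsAlgClosed.exists_pow_nat_eq a (Nat.pos_of_ne_zero hp0)
    refine ⟨s, rfl, ?_⟩
    rw [Algebra.smul_def, map_pow, hδ, ← Algebra.smul_def]
  obtain ⟨g, hg⟩ := hA.exists_ne_zero (Finset.univ : Finset Bool)
    (fun b => bif b then (δ (coeffMatrix hρ (hF.reg.iterate n) i j) : Γ → k)
      else (coeffMatrix hρ (hF.reg.iterate n) l m : Γ → k))
    (by rintro (_ | _) -; exacts [SetLike.coe_mem _, SetLike.coe_mem _])
    (by rintro (_ | _) - h0; exacts [hlm (Subtype.ext h0), hδc (Subtype.ext h0)])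
  have h1 : (δ _ : Γ → k) g ≠ 0 := hg true (Finset.mem_univ _)
  have h2 : ρ (F^[n] g) l m ≠ 0 := hg false (Finset.mem_univ _)
  have h3 := key g _ (hn g i j l m) 1
  have h4 : ∀ f : A, pull _ (hA.isReg_mul_left g⁻¹) (pull _ (hA.isReg_mul_left g) f) = f := by
    intro f
    ext x
    simp
  rw [one_mul, h4, map_sub] at h3
  obtain ⟨s, hs, hs'⟩ := hmul (ρ (F^[n] g) l m) (coeffMatrix hρ (hF.reg.iterate n) i j)
  obtain ⟨t, -, ht'⟩ := hmul (ρ (F^[n] g) i j) (coeffMatrix hρ (hF.reg.iterate n) l m)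
  rw [hs', ht', hδw, smul_zero, sub_zero] at h3
  change s * _ = 0 at h3
  rcases mul_eq_zero.mp h3 with h5 | h5
  · rw [h5, zero_pow hp0] at hs
    exact h2 hs.symm
  · exact h1 h5

/-- In characteristic zero, irreducible representations are one-dimensional in the presence of a
dominant Lang map. -/
theorem IsIrred.dim_le_one_of_charZero [IsAlgClosed k] [CharZero k] (hA : IsCoordRing A)
    (hF : IsDominant A F) (hρ : IsRegRep A ρ) (hirr : IsIrred ρ) : d ≤ 1 := by
  have := hA.isDomain
  have : Algebra.FiniteType k A := A.fg_iff_finiteType.mp hA.fg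
  let I : Ideal A := RingHom.ker (ev A 1)
  have hI : ∀ x, x ∈ I ↔ ev A 1 x = 0 := fun x => RingHom.mem_ker
  obtain ⟨n, hn⟩ := hirr.exists_iterate_proportional_mod hA hF hρ (I ^ 2)
    (fun x hx => ⟨2, Ideal.pow_mem_pow hx 2⟩) (fun u hu hu1 f hf => by
      have h1 : I ≤ I.comap (pull u hu) := fun x hx => by
        rw [Ideal.mem_comap, hI, ev_apply, pull_apply, hu1]
        exact hx
      exact Ideal.le_comap_pow (pull u hu) 2 (Ideal.pow_right_mono h1 2 hf))
  by_contra! hd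
  obtain ⟨i, j, g, hij, hg⟩ := hirr.exists_offDiag_ne_zero hd
  obtain ⟨g, rfl⟩ := hF.surj.iterate n g
  let c := coeffMatrix hρ (hF.reg.iterate n)
  have hc : ∀ i j x, (c i j : Γ → k) x = ρ (F^[n] x) i j := fun _ _ _ => rfl
  have hc1 : ∀ i j, (c i j : Γ → k) 1 = (1 : Matrix (Fin d) (Fin d) k) i j := fun i j => by
    rw [hc, iterate_map_one, map_one]
  have hii : c i i ≠ 0 := fun h0 => by
    have := hc1 i i
    rw [h0, one_apply_eq] at this
    exact zero_ne_one this
  obtain ⟨δ, hδ⟩ := exists_derivation_wronskian_ne_zero (k := k) (c := c i j) hii (by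
    intro l hl
    have h1 := congrArg (fun f : A => (f : Γ → k) 1) hl
    rw [hc1, one_apply_ne hij] at h1
    change 0 = l * (c i i : Γ → k) 1 at h1
    rw [hc1, one_apply_eq, mul_one] at h1
    rw [← h1, zero_smul] at hl
    apply hg
    rw [← hc, hl]
    rfl)
  apply hδ
  ext x
  have key : ∀ f ∈ I ^ 2, (δ (pull _ (hA.isReg_mul_left x⁻¹) f) : Γ → k) x = 0 := by
    intro f hf
    rw [pow_two] at hf
    induction hf using Submodule.mul_induction_on' with
    | mem_mul_mem a ha b hb =>
      have h1 : ∀ a ∈ I, (pull _ (hA.isReg_mul_left x⁻¹) a : Γ → k) x = 0 := by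
        intro a ha
        rw [pull_apply, inv_mul_cancel]
        exact ha
      rw [map_mul, δ.leibniz]
      change (pull _ (hA.isReg_mul_left x⁻¹) a : Γ → k) x * _ +
        (pull _ (hA.isReg_mul_left x⁻¹) b : Γ → k) x * _ = 0
      rw [h1 a ha, h1 b hb, zero_mul, zero_mul, add_zero]
    | add a _ b _ ha hb =>
      rw [map_add, map_add]
      change _ + _ = (0 : k)
      rw [ha, hb, add_zero]
  have h3 := key _ (hn x i j i i)
  have h4 : ∀ f : A, pull _ (hA.isReg_mul_left x⁻¹) (pull _ (hA.isReg_mul_left x) f) = f := by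
    intro f
    ext y
    simp
  rw [h4, map_sub, δ.map_smul, δ.map_smul] at h3
  exact h3

end

section

/-- An element of an extension of the fraction field of a UFD that is not integral is not
integral over the localization at some prime element. -/
theorem exists_prime_not_isIntegral {P K Q : Type*} [CommRing P] [IsDomain P]
    [UniqueFactorizationMonoid P] [Field K] [Algebra P K] [IsFractionRing P K] [Field Q]
    [Algebra K Q] [Algebra P Q] [IsScalarTower P K Q] [FiniteDimensional K Q] {c : Q}
    (hc : ¬ IsIntegral P c) :
    ∃ (π : P) (O : Subalgebra P K), Prime π ∧
      (∀ s, ¬ π ∣ s → (algebraMap P K s)⁻¹ ∈ O) ∧ ¬ IsIntegral O c := by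
  have hcK : IsIntegral K c := Algebra.IsIntegral.isIntegral c
  obtain ⟨i, hi⟩ : ∃ i, (minpoly K c).coeff i ∉ (algebraMap P K).range := by
    by_contra! hcon
    have hl : minpoly K c ∈ Polynomial.lifts (algebraMap P K) := by
      rw [Polynomial.lifts_iff_coeff_lifts]
      exact hcon
    obtain ⟨q, hq, -, hmon⟩ :=
      Polynomial.lifts_and_natDegree_eq_and_monic hl (minpoly.monic hcK)
    refine hc ⟨q, hmon, ?_⟩
    have := minpoly.aeval K c
    rw [← hq, Polynomial.aeval_map_algebraMap] at this
    exact this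
  set α := (minpoly K c).coeff i
  have hden : ¬ IsUnit (IsFractionRing.den P α : P) := fun hu =>
    hi (IsFractionRing.isInteger_of_isUnit_den hu)
  obtain ⟨π, hπ, hdvd⟩ := WfDvdMonoid.exists_irreducible_factor hden
    (nonZeroDivisors.coe_ne_zero _)
  have hprime : Prime π := hπ.prime
  have hnum : ¬ π ∣ IsFractionRing.num P α := fun h =>
    hπ.not_isUnit (IsFractionRing.num_den_reduced P α h hdvd)
  let 𝔭 : Ideal P := Ideal.span {π}
  have h𝔭 : 𝔭.IsPrime := (Ideal.span_singleton_prime hprime.ne_zero).mpr hprime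
  have hS : 𝔭.primeCompl ≤ nonZeroDivisors P := 𝔭.primeCompl_le_nonZeroDivisors
  let O : Subalgebra P K := Localization.subalgebra.ofField K 𝔭.primeCompl hS
  have : IsLocalization 𝔭.primeCompl O := Localization.subalgebra.isLocalization_ofField K _ hS
  have : IsIntegrallyClosed O := isIntegrallyClosed_of_isLocalization (R := P) O _ hS
  refine ⟨π, O, hprime, fun s hs => ?_, fun hintg => ?_⟩
  · exact ⟨1, s, fun h => hs (Ideal.mem_span_singleton.mp h), by simp⟩
  · have h1 : α ∈ O := by
      have := minpoly.isIntegrallyClosed_eq_field_fractions' K hintg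
      simp only [α]
      rw [this, Polynomial.coeff_map]
      exact ((minpoly O c).coeff i).2
    obtain ⟨a, s, hs, has⟩ := h1
    have hs' : ¬ π ∣ s := fun h => hs (Ideal.mem_span_singleton.mpr h)
    have hs0 : algebraMap P K s ≠ 0 := fun h => hs' <| by
      rw [IsFractionRing.to_map_eq_zero_iff.mp h]
      exact dvd_zero π
    have hd0 : algebraMap P K (IsFractionRing.den P α) ≠ 0 := fun h =>
      nonZeroDivisors.coe_ne_zero _ (IsFractionRing.to_map_eq_zero_iff.mp h)
    have h2 : IsFractionRing.num P α * s = a * IsFractionRing.den P α := by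
      apply IsFractionRing.injective P K
      rw [map_mul, map_mul, (div_eq_iff hd0).mp (IsFractionRing.mk'_num_den' P α), mul_right_comm,
        (eq_mul_inv_iff_mul_eq₀ hs0).mp has]
    rcases hprime.dvd_or_dvd (h2 ▸ hdvd.mul_left a : π ∣ IsFractionRing.num P α * s) with h | h
    · exact hnum h
    · exact hs' h

/-- A valuation ring containing a UFD, excluding a given non-integral element, and having a
discrete value group on the fraction field of the UFD. -/
theorem exists_valuationSubring_discrete {P K Q : Type*} [CommRing P] [IsDomain P]
    [UniqueFactorizationMonoid P] [Field K] [Algebra P K] [IsFractionRing P K] [Field Q]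
    [Algebra K Q] [Algebra P Q] [IsScalarTower P K Q] [FiniteDimensional K Q] {c : Q}
    (hc : ¬ IsIntegral P c) :
    ∃ V : ValuationSubring Q, (∀ r, algebraMap P Q r ∈ V) ∧ c ∉ V ∧
      ∃ γ : V.ValueGroup, γ ≠ 0 ∧
        ∀ x : K, x ≠ 0 → ∃ n : ℤ, V.valuation (algebraMap K Q x) = γ ^ n := by
  obtain ⟨π, O, hπ, hO, hintg⟩ := exists_prime_not_isIntegral (K := K) hc
  obtain ⟨V, hV, hcV⟩ := exists_valuationSubring_of_not_isIntegral hintg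
  have hV' : ∀ x ∈ O, algebraMap K Q x ∈ V := fun x hx => hV ⟨x, hx⟩
  have hinj : ∀ s : P, s ≠ 0 → algebraMap P K s ≠ 0 := fun s hs h =>
    hs (IsFractionRing.to_map_eq_zero_iff.mp h)
  have hP : ∀ r, algebraMap P Q r ∈ V := fun r => by
    rw [IsScalarTower.algebraMap_apply P K Q]
    exact hV' _ (O.algebraMap_mem r)
  have hunit : ∀ s : P, ¬ π ∣ s → V.valuation (algebraMap P Q s) = 1 := by
    intro s hs
    refine le_antisymm ((V.valuation_le_one_iff _).mpr (hP s)) ?_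
    have h1 := (V.valuation_le_one_iff _).mpr (hV' _ (hO s hs))
    rw [map_inv₀, map_inv₀, ← IsScalarTower.algebraMap_apply] at h1
    have h0 : V.valuation (algebraMap P Q s) ≠ 0 := by
      rw [Valuation.ne_zero_iff, IsScalarTower.algebraMap_apply P K Q, map_ne_zero]
      exact hinj s fun h => hs (h ▸ dvd_zero π)
    exact (inv_le_one₀ (zero_lt_iff.mpr h0)).mp h1
  have hpow : ∀ s : P, s ≠ 0 → ∃ n : ℕ,
      V.valuation (algebraMap P Q s) = V.valuation (algebraMap P Q π) ^ n := by
    intro s hs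
    obtain ⟨n, q, hq, rfl⟩ := WfDvdMonoid.max_power_factor hs hπ.irreducible
    exact ⟨n, by rw [map_mul, map_mul, map_pow, map_pow, hunit q hq, mul_one]⟩
  have hγ : V.valuation (algebraMap P Q π) ≠ 0 := by
    rw [Valuation.ne_zero_iff, IsScalarTower.algebraMap_apply P K Q, map_ne_zero]
    exact hinj π hπ.ne_zero
  refine ⟨V, hP, hcV, V.valuation (algebraMap P Q π), hγ, fun x hx => ?_⟩
  obtain ⟨a, b, hb, rfl⟩ := IsFractionRing.div_surjective P x
  obtain ⟨m, hm⟩ := hpow a fun h => hx (by rw [h, map_zero, zero_div])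
  obtain ⟨n, hn⟩ := hpow b (nonZeroDivisors.ne_zero hb)
  refine ⟨m - n, ?_⟩
  rw [map_div₀, map_div₀, ← IsScalarTower.algebraMap_apply, ← IsScalarTower.algebraMap_apply,
    hm, hn, zpow_sub₀ hγ, zpow_natCast, zpow_natCast]

open scoped Classical in
/-- In a finite extension, some uniform power of each value is a value on the base field. -/
theorem exists_valuation_pow_factorial {K Q Γ₀ : Type*} [Field K] [Field Q] [Algebra K Q]
    [FiniteDimensional K Q] [LinearOrderedCommGroupWithZero Γ₀] (v : Valuation Q Γ₀) {z : Q}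
    (hz : z ≠ 0) : ∃ x : K, x ≠ 0 ∧
      v z ^ (Module.finrank K Q).factorial = v (algebraMap K Q x) := by
  set e := Module.finrank K Q
  have hdep : ¬ LinearIndependent K fun i : Fin (e + 1) => z ^ (i : ℕ) := by
    intro h
    have := h.fintype_card_le_finrank
    simp [e] at this
  rw [Fintype.not_linearIndependent_iff] at hdep
  obtain ⟨a, ha, i, hi⟩ := hdep
  let t : Fin (e + 1) → Q := fun j => a j • z ^ (j : ℕ)
  have ht : ∀ j, a j ≠ 0 → t j ≠ 0 := fun j hj => smul_ne_zero hj (pow_ne_zero _ hz)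
  obtain ⟨i, hi', hmax⟩ := Finset.exists_max_image (Finset.univ.filter fun j => a j ≠ 0)
    (fun j => v (t j)) ⟨i, by simpa using hi⟩
  replace hi' : a i ≠ 0 := by simpa using hi'
  obtain ⟨j, hji, hj, hvj⟩ : ∃ j, j ≠ i ∧ a j ≠ 0 ∧ v (t j) = v (t i) := by
    by_contra! hcon
    have hvi : v (t i) ≠ 0 := (Valuation.ne_zero_iff v).mpr (ht i hi')
    have hlt : v (∑ j ∈ Finset.univ.erase i, t j) < v (t i) := by
      refine v.map_sum_lt hvi fun j hj => ?_
      by_cases h0 : a j = 0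
      · simpa [t, h0, zero_lt_iff] using hvi
      · exact lt_of_le_of_ne (hmax j (by simpa using h0)) (hcon j (Finset.ne_of_mem_erase hj) h0)
    have hsum : t i + ∑ j ∈ Finset.univ.erase i, t j = 0 := by
      rw [Finset.add_sum_erase _ _ (Finset.mem_univ i)]
      exact ha
    rw [← neg_eq_iff_add_eq_zero] at hsum
    rw [← hsum, Valuation.map_neg] at hlt
    exact hlt.false
  have key : ∀ i j : Fin (e + 1), (i : ℕ) < j → a i ≠ 0 → a j ≠ 0 → v (t j) = v (t i) →
      ∃ x : K, x ≠ 0 ∧ v z ^ e.factorial = v (algebraMap K Q x) := by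
    intro i j hij hi hj h
    obtain ⟨q, hq⟩ : (j - i : ℕ) ∣ e.factorial :=
      Nat.dvd_factorial (by omega) (by have := j.2; omega)
    refine ⟨(a i / a j) ^ q, pow_ne_zero _ (div_ne_zero hi hj), ?_⟩
    have h0 : v (algebraMap K Q (a j)) ≠ 0 := by simpa using hj
    have h1 : v z ^ (i : ℕ) ≠ 0 := pow_ne_zero _ (by simpa using hz)
    simp only [t, Algebra.smul_def, map_mul, map_pow] at h
    rw [← Nat.add_sub_of_le hij.le, pow_add] at h
    have h2 : v z ^ (j - i : ℕ) = v (algebraMap K Q (a i / a j)) := by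
      rw [map_div₀, map_div₀, eq_div_iff h0]
      refine mul_right_cancel₀ h1 ?_
      rw [← h]
      ac_rfl
    rw [hq, pow_mul, h2, map_pow, map_pow]
  rcases lt_or_gt_of_ne hji with h | h
  · exact key j i h hj hi' hvj.symm
  · exact key i j h hi' hj hvj

theorem eq_one_of_forall_eq_pow {K Q Γ₀ : Type*} [Field K] [Field Q] [Algebra K Q]
    [FiniteDimensional K Q] [LinearOrderedCommGroupWithZero Γ₀] (v : Valuation Q Γ₀) {γ : Γ₀}
    (hγ : γ ≠ 0) (hv : ∀ x : K, x ≠ 0 → ∃ n : ℤ, v (algebraMap K Q x) = γ ^ n) {p : ℕ}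
    (hp : 1 < p) {u : Q} (hu : u ≠ 0) (h : ∀ r : ℕ, ∃ z, v u = v z ^ p ^ r) : v u = 1 := by
  have hvu : v u ≠ 0 := (Valuation.ne_zero_iff v).mpr hu
  have hpos := Nat.factorial_pos (Module.finrank K Q)
  have hpow : ∀ z : Q, z ≠ 0 → ∃ n : ℤ, v z ^ (Module.finrank K Q).factorial = γ ^ n := by
    intro z hz
    obtain ⟨x, hx, h⟩ := exists_valuation_pow_factorial (K := K) v hz
    rw [h]
    exact hv x hx
  suffices hs : v u ^ (Module.finrank K Q).factorial = 1 from
    (pow_eq_one_iff_of_nonneg zero_le hpos.ne').mp hs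
  obtain ⟨N, hN⟩ := hpow u hu
  rw [hN]
  by_cases h1 : γ = 1
  · rw [h1, _root_.one_zpow]
  have hdvd : ∀ r : ℕ, (p : ℤ) ^ r ∣ N := by
    intro r
    obtain ⟨z, hz⟩ := h r
    have hz0 : z ≠ 0 := by
      rintro rfl
      rw [map_zero, zero_pow (pow_ne_zero _ (by omega))] at hz
      exact hvu hz
    obtain ⟨M, hM⟩ := hpow z hz0
    refine ⟨M, zpow_right_injective₀ (zero_lt_iff.mpr hγ) h1 ?_⟩
    simp only
    rw [← hN, hz, ← pow_mul, mul_comm, pow_mul, hM, ← zpow_natCast (γ ^ M), ← _root_.zpow_mul,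
      mul_comm]
    push_cast
    rfl
  have hN0 : N = 0 := by
    by_contra hN0
    have hle := Int.le_of_dvd (abs_pos.mpr hN0) ((dvd_abs _ _).mpr (hdvd N.natAbs))
    have hlt : N.natAbs < p ^ N.natAbs := Nat.lt_pow_self hp
    rw [Int.abs_eq_natAbs] at hle
    exact absurd (by exact_mod_cast hle : p ^ N.natAbs ≤ N.natAbs) (not_le.mpr hlt)
  rw [hN0, zpow_zero]

theorem mem_valuationSubring_of_isIntegral {R Q : Type*} [CommRing R] [Field Q] [Algebra R Q]
    (V : ValuationSubring Q) (h : ∀ r, algebraMap R Q r ∈ V) {x : Q} (hx : IsIntegral R x) :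
    x ∈ V := by
  obtain ⟨q, hq, hqx⟩ := hx
  have hintg : IsIntegral V x := ⟨q.map ((algebraMap R Q).codRestrict V.toSubring h), hq.map _, by
    rw [Polynomial.eval₂_map]
    exact hqx⟩
  obtain ⟨y, hy⟩ := IsIntegrallyClosed.isIntegral_iff.mp hintg
  exact hy ▸ y.2

/-- A valuation ring excluding a given non-integral element in which no non-unit has a value that
is infinitely `p`-divisible. -/
theorem exists_valuationSubring_not_divisible {k B Q : Type} [Field k] [CommRing B] [IsDomain B]
    [Algebra k B] [Algebra.FiniteType k B] [Field Q] [Algebra k Q] [Algebra B Q] [FaithfulSMul B Q]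
    [IsScalarTower k B Q] [Algebra.IsAlgebraic B Q] [Algebra.EssFiniteType k Q] {c : Q}
    (hc : ¬ IsIntegral B c) {p : ℕ} (hp : 1 < p) :
    ∃ V : ValuationSubring Q, (∀ b, algebraMap B Q b ∈ V) ∧ c ∉ V ∧
      ∀ u ≠ 0, (∀ r : ℕ, ∃ z, V.valuation u = V.valuation z ^ p ^ r) → V.valuation u = 1 := by
  obtain ⟨s, g, hg, hfin⟩ := exists_finite_inj_algHom_of_fg k B
  obtain ⟨P, _, _, _, hP, g, hg, hfin⟩ : ∃ (P : Type) (_ : CommRing P) (_ : IsDomain P)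
      (_ : Algebra k P) (_ : UniqueFactorizationMonoid P) (g : P →ₐ[k] B),
      Function.Injective g ∧ g.Finite :=
    ⟨MvPolynomial (Fin s) k, inferInstance, inferInstance, inferInstance, inferInstance, g, hg,
      hfin⟩
  let := g.toRingHom.toAlgebra
  let := ((algebraMap B Q).comp g.toRingHom).toAlgebra
  have : IsScalarTower P B Q := .of_algebraMap_eq fun _ => rfl
  have : IsScalarTower k P Q := .of_algebraMap_eq fun x => by
    rw [IsScalarTower.algebraMap_apply P B Q, IsScalarTower.algebraMap_apply k B Q]
    congr 1
    exact (g.commutes x).symm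
  have hfin' : Module.Finite P B := hfin
  have : FaithfulSMul P Q := (faithfulSMul_iff_algebraMap_injective _ _).mpr
    ((FaithfulSMul.algebraMap_injective B Q).comp hg)
  have : Algebra.IsAlgebraic P Q := Algebra.IsAlgebraic.trans P B Q
  let K := FractionRing P
  let : Algebra K Q := FractionRing.liftAlgebra P Q
  have : IsScalarTower P K Q := FractionRing.isScalarTower_liftAlgebra _ _
  have : IsScalarTower k K Q := .of_algebraMap_eq fun x => by
    rw [IsScalarTower.algebraMap_apply k P Q, IsScalarTower.algebraMap_apply k P K,
      ← IsScalarTower.algebraMap_apply P K Q]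
  have : Algebra.EssFiniteType K Q := Algebra.EssFiniteType.of_comp k K Q
  have : Algebra.IsAlgebraic K Q := ⟨fun x =>
    (Algebra.IsAlgebraic.isAlgebraic (R := P) x).extendScalars (IsFractionRing.injective P K)⟩
  have : FiniteDimensional K Q := by
    obtain ⟨t, ht⟩ := IntermediateField.fg_top K Q
    have : FiniteDimensional K (IntermediateField.adjoin K (t : Set Q)) :=
      IntermediateField.finiteDimensional_adjoin fun x _ => Algebra.IsIntegral.isIntegral x
    rw [ht] at this
    exact IntermediateField.topEquiv.toLinearEquiv.finiteDimensional
  obtain ⟨V, hV, hcV, γ, hγ, hval⟩ := exists_valuationSubring_discrete (K := K)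
    (fun h : IsIntegral P c => hc h.tower_top)
  refine ⟨V, fun b => ?_, hcV, fun u hu h => eq_one_of_forall_eq_pow (K := K) _ hγ hval hp hu h⟩
  have hb : IsIntegral P (algebraMap B Q b) := (Algebra.IsIntegral.isIntegral b).algebraMap
  exact mem_valuationSubring_of_isIntegral V hV hb

end

section

variable {k Γ : Type} [Field k] [Group Γ] {A : Subalgebra k (Γ → k)} {d : ℕ}
  {ρ : Γ →* Matrix (Fin d) (Fin d) k} {F : Γ →* Γ}

theorem map_aeval_eq_eval_one_smul {M N : Type*} [AddCommGroup M] [AddCommGroup N]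
    (t : Module.End ℤ M) (ω : M →ₗ[ℤ] N) (h : ∀ x, ω (t x) = ω x) (q : Polynomial ℤ) (x : M) :
    ω (Polynomial.aeval t q x) = q.eval 1 • ω x := by
  have hpow : ∀ n, ω ((t ^ n) x) = ω x := by
    intro n
    induction n with
    | zero => simp
    | succ n ih => rw [pow_succ', Module.End.mul_apply, h, ih]
  induction q using Polynomial.induction_on' with
  | add p q hp hq => simp [hp, hq, add_smul]
  | monomial n a => simp [Polynomial.aeval_monomial, hpow]

/-- The characters that belong to `A`. -/
def regChars (hA : IsCoordRing A) : Subgroup (Γ →* kˣ) where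
  carrier := {ψ | (fun g => (ψ g : k)) ∈ A}
  one_mem' := const_mem 1
  mul_mem' h h' := mul_apply_mem h h'
  inv_mem' {ψ} h := by
    have := hA.inv _ h
    simpa using this

/-- The inclusion of the regular characters in the coordinate ring. -/
def regChars.toRing (hA : IsCoordRing A) : regChars hA →* A where
  toFun ψ := ⟨fun g => (ψ.1 g : k), ψ.2⟩
  map_one' := rfl
  map_mul' _ _ := rfl

@[simp] theorem regChars.toRing_apply (hA : IsCoordRing A) (ψ : regChars hA) (g : Γ) :
    (regChars.toRing hA ψ : Γ → k) g = ψ.1 g := rfl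

/-- The twist of regular characters by `F`. -/
def regChars.twist (hA : IsCoordRing A) (hF : IsReg A F) : regChars hA →* regChars hA where
  toFun ψ := ⟨ψ.1.comp F, hF _ ψ.2⟩
  map_one' := rfl
  map_mul' _ _ := rfl

theorem regChars.eq_one_of_twist_eq (hA : IsCoordRing A) (hF : IsDominant A F) {ψ : regChars hA}
    (h : regChars.twist hA hF.reg ψ = ψ) : ψ = 1 := by
  refine Subtype.ext (MonoidHom.ext fun x => Units.ext ?_)
  refine hF.eq_of_lang ψ.2 (fun g => ?_) x
  have : ψ.1 (F g) = ψ.1 g := congrArg (fun χ : regChars hA => χ.1 g) h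
  rw [lang, map_mul, map_inv, this, mul_inv_cancel]
  rfl

/-- The twist as an endomorphism of a `ℤ`-module. -/
def regChars.twistEnd (hA : IsCoordRing A) (hF : IsReg A F) :
    Module.End ℤ (Additive (regChars hA)) :=
  (MonoidHom.toAdditive (regChars.twist hA hF)).toIntLinearMap

theorem regChars.twistEnd_pow (hA : IsCoordRing A) (hF : IsReg A F) (ψ : regChars hA) (n : ℕ) :
    (regChars.twistEnd hA hF ^ n) (Additive.ofMul ψ) =
      Additive.ofMul ((regChars.twist hA hF)^[n] ψ) := by
  induction n generalizing ψ with
  | zero => rfl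
  | succ n ih =>
    rw [pow_succ, Module.End.mul_apply, Function.iterate_succ_apply, ← ih]
    rfl

/-- The polynomial with exponents `m` as coefficients. -/
def expPoly (m : ℕ →₀ ℕ) : Polynomial ℤ := m.sum fun i a => Polynomial.monomial i (a : ℤ)

theorem expPoly_coeff (m : ℕ →₀ ℕ) (i : ℕ) : (expPoly m).coeff i = m i := by
  simp only [expPoly, Finsupp.sum, Polynomial.finsetSum_coeff, Polynomial.coeff_monomial]
  simp +contextual [eq_comm]

theorem expPoly_injective : Function.Injective expPoly := fun m m' h => by
  ext i
  have := congrArg (fun p => p.coeff i) h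
  simpa [expPoly_coeff] using this

theorem regChars.aeval_expPoly (hA : IsCoordRing A) (hF : IsReg A F) (ψ : regChars hA)
    (m : ℕ →₀ ℕ) : Polynomial.aeval (regChars.twistEnd hA hF) (expPoly m) (Additive.ofMul ψ) =
      Additive.ofMul (m.prod fun i a => (regChars.twist hA hF)^[i] ψ ^ a) := by
  simp only [expPoly, Finsupp.sum, Finsupp.prod, map_sum, LinearMap.sum_apply, ofMul_prod]
  refine Finset.sum_congr rfl fun i _ => ?_
  simp [Polynomial.aeval_monomial, regChars.twistEnd_pow]

theorem regChars.exists_aeval_eq_zero (hA : IsCoordRing A) (hF : IsReg A F) (ψ : regChars hA) :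
    ∃ p : Polynomial ℤ, p ≠ 0 ∧
      Polynomial.aeval (regChars.twistEnd hA hF) p (Additive.ofMul ψ) = 0 := by
  have := hA.isDomain
  have : Algebra.FiniteType k A := A.fg_iff_finiteType.mp hA.fg
  by_contra! hcon
  let t := regChars.twist hA hF
  let χ : (ℕ →₀ ℕ) → regChars hA := fun m => m.prod fun i a => t^[i] ψ ^ a
  have hχ : Function.Injective χ := by
    intro m m' h
    by_contra hne
    refine hcon (expPoly m - expPoly m') (sub_ne_zero.mpr fun h => hne (expPoly_injective h)) ?_
    rw [map_sub, LinearMap.sub_apply, regChars.aeval_expPoly, regChars.aeval_expPoly]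
    exact sub_eq_zero.mpr (congrArg Additive.ofMul h)
  have hli : LinearIndependent k fun m => regChars.toRing hA (χ m) := by
    have h1 := linearIndependent_monoidHom Γ k
    have h2 := h1.comp (fun m => (Units.coeHom k).comp (χ m).1) fun m m' h => hχ <|
      Subtype.ext <| MonoidHom.ext fun g => Units.ext <| DFunLike.congr_fun h g
    exact LinearIndependent.of_comp A.val.toLinearMap h2
  have hai : AlgebraicIndependent k fun i : ℕ => regChars.toRing hA (t^[i] ψ) := by
    rw [algebraicIndependent_iff]
    intro P hP
    rw [linearIndependent_iff'] at hli
    have : ∑ m ∈ P.support, P.coeff m • regChars.toRing hA (χ m) = 0 := by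
      rw [← hP, aeval_def, eval₂_eq]
      refine Finset.sum_congr rfl fun m _ => ?_
      rw [Algebra.smul_def]
      simp only [χ, Finsupp.prod, map_prod, map_pow]
    ext m
    by_cases hm : m ∈ P.support
    · exact hli _ _ this m hm
    · simpa using hm
  have h1 := hai.cardinalMk_le_trdeg
  have h2 := trdeg_lt_aleph0_of_finiteType (R := k) (S := A)
  rw [Cardinal.mk_nat] at h1
  exact absurd h1 (not_le.mpr h2)

theorem regChars.exists_aeval_eq_zero' (hA : IsCoordRing A) (hF : IsDominant A F)
    (ψ : regChars hA) : ∃ q : Polynomial ℤ, q.eval 1 ≠ 0 ∧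
      Polynomial.aeval (regChars.twistEnd hA hF.reg) q (Additive.ofMul ψ) = 0 := by
  obtain ⟨p, hp, h⟩ := regChars.exists_aeval_eq_zero hA hF.reg ψ
  obtain ⟨q, hq, hdvd⟩ := Polynomial.exists_eq_pow_rootMultiplicity_mul_and_not_dvd p hp 1
  refine ⟨q, fun h0 => hdvd (Polynomial.dvd_iff_isRoot.mpr h0), ?_⟩
  rw [hq, map_mul, Module.End.mul_apply, map_pow] at h
  have hinj : Function.Injective
      (Polynomial.aeval (regChars.twistEnd hA hF.reg) (Polynomial.X - Polynomial.C (1 : ℤ))) := by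
    rw [← LinearMap.ker_eq_bot, LinearMap.ker_eq_bot']
    intro x hx
    refine regChars.eq_one_of_twist_eq hA hF (ψ := x.toMul) ?_
    simp only [map_sub, Polynomial.aeval_X, map_one, LinearMap.sub_apply, sub_eq_zero] at hx
    exact hx
  exact (hinj.iterate _) (by rw [← Module.End.coe_pow, h, map_zero])

/-- A valuation that is bounded on the image of the Lang map is trivial on regular characters. -/
theorem regChars.valuation_eq_one (hA : IsCoordRing A) (hF : IsDominant A F) {Q : Type} [Field Q]
    [Algebra A Q] (V : ValuationSubring Q)
    (hV : ∀ f : A, algebraMap A Q (pull _ (hA.isReg_lang hF.reg) f) ∈ V) (ψ : regChars hA) :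
    V.valuation (algebraMap A Q (regChars.toRing hA ψ)) = 1 := by
  let ω : regChars hA →* V.ValueGroupˣ := MonoidHom.toHomUnits
    ((V.valuation : Q →* V.ValueGroup).comp
      ((algebraMap A Q : A →* Q).comp (regChars.toRing hA)))
  have hω : ∀ ψ, (ω ψ : V.ValueGroup) = V.valuation (algebraMap A Q (regChars.toRing hA ψ)) :=
    fun ψ => rfl
  have hle : ∀ ψ, ω ψ ≤ ω (regChars.twist hA hF.reg ψ) := by
    intro ψ
    rw [← Units.val_le_val, hω, hω]
    have h1 : regChars.toRing hA ψ = pull _ (hA.isReg_lang hF.reg) (regChars.toRing hA ψ) *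
        regChars.toRing hA (regChars.twist hA hF.reg ψ) := by
      ext g
      simp [lang, regChars.twist]
    rw [h1, map_mul, map_mul]
    exact mul_le_of_le_one_left' ((V.valuation_le_one_iff _).mpr (hV _))
  have htw : ∀ ψ, ω (regChars.twist hA hF.reg ψ) = ω ψ := fun ψ => by
    refine le_antisymm ?_ (hle ψ)
    have := hle ψ⁻¹
    rw [map_inv, map_inv, map_inv] at this
    exact inv_le_inv_iff.mp this
  obtain ⟨q, hq, h⟩ := regChars.exists_aeval_eq_zero' hA hF ψ
  have h1 := map_aeval_eq_eval_one_smul (regChars.twistEnd hA hF.reg)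
    (MonoidHom.toAdditive ω).toIntLinearMap (fun x => htw x.toMul) q (Additive.ofMul ψ)
  rw [h, map_zero] at h1
  have h2 : ω ψ ^ q.eval 1 = 1 := h1.symm
  have h3 : ω ψ = 1 := (IsMulTorsionFree.zpow_eq_one_iff_left hq).mp h2
  rw [← hω, h3, Units.val_one]

theorem coeffMatrix_apply_apply {u : Γ → Γ} (hρ : IsRegRep A ρ) (hu : IsReg A u) (i j : Fin d)
    (g : Γ) : (coeffMatrix hρ hu i j : Γ → k) g = ρ (u g) i j := rfl

/-- The determinant of a regular representation, as a regular character. -/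
def detChar (hA : IsCoordRing A) (hρ : IsRegRep A ρ) {u : Γ →* Γ} (hu : IsReg A u) :
    regChars hA := ⟨MonoidHom.toHomUnits (detMonoidHom.comp (ρ.comp u)), by
  have h : (fun g => (ρ (u g)).det) = ((coeffMatrix hρ hu).det : Γ → k) := by
    ext g
    exact ((ev A g : A →+* k).map_det (coeffMatrix hρ hu)).symm
  have h' : (fun g => (ρ (u g)).det) ∈ A := h ▸ (coeffMatrix hρ hu).det.2
  exact h'⟩

theorem toRing_detChar (hA : IsCoordRing A) (hρ : IsRegRep A ρ) {u : Γ →* Γ} (hu : IsReg A u) :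
    regChars.toRing hA (detChar hA hρ hu) = (coeffMatrix hρ hu).det := by
  ext g
  exact ((ev A g : A →+* k).map_det (coeffMatrix hρ hu)).symm

theorem valuation_sum_mul_le {Q Γ₀ ι : Type*} [Field Q] [LinearOrderedCommGroupWithZero Γ₀]
    (v : Valuation Q Γ₀) (s : Finset ι) (a b : ι → Q) {m : Γ₀} (ha : ∀ i ∈ s, v (a i) ≤ 1)
    (hb : ∀ i ∈ s, v (b i) ≤ m) : v (∑ i ∈ s, a i * b i) ≤ m := by
  refine v.map_sum_le fun i hi => ?_
  rw [map_mul]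
  exact (mul_le_mul' (ha i hi) (hb i hi)).trans_eq (one_mul m)

/-- Twisting a representation does not change the bounds of its coefficients for a valuation that
is bounded on the image of the Lang map. -/
theorem valuation_coeffMatrix_iterate_le_iff (hA : IsCoordRing A) (hF : IsDominant A F)
    (hρ : IsRegRep A ρ) {Q : Type} [Field Q] [Algebra A Q] (V : ValuationSubring Q)
    (hV : ∀ f : A, algebraMap A Q (pull _ (hA.isReg_lang hF.reg) f) ∈ V) (m : V.ValueGroup)
    (n : ℕ) :
    (∀ i j, V.valuation (algebraMap A Q (coeffMatrix hρ (hF.reg.iterate n) i j)) ≤ m) ↔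
      ∀ i j, V.valuation (algebraMap A Q (coeffMatrix hρ (hF.reg.iterate 0) i j)) ≤ m := by
  induction n with
  | zero => rfl
  | succ n ih =>
    rw [← ih]
    have hN : ∀ {u : Γ → Γ} (hu : IsReg A u) i j, V.valuation (algebraMap A Q
        (pull _ (hA.isReg_lang hF.reg) (coeffMatrix hρ hu i j))) ≤ 1 := fun hu i j =>
      (V.valuation_le_one_iff _).mpr (hV _)
    constructor <;> intro h i j
    · have h1 : coeffMatrix hρ (hF.reg.iterate n) i j =
          ∑ l, pull _ (hA.isReg_lang hF.reg) (coeffMatrix hρ (hF.reg.iterate n) i l) *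
            coeffMatrix hρ (hF.reg.iterate (n + 1)) l j := by
        ext g
        have : F^[n] g = F^[n] (lang F g) * F^[n + 1] g := by rw [iterate_lang]; group
        simp only [coeffMatrix_apply_apply, AddSubmonoidClass.coe_finsetSum, Finset.sum_apply,
          Subalgebra.coe_mul, Pi.mul_apply, pull_apply]
        conv_lhs => rw [this, map_mul, Matrix.mul_apply]
      rw [h1, map_sum]
      simp only [map_mul]
      exact valuation_sum_mul_le _ _ _ _ (fun l _ => hN _ i l) fun l _ => h l j
    · have h1 : coeffMatrix hρ (hF.reg.iterate (n + 1)) i j =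
          ∑ l, pull _ (hA.isReg_lang hF.reg)
            (coeffMatrix hρ (hA.isReg_inv (hF.reg.iterate n)) i l) *
            coeffMatrix hρ (hF.reg.iterate n) l j := by
        ext g
        have : F^[n + 1] g = (F^[n] (lang F g))⁻¹ * F^[n] g := by rw [iterate_lang]; group
        simp only [coeffMatrix_apply_apply, AddSubmonoidClass.coe_finsetSum, Finset.sum_apply,
          Subalgebra.coe_mul, Pi.mul_apply, pull_apply]
        conv_lhs => rw [this, map_mul, Matrix.mul_apply]
      rw [h1, map_sum]
      simp only [map_mul]
      exact valuation_sum_mul_le _ _ _ _ (fun l _ => hN _ i l) fun l _ => h l j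

theorem valuation_det_eq_one (hA : IsCoordRing A) (hF : IsDominant A F) (hρ : IsRegRep A ρ)
    {Q : Type} [Field Q] [Algebra A Q] (V : ValuationSubring Q)
    (hV : ∀ f : A, algebraMap A Q (pull _ (hA.isReg_lang hF.reg) f) ∈ V) {u : Γ →* Γ}
    (hu : IsReg A u) : V.valuation (algebraMap A Q (coeffMatrix hρ hu).det) = 1 := by
  rw [← toRing_detChar hA hρ hu]
  exact regChars.valuation_eq_one hA hF V hV _

theorem IsIrred.algebraMap_coeff_mem_of_charP [IsAlgClosed k] (hA : IsCoordRing A)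
    (hF : IsDominant A F) (hρ : IsRegRep A ρ) (hirr : IsIrred ρ) (p : ℕ) [Fact p.Prime] [CharP k p]
    {Q : Type} [Field Q] [Algebra A Q] [IsFractionRing A Q] (V : ValuationSubring Q)
    (hV : ∀ f : A, algebraMap A Q (pull _ (hA.isReg_lang hF.reg) f) ∈ V)
    (hdiv : ∀ u ≠ 0, (∀ r : ℕ, ∃ z, V.valuation u = V.valuation z ^ p ^ r) → V.valuation u = 1)
    (i j : Fin d) : algebraMap A Q (coeffMatrix hρ (hF.reg.iterate 0) i j) ∈ V := by
  have : Nonempty (Fin d) := ⟨i⟩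
  have : CharP A p := charP_of_injective_algebraMap (algebraMap k A).injective p
  have : CharP Q p := charP_of_injective_algebraMap (IsFractionRing.injective A Q) p
  let C : ℕ → Matrix (Fin d) (Fin d) Q := fun n =>
    (algebraMap A Q).mapMatrix (coeffMatrix hρ (hF.reg.iterate n))
  have hmax : ∀ n, ∃ l m, ∀ a b, V.valuation (C n a b) ≤ V.valuation (C n l m) := by
    intro n
    obtain ⟨⟨l, m⟩, h⟩ := Finite.exists_max fun x : Fin d × Fin d => V.valuation (C n x.1 x.2)
    exact ⟨l, m, fun a b => h (a, b)⟩
  choose l m hlm using hmax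
  have hdet : ∀ n, V.valuation (C n).det = 1 := by
    intro n
    rw [← RingHom.map_det]
    exact valuation_det_eq_one hA hF hρ V hV (u := iterHom F n) (hF.reg.iterate n)
  have hconst : ∀ n, V.valuation (C n (l n) (m n)) = V.valuation (C 0 (l 0) (m 0)) := by
    intro n
    have h := fun x => valuation_coeffMatrix_iterate_le_iff hA hF hρ V hV x n
    exact le_antisymm ((h _).mpr (hlm 0) _ _) ((h _).mp (hlm n) _ _)
  have hne : ∀ n, C n (l n) (m n) ≠ 0 := by
    intro n h0
    have h1 : C n = 0 := by
      ext a b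
      have := hlm n a b
      rw [h0, map_zero, le_zero_iff, Valuation.zero_iff] at this
      exact this
    have h2 := hdet n
    rw [h1, Matrix.det_zero, map_zero] at h2
    exact zero_ne_one h2
  have key : V.valuation (C 0 (l 0) (m 0) ^ d) = 1 := by
    refine hdiv _ (pow_ne_zero _ (hne 0)) fun r => ?_
    obtain ⟨n, hn⟩ := hirr.exists_iterate_eq_mul_pow hA hF hρ p (Q := Q) r
    have hn' : ∀ a b, ∃ z, C n a b = C n (l n) (m n) * z ^ p ^ r := fun a b =>
      hn a b (l n) (m n) fun h0 => hne n (by simp [C, h0])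
    choose z hz using hn'
    have h1 : C n = C n (l n) (m n) • (iterateFrobenius Q p r).mapMatrix (of z) := by
      ext a b
      rw [hz]
      rfl
    have h2 := hdet n
    rw [h1, det_smul, ← RingHom.map_det, Fintype.card_fin, map_mul, iterateFrobenius_def] at h2
    refine ⟨(of z).det⁻¹, ?_⟩
    rw [map_pow V.valuation (C 0 _ _), ← hconst n, ← map_pow, map_inv₀, inv_pow, ← map_pow]
    exact eq_inv_of_mul_eq_one_left h2
  rw [map_pow] at key
  have h1 := (pow_eq_one_iff_of_nonneg zero_le i.pos.ne').mp key
  exact (V.valuation_le_one_iff _).mp ((hlm 0 i j).trans_eq h1)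

/-- The subring of functions pulled back along the Lang map. -/
def langRange (hA : IsCoordRing A) (hF : IsReg A F) : Subalgebra k A :=
  (pull _ (hA.isReg_lang hF)).range

theorem pull_lang_injective (hA : IsCoordRing A) (hF : IsDominant A F) :
    Function.Injective (pull _ (hA.isReg_lang hF.reg)) := by
  rw [injective_iff_map_eq_zero]
  intro f hf
  exact Subtype.ext (hF.dom f f.2 fun g => congrArg (fun f : A => (f : Γ → k) g) hf)

theorem langRange_isAlgebraic (hA : IsCoordRing A) (hF : IsDominant A F) :
    Algebra.IsAlgebraic (langRange hA hF.reg) A := by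
  have := hA.isDomain
  have : Algebra.FiniteType k A := A.fg_iff_finiteType.mp hA.fg
  have e : A ≃ₐ[k] langRange hA hF.reg := AlgEquiv.ofInjective _ (pull_lang_injective hA hF)
  have h1 := trdeg_add_eq k (langRange hA hF.reg) (A := A)
  rw [← e.trdeg_eq] at h1
  exact trdeg_eq_zero_iff.mp
    (Cardinal.eq_of_add_eq_add_left (h1.trans (add_zero _).symm) trdeg_lt_aleph0_of_finiteType)

theorem langRange_finiteType (hA : IsCoordRing A) (hF : IsReg A F) :
    Algebra.FiniteType k (langRange hA hF) := by
  have : Algebra.FiniteType k A := A.fg_iff_finiteType.mp hA.fg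
  exact Algebra.FiniteType.of_surjective _ (AlgHom.rangeRestrict_surjective _)

theorem coeffMatrix_mul_coeffMatrix_inv (hA : IsCoordRing A) (hρ : IsRegRep A ρ) :
    coeffMatrix hρ isReg_id * coeffMatrix hρ (hA.isReg_inv isReg_id) = 1 := by
  refine matrix_ext fun g => ?_
  refine ((ev A g : A →+* k).mapMatrix.map_mul _ _).trans ?_
  exact (rep_mul_inv ρ g).trans ((ev A g : A →+* k).mapMatrix.map_one).symm

/-- The coefficients of an irreducible representation are integral over the functions pulled back
along the Lang map. -/
theorem IsIrred.mem_integralClosure [IsAlgClosed k] (hA : IsCoordRing A)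
    (hF : IsDominant A F) (hρ : IsRegRep A ρ) (hirr : IsIrred ρ) (i j : Fin d) :
    coeffMatrix hρ isReg_id i j ∈ integralClosure (langRange hA hF.reg) A ∧
      coeffMatrix hρ (hA.isReg_inv isReg_id) i j ∈ integralClosure (langRange hA hF.reg) A := by
  have := hA.isDomain
  have : Algebra.FiniteType k A := A.fg_iff_finiteType.mp hA.fg
  have := langRange_finiteType hA hF.reg
  have := langRange_isAlgebraic hA hF
  obtain ⟨Q, _, _, _, _, _⟩ : ∃ (Q : Type) (_ : Field Q) (_ : Algebra k Q) (_ : Algebra A Q)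
      (_ : IsScalarTower k A Q), IsFractionRing A Q :=
    ⟨FractionRing A, inferInstance, inferInstance, inferInstance, inferInstance, inferInstance⟩
  have : Algebra.EssFiniteType A Q := .of_isLocalization _ (nonZeroDivisors A)
  have : Algebra.EssFiniteType k Q := .comp k A Q
  have : Algebra.IsAlgebraic A Q := IsLocalization.isAlgebraic Q (nonZeroDivisors A)
  have : Algebra.IsAlgebraic (langRange hA hF.reg) Q := Algebra.IsAlgebraic.trans _ A _
  have : FaithfulSMul (langRange hA hF.reg) Q := (faithfulSMul_iff_algebraMap_injective _ _).mpr
    ((IsFractionRing.injective A Q).comp Subtype.val_injective)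
  obtain ⟨p, hp, hmem⟩ : ∃ p : ℕ, 1 < p ∧ ∀ V : ValuationSubring Q,
      (∀ f : A, algebraMap A Q (pull _ (hA.isReg_lang hF.reg) f) ∈ V) →
      (∀ u ≠ 0, (∀ r : ℕ, ∃ z, V.valuation u = V.valuation z ^ p ^ r) → V.valuation u = 1) →
      ∀ i j, algebraMap A Q (coeffMatrix hρ isReg_id i j) ∈ V := by
    rcases CharP.exists' k with h | ⟨p, h, _⟩
    · refine ⟨2, one_lt_two, fun V hV _ i j => ?_⟩
      have hd := hirr.dim_le_one_of_charZero hA hF hρ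
      obtain rfl : d = 1 := le_antisymm hd hirr.pos
      have := valuation_det_eq_one hA hF hρ V hV (u := MonoidHom.id Γ) isReg_id
      rw [det_fin_one] at this
      rw [Subsingleton.elim i 0, Subsingleton.elim j 0]
      exact (V.valuation_le_one_iff _).mp this.le
    · exact ⟨p, h.out.one_lt, hirr.algebraMap_coeff_mem_of_charP hA hF hρ p⟩
  have key : ∀ f : A, (∀ V : ValuationSubring Q,
      (∀ f : A, algebraMap A Q (pull _ (hA.isReg_lang hF.reg) f) ∈ V) →
      (∀ i j, algebraMap A Q (coeffMatrix hρ isReg_id i j) ∈ V) → algebraMap A Q f ∈ V) →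
      f ∈ integralClosure (langRange hA hF.reg) A := by
    intro f hf
    rw [mem_integralClosure_iff]
    by_contra hintg
    obtain ⟨V, hV, hfV, hdiv⟩ := exists_valuationSubring_not_divisible (k := k)
      (B := langRange hA hF.reg) (c := algebraMap A Q f)
      (fun h => hintg ((isIntegral_algebraMap_iff (IsFractionRing.injective A Q)).mp h)) hp
    have hV' : ∀ f : A, algebraMap A Q (pull _ (hA.isReg_lang hF.reg) f) ∈ V := fun f =>
      hV ⟨_, f, rfl⟩
    exact hfV (hf V hV' (hmem V hV' hdiv))
  refine ⟨key _ fun V _ h => h i j, key _ fun V hV h => ?_⟩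
  have hdet := valuation_det_eq_one hA hF hρ V hV (u := MonoidHom.id Γ) isReg_id
  let M : Matrix (Fin d) (Fin d) V := of fun i j => ⟨_, h i j⟩
  have hM : V.subtype.mapMatrix M = (algebraMap A Q).mapMatrix (coeffMatrix hρ isReg_id) := rfl
  have hMdet : IsUnit M.det := by
    rw [ValuationSubring.valuation_eq_one_iff, ← hdet]
    change V.valuation (V.subtype M.det) = _
    rw [RingHom.map_det, hM, ← RingHom.map_det]
  have h1 : V.subtype.mapMatrix M * V.subtype.mapMatrix M⁻¹ = 1 := by
    rw [← map_mul, Matrix.mul_nonsing_inv _ hMdet, map_one]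
  have h2 : V.subtype.mapMatrix M *
      (algebraMap A Q).mapMatrix (coeffMatrix hρ (hA.isReg_inv isReg_id)) = 1 := by
    rw [hM, ← map_mul, coeffMatrix_mul_coeffMatrix_inv hA hρ, map_one]
  have h3 := (Matrix.inv_eq_right_inv h2).symm.trans (Matrix.inv_eq_right_inv h1)
  have h4 : algebraMap A Q (coeffMatrix hρ (hA.isReg_inv isReg_id) i j) = M⁻¹ i j :=
    congrFun (congrFun h3 i) j
  exact h4 ▸ (M⁻¹ i j).2

end

section

variable {k Γ : Type} [Field k] [Group Γ] {A : Subalgebra k (Γ → k)} {d : ℕ}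
  {ρ : Γ →* Matrix (Fin d) (Fin d) k} {F : Γ →* Γ}

/-- Surjective homomorphisms to an algebraically closed field extend to integral extensions. -/
theorem exists_ringHom_comp_eq_of_isIntegral {B C : Type*} [IsAlgClosed k] [CommRing B] [CommRing C]
    [Algebra B C] [Algebra.IsIntegral B C] [FaithfulSMul B C] (φ : B →+* k)
    (hφ : Function.Surjective φ) : ∃ ψ : C →+* k, ∀ b, ψ (algebraMap B C b) = φ b := by
  have := RingHom.ker_isMaximal_of_surjective φ hφ
  obtain ⟨P, hP, hPm⟩ := Ideal.exists_maximal_ideal_liesOver_of_isIntegral (S := C) (RingHom.ker φ)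
  let : Field (C ⧸ P) := Ideal.Quotient.field P
  let e : B ⧸ RingHom.ker φ ≃+* k := RingHom.quotientKerEquivOfSurjective hφ
  have hker : ∀ b ∈ RingHom.ker φ, (Ideal.Quotient.mk P).comp (algebraMap B C) b = 0 := by
    intro b hb
    rw [hPm.over] at hb
    exact Ideal.Quotient.eq_zero_iff_mem.mpr hb
  let i : k →+* C ⧸ P := (Ideal.Quotient.lift (RingHom.ker φ) _ hker).comp e.symm
  have hi : i.comp φ = (Ideal.Quotient.mk P).comp (algebraMap B C) := by
    ext b
    have : e.symm (φ b) = Ideal.Quotient.mk _ b := by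
      rw [RingEquiv.symm_apply_eq]
      rfl
    simp [i, this]
  let := i.toAlgebra
  have hintg : i.IsIntegral := by
    refine RingHom.IsIntegral.tower_top φ i (hi ▸ ?_)
    exact (algebraMap_isIntegral_iff.mpr inferInstance).trans _ _
      (RingHom.isIntegral_of_surjective _ Ideal.Quotient.mk_surjective)
  have : Algebra.IsIntegral k (C ⧸ P) := ⟨hintg⟩
  let e' : k ≃+* C ⧸ P := RingEquiv.ofBijective i
    (IsAlgClosed.algebraMap_bijective_of_isIntegral (k := k) (K := C ⧸ P))
  refine ⟨(e'.symm : C ⧸ P →+* k).comp (Ideal.Quotient.mk P), fun b => ?_⟩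
  exact (e'.symm_apply_eq).mpr (RingHom.congr_fun hi b).symm

theorem exists_subring_ringHom_of_surjective {B C : Type*} [IsAlgClosed k] [CommRing B]
    [CommRing C] [Algebra B C] [FaithfulSMul B C] (φ : B →+* k) (hφ : Function.Surjective φ) :
    ∃ (S : Subring C) (ψ : S →+* k), (∀ a, IsIntegral B a → a ∈ S) ∧
      ∀ b (c : S), (c : C) = algebraMap B C b → ψ c = φ b := by
  have : FaithfulSMul B (integralClosure B C) :=
    (faithfulSMul_iff_algebraMap_injective _ _).mpr fun x y h =>
      FaithfulSMul.algebraMap_injective B C (congrArg Subtype.val h)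
  obtain ⟨ψ, hψ⟩ := exists_ringHom_comp_eq_of_isIntegral (C := integralClosure B C) φ hφ
  refine ⟨(integralClosure B C).toSubring, ψ, fun a ha => ha, fun b c hc => ?_⟩
  rw [← hψ b]
  exact congrArg ψ (Subtype.ext hc)

/-- Evaluation at a point, transported to the functions pulled back along the Lang map, extends to
their integral closure. -/
theorem exists_ringHom_integralClosure [IsAlgClosed k] (hA : IsCoordRing A) (hF : IsDominant A F)
    (x : Γ) : ∃ (C : Subring A) (φ : C →+* k), (∀ a, IsIntegral (langRange hA hF.reg) a → a ∈ C) ∧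
      ∀ (f : A) (c : C), (c : A) = pull _ (hA.isReg_lang hF.reg) f → φ c = (f : Γ → k) x := by
  let e : A ≃ₐ[k] langRange hA hF.reg := AlgEquiv.ofInjective _ (pull_lang_injective hA hF)
  let χ : langRange hA hF.reg →ₐ[k] k := (ev A x).comp e.symm.toAlgHom
  have hχ : Function.Surjective χ.toRingHom :=
    fun c => ⟨algebraMap k _ c, χ.commutes c⟩
  obtain ⟨C, φ, hC, h⟩ := exists_subring_ringHom_of_surjective (k := k)
    (B := langRange hA hF.reg) (C := A) χ.toRingHom hχ
  refine ⟨C, φ, hC, fun f c hc => ?_⟩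
  have h1 : φ c = χ (e f) := h (e f) c hc
  rw [h1]
  exact congrArg (fun f : A => (f : Γ → k) x) (e.symm_apply_apply f)

/-- The image of the Lang map contains a nonempty principal open subset. -/
theorem exists_ne_zero_forall_exists_lang_eq [IsAlgClosed k] (hA : IsCoordRing A)
    (hF : IsDominant A F) : ∃ f : A, f ≠ 0 ∧ ∀ x, (f : Γ → k) x ≠ 0 → ∃ g, lang F g = x := by
  have := hA.isDomain
  have : Algebra.FiniteType k A := A.fg_iff_finiteType.mp hA.fg
  have := langRange_isAlgebraic hA hF
  obtain ⟨s, hs⟩ := Algebra.FiniteType.out (R := k) (A := A)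
  obtain ⟨⟨_, f, rfl⟩, hr, hintg⟩ :=
    Algebra.IsAlgebraic.exists_integral_multiples (langRange hA hF.reg) s
  set r := pull _ (hA.isReg_lang hF.reg) f with hrdef
  have hmul : ∀ a : A, ∃ n : ℕ, IsIntegral (langRange hA hF.reg) (r ^ n * a) := by
    intro a
    have ha : a ∈ Algebra.adjoin k (s : Set A) := hs ▸ Algebra.mem_top
    have hri : IsIntegral (langRange hA hF.reg) r :=
      isIntegral_algebraMap (x := (⟨r, f, rfl⟩ : langRange hA hF.reg))
    induction ha using Algebra.adjoin_induction with
    | mem x hx => exact ⟨1, by rw [pow_one]; exact hintg x hx⟩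
    | algebraMap c => exact ⟨0, by
        rw [pow_zero, one_mul]
        exact isIntegral_algebraMap (x := algebraMap k (langRange hA hF.reg) c)⟩
    | add x y _ _ hx hy =>
      obtain ⟨n, hn⟩ := hx
      obtain ⟨m, hm⟩ := hy
      refine ⟨n + m, ?_⟩
      have : r ^ (n + m) * (x + y) = r ^ m * (r ^ n * x) + r ^ n * (r ^ m * y) := by ring
      exact this ▸ ((hri.pow m).mul hn).add ((hri.pow n).mul hm)
    | mul x y _ _ hx hy =>
      obtain ⟨n, hn⟩ := hx
      obtain ⟨m, hm⟩ := hy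
      refine ⟨n + m, ?_⟩
      have : r ^ (n + m) * (x * y) = r ^ n * x * (r ^ m * y) := by ring
      exact this ▸ hn.mul hm
  refine ⟨f, fun h0 => hr (Subtype.ext (by simp [h0])), fun x hx => ?_⟩
  obtain ⟨C, φ, hC, hφ⟩ := exists_ringHom_integralClosure hA hF x
  let J : Ideal A :=
    Ideal.span {a | ∃ h : A, (h : Γ → k) x = 0 ∧ pull _ (hA.isReg_lang hF.reg) h = a}
  have hJ : ∀ a ∈ J, ∃ (n : ℕ) (c : C), (c : A) = r ^ n * a ∧ φ c = 0 := by
    intro a ha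
    have hri : ∃ c : C, (c : A) = r :=
      ⟨⟨r, hC _ <| isIntegral_algebraMap (x := (⟨r, f, rfl⟩ : langRange hA hF.reg))⟩, rfl⟩
    obtain ⟨c, hc⟩ := hri
    induction ha using Submodule.span_induction with
    | mem a ha =>
      obtain ⟨h, hx, rfl⟩ := ha
      let c : C := ⟨_, hC _ <| isIntegral_algebraMap (x := (⟨_, h, rfl⟩ : langRange hA hF.reg))⟩
      exact ⟨0, c, by rw [pow_zero, one_mul]; rfl, (hφ h c rfl).trans hx⟩
    | zero => exact ⟨0, 0, by simp, map_zero φ⟩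
    | add a b _ _ ha hb =>
      obtain ⟨n, u, hu, hu'⟩ := ha
      obtain ⟨m, v, hv, hv'⟩ := hb
      refine ⟨n + m, c ^ m * u + c ^ n * v, ?_, by simp [hu', hv']⟩
      push_cast
      rw [hc, hu, hv]
      ring
    | smul b a _ ha =>
      obtain ⟨n, u, hu, hu'⟩ := ha
      obtain ⟨m, hm⟩ := hmul b
      refine ⟨n + m, ⟨_, hC _ hm⟩ * u, ?_, by simp [hu']⟩
      push_cast
      rw [hu, smul_eq_mul]
      ring
  have hJtop : J ≠ ⊤ := by
    intro htop
    obtain ⟨n, c, hc, hc'⟩ := hJ 1 (htop ▸ Submodule.mem_top)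
    have := hφ (f ^ n) c (by rw [hc, mul_one, map_pow])
    rw [hc'] at this
    exact pow_ne_zero n hx this.symm
  obtain ⟨ψ, hψ⟩ := exists_algHom_of_ne_top (k := k) hJtop
  obtain ⟨g, hg⟩ := hA.exists_point ψ
  refine ⟨g, hA.separates _ _ fun h hh => ?_⟩
  have h1 := hψ (pull _ (hA.isReg_lang hF.reg) (⟨h, hh⟩ - algebraMap k A (h x)))
    (Ideal.subset_span ⟨_, by
      change h x - h x = 0
      exact sub_self _, rfl⟩)
  rw [hg] at h1
  exact sub_eq_zero.mp h1

/-- The action of `Γ` on functions by twisted conjugation. -/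
def twistedAction (F : Γ →* Γ) : Γ →* Module.End k (Γ → k) where
  toFun g := LinearMap.funLeft k k fun x => g⁻¹ * x * F g
  map_one' := by
    ext f x
    simp [LinearMap.funLeft_apply]
  map_mul' g h := by
    ext f x
    simp [LinearMap.funLeft_apply, mul_assoc]

@[simp] theorem twistedAction_apply (g : Γ) (f : Γ → k) (x : Γ) :
    twistedAction F g f x = f (g⁻¹ * x * F g) := rfl

/-- A nonzero function lying in a stable space of functions yields an irreducible
representation inside this space. -/
theorem exists_isIrred_of_stable (hA : IsCoordRing A) (hF : IsReg A F) (I : Submodule k (Γ → k))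
    (hIA : ∀ f ∈ I, f ∈ A) (hI : ∀ g, ∀ f ∈ I, twistedAction F g f ∈ I) (h0 : I ≠ ⊥) :
    ∃ (d : ℕ) (ρ : Γ →* Matrix (Fin d) (Fin d) k) (e : Fin d → Γ → k), IsRegRep A ρ ∧ IsIrred ρ ∧
      (∀ j, e j ∈ I ∧ e j ≠ 0) ∧ ∀ g j x, e j (g⁻¹ * x * F g) = ∑ i, ρ g i j * e i x := by
  classical
  have hex : ∃ (n : ℕ) (E : Submodule k (Γ → k)), E ≠ ⊥ ∧ E ≤ I ∧
      (∀ g, ∀ f ∈ E, twistedAction F g f ∈ E) ∧ FiniteDimensional k E ∧ Module.finrank k E = n := by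
    obtain ⟨f, hf, hf0⟩ := I.exists_mem_ne_zero_of_ne_bot h0
    obtain ⟨ι, _, α, β, h⟩ := hA.exists_two_sided (hA.isReg_inv isReg_id) hF (hIA f hf)
    refine ⟨_, Submodule.span k (Set.range fun g => twistedAction F g f), ?_, ?_, ?_, ?_, rfl⟩
    · rw [Submodule.ne_bot_iff]
      refine ⟨f, Submodule.subset_span ⟨1, by simp⟩, hf0⟩
    · rw [Submodule.span_le]
      rintro _ ⟨g, rfl⟩
      exact hI g f hf
    · intro g u hu
      induction hu using Submodule.span_induction with
      | mem u hu =>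
        obtain ⟨h, rfl⟩ := hu
        refine Submodule.subset_span ⟨g * h, ?_⟩
        simp only [map_mul, Module.End.mul_apply]
      | zero => rw [map_zero]; exact zero_mem _
      | add u v _ _ hu hv => rw [map_add]; exact add_mem hu hv
      | smul c u _ hu => rw [map_smul]; exact Submodule.smul_mem _ c hu
    · have : FiniteDimensional k (Submodule.span k (Set.range fun i => (β i : Γ → k))) :=
        FiniteDimensional.span_of_finite k (Set.finite_range _)
      refine Submodule.finiteDimensional_of_le (S₂ := Submodule.span k (Set.range fun i =>
        (β i : Γ → k))) (Submodule.span_le.mpr ?_)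
      rintro _ ⟨g, rfl⟩
      have : twistedAction F g f = ∑ i, (α i : Γ → k) g • (β i : Γ → k) := by
        ext x
        simp [h]
      change twistedAction F g f ∈ _
      rw [this]
      exact Submodule.sum_mem _ fun i _ => Submodule.smul_mem _ _ (Submodule.subset_span ⟨i, rfl⟩)
  obtain ⟨E, hE0, hEI, hEs, _, hEn⟩ := Nat.find_spec hex
  have hmin : ∀ W ≤ E, W ≠ ⊥ → (∀ g, ∀ f ∈ W, twistedAction F g f ∈ W) → W = E := by
    intro W hW hW0 hWs
    have := Submodule.finiteDimensional_of_le hW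
    refine Submodule.eq_of_le_of_finrank_eq hW (le_antisymm (Submodule.finrank_mono hW) ?_)
    rw [hEn]
    exact Nat.find_min' hex ⟨W, hW0, hW.trans hEI, hWs, this, rfl⟩
  let b := Module.finBasis k E
  let T : Γ →* Module.End k E :=
    { toFun g := (twistedAction F g).restrict (hEs g)
      map_one' := by ext; simp
      map_mul' g h := by ext; simp }
  have hT : ∀ g u, (T g u : Γ → k) = twistedAction F g u := fun _ _ => rfl
  let ρ : Γ →* Matrix _ _ k := (LinearMap.toMatrixAlgEquiv b).toMulEquiv.toMonoidHom.comp T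
  have hρ : ∀ g i j, ρ g i j = b.repr (T g (b j)) i := fun g i j =>
    LinearMap.toMatrixAlgEquiv_apply b (T g) i j
  have hTb : ∀ g j, T g (b j) = ∑ i, ρ g i j • b i := by
    intro g j
    simp only [hρ]
    exact (b.sum_repr _).symm
  refine ⟨_, ρ, fun j => b j, fun i j => ?_, ⟨?_, fun W hW => ?_⟩,
    fun j => ⟨hEI (b j).2, fun h => b.ne_zero j (Subtype.ext h)⟩, fun g j x => ?_⟩
  · obtain ⟨c, hc⟩ := LinearMap.exists_extend (b.coord i)
    obtain ⟨ι, _, α, β, h⟩ := hA.exists_two_sided (hA.isReg_inv isReg_id) hF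
      (hIA (b j) (hEI (b j).2))
    have h1 : ∀ g, ρ g i j = ∑ l, (α l : Γ → k) g * c (β l) := by
      intro g
      have h2 : twistedAction F g (b j) = ∑ l, (α l : Γ → k) g • (β l : Γ → k) := by
        ext x
        simp [h]
      have h3 : ρ g i j = c (twistedAction F g (b j)) := by
        rw [hρ, ← hT]
        exact (LinearMap.congr_fun hc _).symm
      rw [h3, h2]
      simp
    simp only [h1]
    exact sum_apply_mem _ _ fun l _ => mul_apply_mem (α l).2 (const_mem _)
  · have := Submodule.nontrivial_iff_ne_bot.mpr hE0
    exact Module.finrank_pos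
  · by_cases hW0 : W = ⊥
    · exact Or.inl hW0
    right
    let m : (Fin (Module.finrank k E) → k) →ₗ[k] (Γ → k) :=
      E.subtype ∘ₗ b.equivFun.symm.toLinearMap
    have hm : Function.Injective m := Subtype.val_injective.comp b.equivFun.symm.injective
    have hmρ : ∀ g v, twistedAction F g (m v) = m (ρ g *ᵥ v) := by
      intro g v
      have : T g (b.equivFun.symm v) = b.equivFun.symm (ρ g *ᵥ v) := by
        rw [LinearEquiv.eq_symm_apply]
        have := LinearMap.toMatrix_mulVec_repr b b (T g) (b.equivFun.symm v)
        simp only [← Module.Basis.equivFun_apply, LinearEquiv.apply_symm_apply] at this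
        exact this.symm
      exact congrArg Subtype.val this
    have h1 := hmin (W.map m) (by rintro _ ⟨v, -, rfl⟩; exact (b.equivFun.symm v).2)
      (fun h => hW0 (Submodule.map_injective_of_injective hm (h.trans (Submodule.map_bot m).symm)))
      (by rintro g _ ⟨v, hv, rfl⟩; exact ⟨_, hW g v hv, (hmρ g v).symm⟩)
    rw [eq_top_iff]
    intro v _
    obtain ⟨w, hw, hwv⟩ := h1.ge (b.equivFun.symm v).2
    exact (hm hwv : w = v) ▸ hw
  · have := congrFun (congrArg Subtype.val (hTb g j)) x
    rw [hT] at this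
    simpa using this

/-- **Lang–Steinberg**: if the Lang map is dominant, it is surjective. -/
theorem lang_surjective [IsAlgClosed k] (hA : IsCoordRing A) (hF : IsDominant A F) :
    Function.Surjective (lang F) := by
  obtain ⟨f, hf0, hf⟩ := exists_ne_zero_forall_exists_lang_eq hA hF
  let I : Submodule k (Γ → k) :=
    { carrier := {f | f ∈ A ∧ ∀ x, (¬∃ g, lang F g = x) → f x = 0}
      zero_mem' := ⟨A.zero_mem, fun _ _ => rfl⟩
      add_mem' := fun ha hb => ⟨A.add_mem ha.1 hb.1, fun x hx => by simp [ha.2 x hx, hb.2 x hx]⟩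
      smul_mem' := fun c _ ha => ⟨A.smul_mem ha.1 c, fun x hx => by simp [ha.2 x hx]⟩ }
  have hI : ∀ g, ∀ f ∈ I, twistedAction F g f ∈ I := by
    refine fun g f hf =>
      ⟨hA.isReg_mul (hA.isReg_mul (isReg_const _) isReg_id) (isReg_const _) _ hf.1,
        fun x hx => hf.2 _ fun ⟨h, hh⟩ => hx ⟨g * h, ?_⟩⟩
    have hx : x = g * lang F h * (F g)⁻¹ := by rw [hh]; group
    rw [hx, lang, lang, map_mul]
    group
  obtain ⟨d, ρ, e, hρ, hirr, he, hact⟩ := exists_isIrred_of_stable hA hF.reg I (fun f hf => hf.1) hI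
    ((Submodule.ne_bot_iff _).mpr ⟨f, ⟨f.2, fun x hx => by_contra fun h => hx (hf x h)⟩,
      fun h => hf0 (Subtype.ext h)⟩)
  intro x
  by_contra hx
  obtain ⟨C, φ, hC, hφ⟩ := exists_ringHom_integralClosure hA hF x
  let M : Matrix (Fin d) (Fin d) C :=
    of fun i j => ⟨_, hC _ (hirr.mem_integralClosure hA hF hρ i j).1⟩
  let N : Matrix (Fin d) (Fin d) C :=
    of fun i j => ⟨_, hC _ (hirr.mem_integralClosure hA hF hρ i j).2⟩
  have hMN : M * N = 1 := by
    have hinj : Function.Injective C.subtype.mapMatrix :=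
      Matrix.map_injective (m := Fin d) (n := Fin d) Subtype.val_injective
    refine hinj ?_
    rw [map_mul, map_one]
    exact coeffMatrix_mul_coeffMatrix_inv hA hρ
  have hNM : φ.mapMatrix N * φ.mapMatrix M = 1 := by
    rw [← map_mul, mul_eq_one_comm.mp hMN, map_one]
  have hsum : ∀ j, pull _ (hA.isReg_lang hF.reg) ⟨e j, (he j).1.1⟩ =
      ∑ i, algebraMap k A (e i 1) * N i j := by
    intro j
    ext g
    have := hact g⁻¹ j 1
    simp only [inv_inv, mul_one, map_inv] at this
    refine this.trans ?_
    simp only [AddSubmonoidClass.coe_finsetSum, Finset.sum_apply, mul_comm]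
    rfl
  have hzero : (fun i => e i 1) ᵥ* (φ.mapMatrix N) = 0 := by
    ext j
    let c : k → C := fun a =>
      ⟨algebraMap k A a, hC _ <| isIntegral_algebraMap (x := algebraMap k (langRange hA hF.reg) a)⟩
    have hc : ∀ a, φ (c a) = a := fun a => hφ (algebraMap k A a) _ ((pull _ _).commutes a).symm
    have h1 := hφ ⟨e j, (he j).1.1⟩ (∑ i, c (e i 1) * N i j) (by
      rw [hsum]
      push_cast
      rfl)
    rw [map_sum] at h1
    simp only [map_mul, hc] at h1
    exact h1.trans ((he j).1.2 x hx)
  have hone : (fun i => e i 1) = 0 := by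
    rw [← vecMul_one (fun i => e i 1), ← hNM, ← vecMul_vecMul, hzero, zero_vecMul]
  obtain ⟨j⟩ : Nonempty (Fin d) := ⟨⟨0, hirr.pos⟩⟩
  refine (he j).2 (congrArg Subtype.val (pull_lang_injective hA hF
    (((hsum j).trans (Finset.sum_eq_zero fun i _ => ?_)).trans (map_zero _).symm) :
      (⟨e j, (he j).1.1⟩ : A) = 0))
  rw [show e i 1 = 0 from congrFun hone i, map_zero, zero_mul]

end

section

theorem comap_eq_of_le_comap {B : Type*} [CommRing B] [IsNoetherianRing B] {σ : B →+* B}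
    (hσ : Function.Surjective σ) {P : Ideal B} (h : P ≤ P.comap σ) : P.comap σ = P := by
  have hiter : ∀ n (f : B), f ∈ P → σ^[n] f ∈ P := by
    intro n
    induction n with
    | zero => exact fun f hf => hf
    | succ n ih => exact fun f hf => ih _ (h hf)
  have hmono : Monotone fun n => P.comap (σ ^ n) := by
    refine monotone_nat_of_le_succ fun n f hf => ?_
    rw [Ideal.mem_comap, RingHom.coe_pow] at hf ⊢
    rw [Function.iterate_succ_apply']
    exact h hf
  obtain ⟨n, hn⟩ := monotone_stabilizes_iff_noetherian.mpr ‹_› ⟨_, hmono⟩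
  refine le_antisymm (fun f hf => ?_) h
  obtain ⟨u, rfl⟩ := hσ.iterate n f
  have h1 : u ∈ P.comap (σ ^ (n + 1)) := by
    rw [Ideal.mem_comap, RingHom.coe_pow, Function.iterate_succ_apply']
    exact hf
  have h2 : u ∈ P.comap (σ ^ n) := (hn (n + 1) n.le_succ).ge h1
  rwa [Ideal.mem_comap, RingHom.coe_pow] at h2

section LocalKernel

variable {k Γ : Type} [Field k] [Group Γ] {A : Subalgebra k (Γ → k)}

/-- The ideal of functions vanishing near `x`. -/
def localKernel (A : Subalgebra k (Γ → k)) (x : Γ) : Ideal A where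
  carrier := {f | ∃ s : A, (s : Γ → k) x ≠ 0 ∧ s * f = 0}
  zero_mem' := ⟨1, by simp, by simp⟩
  add_mem' := by
    rintro f g ⟨s, hs, hsf⟩ ⟨t, ht, htg⟩
    refine ⟨s * t, mul_ne_zero hs ht, ?_⟩
    linear_combination t * hsf + s * htg
  smul_mem' := by
    rintro c f ⟨s, hs, hsf⟩
    refine ⟨s, hs, ?_⟩
    rw [smul_eq_mul]
    linear_combination c * hsf

theorem apply_eq_zero_of_mem_localKernel {x : Γ} {f : A} (hf : f ∈ localKernel A x) :
    (f : Γ → k) x = 0 := by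
  obtain ⟨s, hs, h⟩ := hf
  exact (mul_eq_zero.mp (congrArg (fun f : A => (f : Γ → k) x) h)).resolve_left hs

/-- The functions vanishing near a point form a locally constant family of ideals. -/
theorem exists_localKernel_eq [IsNoetherianRing A] (hA : ∀ h : Γ, IsReg A (fun x => h * x))
    (x : Γ) :
    ∃ s : A, (s : Γ → k) x ≠ 0 ∧ ∀ y, (s : Γ → k) y ≠ 0 → localKernel A y = localKernel A x := by
  classical
  obtain ⟨T, hT⟩ := (isNoetherianRing_iff_ideal_fg A).mp ‹_› (localKernel A x)
  have hmem : ∀ f ∈ T, f ∈ localKernel A x := fun f hf => hT ▸ Ideal.subset_span hf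
  choose! s hs hsf using hmem
  refine ⟨∏ f ∈ T, s f, ?_, fun y hy => ?_⟩
  · have := map_prod (ev A x) s T
    rw [← ev_apply, this]
    exact Finset.prod_ne_zero_iff.mpr hs
  have hle : localKernel A x ≤ localKernel A y := by
    rw [← hT, Ideal.span_le]
    intro f hf
    refine ⟨_, hy, ?_⟩
    rw [← Finset.mul_prod_erase T s hf, mul_right_comm, hsf f hf, zero_mul]
  have hcomap : ∀ a b : Γ, (localKernel A b).comap (pull _ (hA (a * b⁻¹))) ≤ localKernel A a := by
    rintro a b f ⟨s, hs, hsf⟩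
    refine ⟨pull _ (hA (b * a⁻¹)) s, by simpa using hs, ?_⟩
    ext z
    simpa [mul_assoc] using congrArg (fun f : A => (f : Γ → k) (b * a⁻¹ * z)) hsf
  have hcomap' : localKernel A y = (localKernel A x).comap (pull _ (hA (y * x⁻¹)) : A →+* A) := by
    refine le_antisymm (fun f hf => ?_) (hcomap y x)
    have h1 : pull _ (hA (x * y⁻¹)) (pull _ (hA (y * x⁻¹)) f) = f := by
      ext z
      simp [mul_assoc]
    exact hcomap x y (show pull _ (hA (x * y⁻¹)) (pull _ (hA (y * x⁻¹)) f) ∈ _ from h1.symm ▸ hf)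
  rw [hcomap']
  refine comap_eq_of_le_comap (fun f => ⟨pull _ (hA (x * y⁻¹)) f, ?_⟩) (hcomap' ▸ hle)
  ext z
  simp [mul_assoc]

end LocalKernel

variable {k : Type} [Field k] {n : ℕ}

/-- Restriction to `G` of polynomial functions on `GL n`. -/
def restrictToGroup (G : Subgroup (GL (Fin n) k)) : MvPolynomial (Coord n) k →ₐ[k] G → k :=
  aeval fun c (g : G) => coords (g : GL (Fin n) k) c

theorem restrictToGroup_apply (G : Subgroup (GL (Fin n) k)) (P : MvPolynomial (Coord n) k)
    (g : G) : restrictToGroup G P g = eval (coords (g : GL (Fin n) k)) P := by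
  have : (Pi.evalAlgHom k (fun _ : G => k) g).comp (restrictToGroup G) =
      aeval (coords (g : GL (Fin n) k)) := by
    ext c
    simp [restrictToGroup]
  exact (AlgHom.congr_fun this P).trans (RingHom.congr_fun (coe_aeval_eq_eval _) P)

/-- The ring of restrictions to `G` of polynomial functions on `GL n`. -/
def coordRing (G : Subgroup (GL (Fin n) k)) : Subalgebra k (G → k) := (restrictToGroup G).range

theorem mem_coordRing {G : Subgroup (GL (Fin n) k)} {f : G → k} :
    f ∈ coordRing G ↔ ∃ P, ∀ g : G, f g = eval (coords (g : GL (Fin n) k)) P := by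
  constructor
  · rintro ⟨P, hP⟩
    exact ⟨P, fun g => (congrFun hP g).symm.trans (restrictToGroup_apply G P g)⟩
  · rintro ⟨P, hP⟩
    have h : restrictToGroup G P = f := by
      ext g
      rw [restrictToGroup_apply, hP]
    exact (AlgHom.mem_range _).mpr ⟨P, h⟩

theorem coords_mul_inl (g h : GL (Fin n) k) (i j : Fin n) :
    coords (g * h) (.inl (i, j)) = ∑ l, coords g (.inl (i, l)) * coords h (.inl (l, j)) :=
  Matrix.mul_apply

theorem coords_mul_inr (g h : GL (Fin n) k) (i j : Fin n) :
    coords (g * h) (.inr (i, j)) = ∑ l, coords g (.inr (l, j)) * coords h (.inr (i, l)) := by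
  have : (g * h)⁻¹ = h⁻¹ * g⁻¹ := _root_.mul_inv_rev g h
  simp only [coords, Sum.elim_inr, this, Units.val_mul, Matrix.mul_apply, mul_comm]

theorem coords_inv (g : GL (Fin n) k) : coords g⁻¹ = coords g ∘ Sum.swap := by
  ext (c | c) <;> simp [coords]

theorem coords_injective : Function.Injective (coords : GL (Fin n) k → Coord n → k) := by
  intro g h hgh
  ext i j
  exact congrFun hgh (.inl (i, j))

theorem coordRing_comul (G : Subgroup (GL (Fin n) k)) (P : MvPolynomial (Coord n) k) :
    ∃ (ι : Type) (_ : Fintype ι) (a b : ι → coordRing G), ∀ g h : G,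
      eval (coords ((g * h : G) : GL (Fin n) k)) P = ∑ i, (a i : G → k) g * (b i : G → k) h := by
  have hc : ∀ c, (fun g : G => coords (g : GL (Fin n) k) c) ∈ coordRing G := fun c =>
    mem_coordRing.mpr ⟨X c, fun g => by simp⟩
  induction P using MvPolynomial.induction_on with
  | C c => exact ⟨Unit, inferInstance, fun _ => algebraMap k _ c, fun _ => 1, fun g h => by simp⟩
  | add p q hp hq =>
    obtain ⟨ι, _, a, b, h⟩ := hp
    obtain ⟨ι', _, a', b', h'⟩ := hq
    exact ⟨ι ⊕ ι', inferInstance, Sum.elim a a', Sum.elim b b', fun x y => by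
      rw [map_add, h, h']
      simp⟩
  | mul_X p c hp =>
    obtain ⟨ι, _, a, b, h⟩ := hp
    rcases c with ⟨i, j⟩ | ⟨i, j⟩
    · refine ⟨ι × Fin n, inferInstance, fun q => a q.1 * ⟨_, hc (.inl (i, q.2))⟩,
        fun q => b q.1 * ⟨_, hc (.inl (q.2, j))⟩, fun x y => ?_⟩
      rw [map_mul, h, eval_X, Subgroup.coe_mul, coords_mul_inl, Finset.sum_mul_sum,
        ← Fintype.sum_prod_type']
      exact Finset.sum_congr rfl fun q _ => mul_mul_mul_comm _ _ _ _
    · refine ⟨ι × Fin n, inferInstance, fun q => a q.1 * ⟨_, hc (.inr (q.2, j))⟩,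
        fun q => b q.1 * ⟨_, hc (.inr (i, q.2))⟩, fun x y => ?_⟩
      rw [map_mul, h, eval_X, Subgroup.coe_mul, coords_mul_inr, Finset.sum_mul_sum,
        ← Fintype.sum_prod_type']
      exact Finset.sum_congr rfl fun q _ => mul_mul_mul_comm _ _ _ _

theorem coordRing_finiteType (G : Subgroup (GL (Fin n) k)) :
    Algebra.FiniteType k (coordRing G) :=
  Algebra.FiniteType.of_surjective _ (AlgHom.rangeRestrict_surjective _)

theorem coordRing_isReg_mul_left (G : Subgroup (GL (Fin n) k)) (h : G) :
    IsReg (coordRing G) (fun x => h * x) := by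
  intro f hf
  obtain ⟨P, hP⟩ := mem_coordRing.mp hf
  obtain ⟨ι, _, a, b, hab⟩ := coordRing_comul G P
  simp only [hP, hab]
  exact sum_apply_mem _ _ fun i _ => mul_apply_mem (const_mem _) (b i).2

/-- The complement of a subset that is open for the Zariski topology of `G` is closed. -/
theorem isZClosed_image_compl {G : Subgroup (GL (Fin n) k)}
    (hG : IsZClosed (G : Set (GL (Fin n) k))) (U : Set G)
    (hU : ∀ x ∈ U, ∃ s : coordRing G, (s : G → k) x ≠ 0 ∧ ∀ y, (s : G → k) y ≠ 0 → y ∈ U) :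
    IsZClosed (Subtype.val '' Uᶜ) := by
  obtain ⟨I, hI⟩ := hG
  refine ⟨I ∪ {P | ∀ z ∈ Uᶜ, eval (coords (z : GL (Fin n) k)) P = 0}, Set.ext fun g => ⟨?_, ?_⟩⟩
  · rintro ⟨z, hz, rfl⟩ P (hP | hP)
    · exact (hI ▸ z.2 : (z : GL (Fin n) k) ∈ {g | ∀ P ∈ I, eval (coords g) P = 0}) P hP
    · exact hP z hz
  · intro hg
    have hgG : g ∈ (G : Set (GL (Fin n) k)) := hI ▸ fun P hP => hg P (Or.inl hP)
    refine ⟨⟨g, hgG⟩, fun hgU => ?_, rfl⟩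
    obtain ⟨s, hs, hsU⟩ := hU _ hgU
    obtain ⟨P, hP⟩ := mem_coordRing.mp s.2
    refine hs ((hP _).trans (hg P (Or.inr fun z hz => ?_)))
    rw [← hP]
    exact by_contra fun h => hz (hsU z h)

theorem coordRing_mul_eq_zero {G : Subgroup (GL (Fin n) k)}
    (hG : IsZClosed (G : Set (GL (Fin n) k))) (hconn : IsZConnected (G : Set (GL (Fin n) k)))
    (s f : coordRing G) (hsf : s * f = 0) : s = 0 ∨ f = 0 := by
  have := coordRing_finiteType G
  have : IsNoetherianRing (coordRing G) := Algebra.FiniteType.isNoetherianRing k _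
  by_contra! hne
  obtain ⟨x, hx⟩ : ∃ x, (s : G → k) x ≠ 0 := by
    by_contra! h
    exact hne.1 (Subtype.ext (funext h))
  have hloc := exists_localKernel_eq (coordRing_isReg_mul_left G)
  let U : Set G := {y | localKernel (coordRing G) y = localKernel (coordRing G) x}
  have hclosed := isZClosed_image_compl hG U fun y hy => by
    obtain ⟨t, ht, h⟩ := hloc y
    exact ⟨t, ht, fun z hz => (h z hz).trans hy⟩
  have hclosed' := isZClosed_image_compl hG Uᶜ fun y hy => by
    obtain ⟨t, ht, h⟩ := hloc y
    exact ⟨t, ht, fun z hz hzU => hy ((h z hz).symm.trans hzU)⟩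
  rw [compl_compl] at hclosed'
  have hcover : (G : Set (GL (Fin n) k)) ⊆ Subtype.val '' U ∪ Subtype.val '' Uᶜ := by
    intro y hy
    rw [← Set.image_union, Set.union_compl_self]
    exact ⟨⟨y, hy⟩, trivial, rfl⟩
  have hdisj : (G : Set (GL (Fin n) k)) ∩ (Subtype.val '' U ∩ Subtype.val '' Uᶜ) = ∅ := by
    rw [← Set.image_inter Subtype.val_injective, Set.inter_compl_self, Set.image_empty,
      Set.inter_empty]
  have hU : ∀ y, y ∈ U := by
    rcases hconn _ _ hclosed' hclosed hcover hdisj with h | h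
    · exact absurd h (Set.Nonempty.ne_empty ⟨x, x.2, x, rfl, rfl⟩)
    · intro y
      by_contra hy
      exact absurd h (Set.Nonempty.ne_empty ⟨y, y.2, y, hy, rfl⟩)
  refine hne.2 (Subtype.ext (funext fun y => ?_))
  have : f ∈ localKernel (coordRing G) y := (hU y).ge ⟨s, hx, hsf⟩
  exact apply_eq_zero_of_mem_localKernel this

theorem coordRing_exists_point {G : Subgroup (GL (Fin n) k)}
    (hG : IsZClosed (G : Set (GL (Fin n) k))) (φ : coordRing G →ₐ[k] k) :
    ∃ γ, ∀ f : coordRing G, φ f = (f : G → k) γ := by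
  let π : MvPolynomial (Coord n) k →ₐ[k] coordRing G := (restrictToGroup G).rangeRestrict
  have hπ : ∀ P (g : G), (π P : G → k) g = eval (coords (g : GL (Fin n) k)) P :=
    restrictToGroup_apply G
  let p : Coord n → k := fun c => φ (π (X c))
  have hp : ∀ P, φ (π P) = eval p P := by
    intro P
    have : φ.comp π = aeval p := by
      ext c
      simp [p]
    exact (AlgHom.congr_fun this P).trans (RingHom.congr_fun (coe_aeval_eq_eval _) P)
  have hzero : ∀ P, (∀ g : G, eval (coords (g : GL (Fin n) k)) P = 0) → eval p P = 0 := by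
    intro P hP
    have : π P = 0 := by
      ext g
      rw [hπ, hP]
      rfl
    rw [← hp, this, map_zero]
  have hxy : of (fun i j => p (.inl (i, j))) * of (fun i j => p (.inr (i, j))) = 1 := by
    ext i j
    let P : MvPolynomial (Coord n) k :=
      ∑ l, X (.inl (i, l)) * X (.inr (l, j)) - C ((1 : Matrix (Fin n) (Fin n) k) i j)
    have hP : ∀ q, eval q P =
        ∑ l, q (.inl (i, l)) * q (.inr (l, j)) - (1 : Matrix (Fin n) (Fin n) k) i j := fun q => by
      simp only [P, map_sub, map_sum, map_mul, eval_X, eval_C]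
    have h1 := hzero P fun g => (hP _).trans
      (sub_eq_zero.mpr (congrFun (congrFun (Units.mul_inv (g : GL (Fin n) k)) i) j))
    rw [hP] at h1
    exact sub_eq_zero.mp h1
  let γ : GL (Fin n) k := ⟨_, _, hxy, mul_eq_one_comm.mp hxy⟩
  have hγ : coords γ = p := by
    ext (c | c) <;> rfl
  have hγG : γ ∈ (G : Set (GL (Fin n) k)) := by
    obtain ⟨I, hI⟩ := hG
    rw [hI]
    intro P hP
    rw [hγ]
    refine hzero P fun g => ?_
    exact (hI ▸ g.2 : (g : GL (Fin n) k) ∈ {g | ∀ P ∈ I, eval (coords g) P = 0}) P hP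
  refine ⟨⟨γ, hγG⟩, fun f => ?_⟩
  obtain ⟨P, rfl⟩ := AlgHom.rangeRestrict_surjective _ f
  exact (hp P).trans ((congrArg (fun p => eval p P) hγ).symm.trans (hπ P ⟨γ, hγG⟩).symm)

theorem coordRing_isCoordRing {G : Subgroup (GL (Fin n) k)}
    (hG : IsZClosed (G : Set (GL (Fin n) k))) (hconn : IsZConnected (G : Set (GL (Fin n) k))) :
    IsCoordRing (coordRing G) where
  fg := (coordRing G).fg_iff_finiteType.mpr (coordRing_finiteType G)
  mul_eq_zero f hf g hg h :=
    (coordRing_mul_eq_zero hG hconn ⟨f, hf⟩ ⟨g, hg⟩ (Subtype.ext h)).imp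
      (congrArg Subtype.val) (congrArg Subtype.val)
  comul f hf := by
    obtain ⟨P, hP⟩ := mem_coordRing.mp hf
    obtain ⟨ι, _, a, b, h⟩ := coordRing_comul G P
    let e := (Fintype.equivFin ι).symm
    refine ⟨_, a ∘ e, b ∘ e, fun x y => ?_⟩
    rw [hP, h]
    exact (Equiv.sum_comp e _).symm
  inv f hf := by
    obtain ⟨P, hP⟩ := mem_coordRing.mp hf
    refine mem_coordRing.mpr ⟨rename Sum.swap P, fun g => ?_⟩
    rw [hP, eval_rename, Subgroup.coe_inv, coords_inv]
  exists_point := coordRing_exists_point hG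
  separates x y h := Subtype.ext <| coords_injective <| funext fun c =>
    h (fun g => coords (g : GL (Fin n) k) c) (mem_coordRing.mpr ⟨X c, fun g => by simp⟩)

/-- The endomorphism of the group of points given by a surjective isogeny. -/
def isogenyHom {G : Subgroup (GL (Fin n) k)} {F : GL (Fin n) k → GL (Fin n) k}
    (hF : IsIsogeny G G F) : G →* G :=
  MonoidHom.mk' (fun g => ⟨F g, hF.maps g g.2⟩) fun g h => Subtype.ext (hF.hom g g.2 h h.2)

theorem isReg_isogenyHom {G : Subgroup (GL (Fin n) k)} {F : GL (Fin n) k → GL (Fin n) k}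
    (hF : IsIsogeny G G F) : IsReg (coordRing G) (isogenyHom hF) := by
  intro f hf
  obtain ⟨P, hP⟩ := mem_coordRing.mp hf
  obtain ⟨Q, hQ⟩ := hF.regular
  refine mem_coordRing.mpr ⟨bind₁ Q P, fun g => ?_⟩
  have h1 : eval (coords (g : GL (Fin n) k)) (bind₁ Q P) =
      eval (fun i => eval (coords (g : GL (Fin n) k)) (Q i)) P := eval₂Hom_bind₁ _ _ _ _
  rw [hP, h1]
  exact congrArg (fun p => eval p P) (hQ g g.2)

section Transitive

variable {Γ : Type} [Group Γ] {A : Subalgebra k (Γ → k)}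

/-- If finitely many twisted conjugacy classes cover the group, then one of them is everything. -/
theorem exists_forall_exists_twisted_conj_eq [IsAlgClosed k] (hA : IsCoordRing A) {F : Γ →* Γ}
    (hF : IsReg A F) (hsurj : Function.Surjective F) (R : Finset Γ)
    (hR : ∀ x, ∃ r ∈ R, ∃ g, g * r * (F g)⁻¹ = x) : ∃ r, ∀ x, ∃ g, g * r * (F g)⁻¹ = x := by
  obtain ⟨r, -, hr⟩ : ∃ r ∈ R, ∀ f ∈ A, (∀ g, f (g * r * (F g)⁻¹) = 0) → f = 0 := by
    by_contra! hcon
    choose! f hfA hf0 hf using hcon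
    obtain ⟨x, hx⟩ := hA.exists_ne_zero R f hfA hf
    obtain ⟨r, hr, g, rfl⟩ := hR x
    exact hx r hr (hf0 r hr g)
  let F' : Γ →* Γ := (MulAut.conj r).toMonoidHom.comp F
  have hF' : ∀ g, lang F' g = g * r * (F g)⁻¹ * r⁻¹ := fun g => by simp [F', lang, mul_assoc]
  have hdom : IsDominant A F' := by
    refine ⟨hA.isReg_mul (hA.isReg_mul (isReg_const r) hF) (isReg_const r⁻¹),
      (MulAut.conj r).surjective.comp hsurj, fun f hf h => ?_⟩
    have h1 := hr (fun x => f (x * r⁻¹)) (hA.isReg_mul isReg_id (isReg_const r⁻¹) f hf)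
      fun g => hF' g ▸ h g
    ext x
    simpa using congrFun h1 (x * r)
  refine ⟨r, fun x => ?_⟩
  obtain ⟨g, hg⟩ := lang_surjective hA hdom (x * r⁻¹)
  exact ⟨g, mul_right_cancel ((hF' g).symm.trans hg)⟩

end Transitive

end

end FConjugation

/-- If the action of a connected affine algebraic group `G` on itself by
`F`-conjugation `(g, x) ↦ g·x·F(g)⁻¹` (for an isogeny `F`) has only finitely many
orbits, then it is transitive. -/
theorem fConjugation_transitive_of_finitely_many_orbits
    {k : Type} [Field k] [IsAlgClosed k] {n : ℕ}
    (G : Subgroup (GL (Fin n) k))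
    (hGcl : IsZClosed (G : Set (GL (Fin n) k)))
    (hGconn : IsZConnected (G : Set (GL (Fin n) k)))
    (F : GL (Fin n) k → GL (Fin n) k) (hF : IsIsogeny G G F)
    (horb : ∃ R : Finset (GL (Fin n) k), (↑R : Set (GL (Fin n) k)) ⊆ (G : Set (GL (Fin n) k)) ∧
      ∀ x ∈ G, ∃ r ∈ R, ∃ g ∈ G, g * r * (F g)⁻¹ = x) :
    ∀ x ∈ G, ∀ y ∈ G, ∃ g ∈ G, g * x * (F g)⁻¹ = y := by
  classical
  obtain ⟨R, hRG, hR⟩ := horb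
  have hsurj : Function.Surjective (FConjugation.isogenyHom hF) := fun h => by
    obtain ⟨g, hg, hgh⟩ := hF.surj h h.2
    exact ⟨⟨g, hg⟩, Subtype.ext hgh⟩
  obtain ⟨r, hr⟩ := FConjugation.exists_forall_exists_twisted_conj_eq
    (FConjugation.coordRing_isCoordRing hGcl hGconn) (FConjugation.isReg_isogenyHom hF) hsurj
    (R.subtype (· ∈ G)) fun x => by
      obtain ⟨r, hr, g, hg, h⟩ := hR x x.2
      exact ⟨⟨r, hRG hr⟩, Finset.mem_subtype.mpr hr, ⟨g, hg⟩, Subtype.ext h⟩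
  intro x hx y hy
  obtain ⟨a, ha⟩ := hr ⟨x, hx⟩
  obtain ⟨b, hb⟩ := hr ⟨y, hy⟩
  have hab : b * a⁻¹ * ⟨x, hx⟩ * (FConjugation.isogenyHom hF (b * a⁻¹))⁻¹ = ⟨y, hy⟩ := by
    rw [← ha, ← hb, map_mul, map_inv]
    group
  exact ⟨_, (b * a⁻¹).2, congrArg Subtype.val hab⟩

end
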